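/- Let β ∈ (1, 2) and let X and Y be independent random variables with values in separable metric spaces (𝒳, d) and (𝒴, d) that admit isometric embeddings into separable Hilbert spaces, with 𝒳 × 𝒴 σ-compact. Let Z := (X, Y), θ := L(Z), and θₙ the empirical measure of Z₁, ..., Zₙ, where (Z_k)_{k∈ℕ} is strictly stationary with L(Z₁) = θ. If X and Y have finite (1+ε)β-moments for some ε > 0 and (Z_k) is absolutely regular with β(n) = O(n^{-r}) for some r > 6(1 + 2ε^{-1}), then n·dcov_β(θₙ) converges in distribution to Σ_{k=1}^∞ λ_k ζ_k², where (λ_k, φ_k) are the non-negative eigenvalue/eigenfunction pairs of the integral operator f ↦ ∫ δ_θ^{(β)}(·, z) f(z) dθ(z) on L²(θ) and (ζ_k) are centered Gaussian variables with Cov(ζ_i, ζ_j) = lim_n n^{-1} Σ_{t,u=1}^n Cov(φ_i(Z_t), φ_j(Z_u)). -/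

import Mathlib

open MeasureTheory Filter Topology ProbabilityTheory
open scoped ENNReal NNReal

noncomputable section

/-- The shift map on path space. -/
def shift {𝒵 : Type*} (x : ℕ → 𝒵) : ℕ → 𝒵 := fun i => x (i + 1)

/-- Empirical measure of `Z₁, …, Zₙ` (indexed here as `Z 0, …, Z (n-1)`). -/
def emp {Ω 𝒵 : Type*} [MeasurableSpace 𝒵] (Z : ℕ → Ω → 𝒵) (n : ℕ) (ω : Ω) : Measure 𝒵 :=
  (n : ℝ≥0∞)⁻¹ • ∑ k ∈ Finset.range n, Measure.dirac (Z k ω)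

/-- `a_μ(x) = ∫ ρ(x,x') dμ(x')`. -/
def aM {X : Type*} [MeasurableSpace X] (ρ : X → X → ℝ) (μ : Measure X) (x : X) : ℝ :=
  ∫ x', ρ x x' ∂μ

/-- `D(μ) = ∫ ρ(x,x') dμ²(x,x')`. -/
def DM {X : Type*} [MeasurableSpace X] (ρ : X → X → ℝ) (μ : Measure X) : ℝ :=
  ∫ p : X × X, ρ p.1 p.2 ∂(μ.prod μ)

/-- `d_μ(x,x') = ρ(x,x') - a_μ(x) - a_μ(x') + D(μ)`. -/
def dM {X : Type*} [MeasurableSpace X] (ρ : X → X → ℝ) (μ : Measure X) (x x' : X) : ℝ :=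
  ρ x x' - aM ρ μ x - aM ρ μ x' + DM ρ μ

/-- `δ_θ(z,z') = d_μ(x,x') d_ν(y,y')` where `μ, ν` are the marginals of `θ`. -/
def deltaTheta {X Y : Type*} [MeasurableSpace X] [MeasurableSpace Y]
    (ρX : X → X → ℝ) (ρY : Y → Y → ℝ) (θ : Measure (X × Y)) (z z' : X × Y) : ℝ :=
  dM ρX (θ.map Prod.fst) z.1 z'.1 * dM ρY (θ.map Prod.snd) z.2 z'.2

/-- The distance covariance `dcov(θ) = ∫ δ_θ dθ²` w.r.t. the (pseudo)metrics `ρX, ρY`;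
for `ρX = dX^β`, `ρY = dY^β` this is `dcov_β(θ)`. -/
def dcov {X Y : Type*} [MeasurableSpace X] [MeasurableSpace Y]
    (ρX : X → X → ℝ) (ρY : Y → Y → ℝ) (θ : Measure (X × Y)) : ℝ :=
  ∫ p : (X × Y) × (X × Y), deltaTheta ρX ρY θ p.1 p.2 ∂(θ.prod θ)

/-- The `β`-dependence (absolute regularity) coefficient of two sub-σ-algebras. -/
def betaDep {Ω : Type*} [MeasurableSpace Ω] (P : Measure Ω)
    (A B : MeasurableSpace Ω) : ℝ :=
  sSup {r | ∃ (I J : ℕ) (a : Fin I → Set Ω) (b : Fin J → Set Ω),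
    (∀ i, MeasurableSet[A] (a i)) ∧ (∀ j, MeasurableSet[B] (b j)) ∧
    Pairwise (Function.onFun Disjoint a) ∧ Pairwise (Function.onFun Disjoint b) ∧
    (⋃ i, a i) = Set.univ ∧ (⋃ j, b j) = Set.univ ∧
    r = (1 / 2) * ∑ i, ∑ j,
      |(P (a i ∩ b j)).toReal - (P (a i)).toReal * (P (b j)).toReal|}

/-- The σ-algebra generated by `Z 0, …, Z (l-1)`, i.e. by `Z₁, …, Z_l`. -/
def sigmaUpTo {Ω 𝒵 : Type*} [m𝒵 : MeasurableSpace 𝒵] (Z : ℕ → Ω → 𝒵) (l : ℕ) :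
    MeasurableSpace Ω :=
  ⨆ i ∈ Finset.range l, MeasurableSpace.comap (Z i) m𝒵

/-- The σ-algebra generated by `Z l, Z (l+1), …`. -/
def sigmaFrom {Ω 𝒵 : Type*} [m𝒵 : MeasurableSpace 𝒵] (Z : ℕ → Ω → 𝒵) (l : ℕ) :
    MeasurableSpace Ω :=
  ⨆ i ∈ {i : ℕ | l ≤ i}, MeasurableSpace.comap (Z i) m𝒵

/-- The β-mixing coefficient `β(n) = sup_l β(σ(Z₁,…,Z_l), σ(Z_{l+n}, …))`. -/
def betaProc {Ω 𝒵 : Type*} [MeasurableSpace Ω] [MeasurableSpace 𝒵]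
    (P : Measure Ω) (Z : ℕ → Ω → 𝒵) (n : ℕ) : ℝ :=
  sSup {r | ∃ l : ℕ, r = betaDep P (sigmaUpTo Z (l + 1)) (sigmaFrom Z (l + n))}


section Mixing

/-- Mixing bound on finite partitions. -/
def MixLe {Ω : Type*} {mΩ : MeasurableSpace Ω} (P : Measure Ω) (A B : MeasurableSpace Ω) (c : ℝ) : Prop :=
  ∀ (I J : ℕ) (a : Fin I → Set Ω) (b : Fin J → Set Ω),
    (∀ i, MeasurableSet[A] (a i)) → (∀ j, MeasurableSet[B] (b j)) →
    Pairwise (Function.onFun Disjoint a) → Pairwise (Function.onFun Disjoint b) →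
    (⋃ i, a i) = Set.univ → (⋃ j, b j) = Set.univ →
    ∑ i, ∑ j, |(P (a i ∩ b j)).toReal - (P (a i)).toReal * (P (b j)).toReal| ≤ c

lemma sum_partition {Ω : Type*} [MeasurableSpace Ω] (P : Measure Ω) [IsProbabilityMeasure P]
    {J : ℕ} (b : Fin J → Set Ω) (hb : ∀ j, MeasurableSet (b j))
    (hd : Pairwise (Function.onFun Disjoint b)) (hu : (⋃ j, b j) = Set.univ) (s : Set Ω)
    (hs : MeasurableSet s) :
    ∑ j, (P (s ∩ b j)).toReal = (P s).toReal := by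
  have h1 : P s = ∑ j, P (s ∩ b j) := by
    conv_lhs => rw [← Set.inter_univ s, ← hu, Set.inter_iUnion]
    rw [measure_iUnion, tsum_fintype]
    · intro i j hij
      exact (hd hij).mono Set.inter_subset_right Set.inter_subset_right
    · exact fun j => hs.inter (hb j)
  rw [h1, ENNReal.toReal_sum]
  exact fun j _ => measure_ne_top _ _

lemma partition_sum_le {Ω : Type*} (A B : MeasurableSpace Ω) [m : MeasurableSpace Ω] (P : Measure Ω)
    [IsProbabilityMeasure P] (hA : A ≤ m) (hB : B ≤ m)
    (I J : ℕ) (a : Fin I → Set Ω) (b : Fin J → Set Ω)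
    (ha : ∀ i, MeasurableSet[A] (a i)) (hb : ∀ j, MeasurableSet[B] (b j))
    (hda : Pairwise (Function.onFun Disjoint a)) (hdb : Pairwise (Function.onFun Disjoint b))
    (hua : (⋃ i, a i) = Set.univ) (hub : (⋃ j, b j) = Set.univ) :
    ∑ i, ∑ j, |(P (a i ∩ b j)).toReal - (P (a i)).toReal * (P (b j)).toReal| ≤ 2 := by
  have ha' := fun i => hA _ (ha i)
  have hb' := fun i => hB _ (hb i)
  have e1 : ∑ j, (P (b j)).toReal = 1 := by
    have := sum_partition P b hb' hdb hub Set.univ MeasurableSet.univ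
    simpa using this
  have e2 : ∑ j, (P (a j)).toReal = 1 := by
    have := sum_partition P a ha' hda hua Set.univ MeasurableSet.univ
    simpa using this
  calc _ ≤ ∑ i, ∑ j, ((P (a i ∩ b j)).toReal + (P (a i)).toReal * (P (b j)).toReal) := by
        refine Finset.sum_le_sum fun i _ => Finset.sum_le_sum fun j _ => ?_
        refine (abs_sub _ _).trans (le_of_eq ?_)
        rw [abs_of_nonneg ENNReal.toReal_nonneg, abs_of_nonneg (by positivity)]
    _ = 2 := by
        simp_rw [Finset.sum_add_distrib, ← Finset.mul_sum, e1, mul_one]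
        rw [e2]
        have : ∀ i, ∑ j, (P (a i ∩ b j)).toReal = (P (a i)).toReal :=
          fun i => sum_partition P b hb' hdb hub _ (ha' i)
        simp_rw [this]
        rw [e2]; norm_num

variable {Ω 𝒵 : Type*} {A B : MeasurableSpace Ω} [mΩ : MeasurableSpace Ω] [m𝒵 : MeasurableSpace 𝒵]
set_option linter.unusedSectionVars false

lemma sigmaUpTo_le {Z : ℕ → Ω → 𝒵} (hZ : ∀ i, Measurable (Z i)) (l : ℕ) : sigmaUpTo Z l ≤ mΩ :=
  iSup₂_le fun i _ => (hZ i).comap_le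

lemma sigmaFrom_le {Z : ℕ → Ω → 𝒵} (hZ : ∀ i, Measurable (Z i)) (l : ℕ) : sigmaFrom Z l ≤ mΩ :=
  iSup₂_le fun i _ => (hZ i).comap_le

lemma meas_upTo (Z : ℕ → Ω → 𝒵) {i l : ℕ} (h : i < l) :
    Measurable[sigmaUpTo Z l] (Z i) := by
  apply Measurable.of_comap_le
  exact le_iSup₂_of_le (f := fun i (_ : i ∈ Finset.range l) => MeasurableSpace.comap (Z i) m𝒵)
    i (Finset.mem_range.2 h) le_rfl

lemma meas_from (Z : ℕ → Ω → 𝒵) {i l : ℕ} (h : l ≤ i) :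
    Measurable[sigmaFrom Z l] (Z i) := by
  apply Measurable.of_comap_le
  exact le_iSup₂_of_le (f := fun i (_ : i ∈ {i : ℕ | l ≤ i}) => MeasurableSpace.comap (Z i) m𝒵)
    i h le_rfl

lemma betaDep_bdd (P : Measure Ω) [IsProbabilityMeasure P] (hA : A ≤ mΩ) (hB : B ≤ mΩ) :
    ∀ r ∈ {r | ∃ (I J : ℕ) (a : Fin I → Set Ω) (b : Fin J → Set Ω),
    (∀ i, MeasurableSet[A] (a i)) ∧ (∀ j, MeasurableSet[B] (b j)) ∧
    Pairwise (Function.onFun Disjoint a) ∧ Pairwise (Function.onFun Disjoint b) ∧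
    (⋃ i, a i) = Set.univ ∧ (⋃ j, b j) = Set.univ ∧
    r = (1 / 2) * ∑ i, ∑ j,
      |(P (a i ∩ b j)).toReal - (P (a i)).toReal * (P (b j)).toReal|}, r ≤ 1 := by
  rintro r ⟨I, J, a, b, ha, hb, hda, hdb, hua, hub, rfl⟩
  have := partition_sum_le A B P hA hB I J a b ha hb hda hdb hua hub
  linarith

lemma mixLe_betaDep (P : Measure Ω) [IsProbabilityMeasure P] (hA : A ≤ mΩ) (hB : B ≤ mΩ) : MixLe P A B (2 * betaDep P A B) := by
  intro I J a b ha hb hda hdb hua hub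
  have : (1 / 2) * ∑ i, ∑ j,
      |(P (a i ∩ b j)).toReal - (P (a i)).toReal * (P (b j)).toReal| ≤ betaDep P A B := 
    le_csSup ⟨1, betaDep_bdd P hA hB⟩ ⟨I, J, a, b, ha, hb, hda, hdb, hua, hub, rfl⟩
  linarith

lemma betaDep_le_one (P : Measure Ω) [IsProbabilityMeasure P] (hA : A ≤ mΩ) (hB : B ≤ mΩ) : betaDep P A B ≤ 1 :=
  Real.sSup_le (betaDep_bdd P hA hB) zero_le_one

lemma betaDep_nonneg (P : Measure Ω) : 0 ≤ betaDep P A B := by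
  apply Real.sSup_nonneg
  rintro r ⟨I, J, a, b, _, _, _, _, _, _, rfl⟩
  positivity

lemma betaDep_le_betaProc (P : Measure Ω) [IsProbabilityMeasure P] {Z : ℕ → Ω → 𝒵}
    (hZ : ∀ i, Measurable (Z i)) (l n : ℕ) :
    betaDep P (sigmaUpTo Z (l + 1)) (sigmaFrom Z (l + n)) ≤ betaProc P Z n := by
  refine le_csSup ⟨1, ?_⟩ ⟨l, rfl⟩
  rintro r ⟨l, rfl⟩
  exact betaDep_le_one P (sigmaUpTo_le hZ _) (sigmaFrom_le hZ _)

lemma betaProc_nonneg (P : Measure Ω) (Z : ℕ → Ω → 𝒵) (n : ℕ) : 0 ≤ betaProc P Z n := by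
  apply Real.sSup_nonneg
  rintro r ⟨l, rfl⟩
  exact betaDep_nonneg _

lemma mixLe_betaProc (P : Measure Ω) [IsProbabilityMeasure P] {Z : ℕ → Ω → 𝒵}
    (hZ : ∀ i, Measurable (Z i)) (l n : ℕ) :
    MixLe P (sigmaUpTo Z (l + 1)) (sigmaFrom Z (l + n)) (2 * betaProc P Z n) := by
  intro I J a b ha hb hda hdb hua hub
  refine (mixLe_betaDep P (sigmaUpTo_le hZ _) (sigmaFrom_le hZ _) I J a b ha hb hda hdb hua
    hub).trans ?_
  have := betaDep_le_betaProc P hZ l n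
  linarith

lemma MixLe.fintype {P : Measure Ω} {c : ℝ} (h : MixLe P A B c)
    {ι κ : Type*} [Fintype ι] [Fintype κ] (a : ι → Set Ω) (b : κ → Set Ω)
    (ha : ∀ i, MeasurableSet[A] (a i)) (hb : ∀ j, MeasurableSet[B] (b j))
    (hda : Pairwise (Function.onFun Disjoint a)) (hdb : Pairwise (Function.onFun Disjoint b))
    (hua : (⋃ i, a i) = Set.univ) (hub : (⋃ j, b j) = Set.univ) :
    ∑ i, ∑ j, |P.real (a i ∩ b j) - P.real (a i) * P.real (b j)| ≤ c := by
  let e := (Fintype.equivFin ι).symm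
  let e' := (Fintype.equivFin κ).symm
  have := h _ _ (a ∘ e) (b ∘ e') (fun i => ha _) (fun i => hb _)
    (fun i j hij => hda (e.injective.ne hij)) (fun i j hij => hdb (e'.injective.ne hij))
    (by rw [← hua]; exact e.surjective.iUnion_comp a) (by rw [← hub]; exact e'.surjective.iUnion_comp b)
  rw [← e.sum_comp]
  refine le_trans (le_of_eq ?_) this
  refine Finset.sum_congr rfl fun i _ => ?_
  rw [← e'.sum_comp]
  rfl

variable {E F G : Type*} [NormedAddCommGroup E] [NormedSpace ℝ E] 
  [NormedAddCommGroup F] [NormedSpace ℝ F]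
  [NormedAddCommGroup G] [NormedSpace ℝ G]

/-- `U` takes finitely many values, on `A`-measurable fibres. -/
structure FinFib (A : MeasurableSpace Ω) (U : Ω → E) (S : Finset E) : Prop where
  mem : ∀ ω, U ω ∈ S
  ran : ∀ x ∈ S, ∃ ω, U ω = x
  meas : ∀ x, MeasurableSet[A] (U ⁻¹' {x})

lemma exists_finFib {Ω E : Type*} [A : MeasurableSpace Ω] [NormedAddCommGroup E] [NormedSpace ℝ E]
    {U : Ω → E} {a : ℝ} (hUm : StronglyMeasurable U) (hU : ∀ ω, ‖U ω‖ ≤ a) (ha : 0 ≤ a) :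
    ∃ (Un : ℕ → Ω → E) (S : ℕ → Finset E), (∀ n, FinFib A (Un n) (S n)) ∧ (∀ n ω, ‖Un n ω‖ ≤ a) ∧
      (∀ n, StronglyMeasurable (Un n)) ∧
      ∀ ω, Tendsto (fun n => Un n ω) atTop (𝓝 (U ω)) := by
  classical
  refine ⟨fun n => hUm.approxBounded a n, fun n => (hUm.approxBounded a n).range,
    fun n => ⟨fun ω => SimpleFunc.mem_range_self _ _, fun x hx => SimpleFunc.mem_range.1 hx, fun x => SimpleFunc.measurableSet_fiber _ _⟩,
    fun n ω => hUm.norm_approxBounded_le ha n ω,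
    fun n => SimpleFunc.stronglyMeasurable _,
    fun ω => hUm.tendsto_approxBounded_of_norm_le (hU ω)⟩

lemma FinFib.ind {U : Ω → E} {S : Finset E} (h : FinFib A U S) (g : E → Ω → G) (ω : Ω) :
    g (U ω) ω = ∑ x : S, (U ⁻¹' {x.1}).indicator (g x) ω := by
  classical
  rw [Finset.sum_eq_single (⟨U ω, h.mem ω⟩ : S)]
  · simp
  · intro b _ hb
    rw [Set.indicator_of_notMem]
    intro h
    apply hb
    ext
    exact h.symm
  · simp

lemma simple_integral {U : Ω → E} {S : Finset E} (h : FinFib A U S)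
    (hA : A ≤ mΩ) (P : Measure Ω) [IsProbabilityMeasure P]
    [CompleteSpace G] (g : E → G) (s : Set Ω) :
    ∫ ω in s, g (U ω) ∂P = ∑ x : S, P.real ((U ⁻¹' {x.1}) ∩ s) • g x := by
  have hm : ∀ x, MeasurableSet (U ⁻¹' {x}) := fun x => hA _ (h.meas x)
  simp_rw [fun ω => h.ind (fun x _ => g x) ω]
  rw [integral_finsetSum]
  · refine Finset.sum_congr rfl fun x _ => ?_
    rw [integral_indicator_const _ (hm x)]
    rw [measureReal_restrict_apply (hm x)]
  · intro x _
    exact (integrable_const _).indicator (hm x)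

lemma cov_simple (hA : A ≤ mΩ) (hB : B ≤ mΩ)
    (P : Measure Ω) [IsProbabilityMeasure P] {c : ℝ} (h : MixLe P A B c)
    [CompleteSpace E] [CompleteSpace F] [CompleteSpace G]
    (L : E →L[ℝ] F →L[ℝ] G) {U : Ω → E} {S : Finset E} (hUf : FinFib A U S)
    {V : Ω → F} {T : Finset F} (hVf : FinFib B V T) (hVs : AEStronglyMeasurable V P) {a b : ℝ}
    (hU : ∀ ω, ‖U ω‖ ≤ a) (hV : ∀ ω, ‖V ω‖ ≤ b) (ha : 0 ≤ a) :
    ‖∫ ω, L (U ω) (V ω) ∂P - L (∫ ω, U ω ∂P) (∫ ω, V ω ∂P)‖ ≤ ‖L‖ * a * b * c := by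
  classical
  have hmU : ∀ x, MeasurableSet (U ⁻¹' {x}) := fun x => hA _ (hUf.meas x)
  have hmV : ∀ x, MeasurableSet (V ⁻¹' {x}) := fun x => hB _ (hVf.meas x)
  have e1 : ∫ ω, U ω ∂P = ∑ x : S, P.real (U ⁻¹' {x.1}) • x.1 := by
    have := simple_integral hUf hA P id Set.univ
    simpa using this
  have e2 : ∫ ω, V ω ∂P = ∑ x : T, P.real (V ⁻¹' {x.1}) • x.1 := by
    have := simple_integral hVf hB P id Set.univ
    simpa using this
  have e3 : ∫ ω, L (U ω) (V ω) ∂P = ∑ x : S, ∑ y : T,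
      P.real (U ⁻¹' {x.1} ∩ V ⁻¹' {y.1}) • L x y := by
    simp_rw [fun ω => hUf.ind (fun x ω => L x (V ω)) ω]
    rw [integral_finsetSum]
    · refine Finset.sum_congr rfl fun x _ => ?_
      rw [integral_indicator (hmU x)]
      rw [simple_integral hVf hB P (fun y => L x y) _]
      simp_rw [Set.inter_comm]
    · intro x _
      refine Integrable.indicator ?_ (hmU x)
      refine (L x.1).integrable_comp ?_
      refine Integrable.of_bound hVs b (ae_of_all _ hV)
  have e4 : ∫ ω, L (U ω) (V ω) ∂P - L (∫ ω, U ω ∂P) (∫ ω, V ω ∂P) = ∑ x : S, ∑ y : T,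
      (P.real (U ⁻¹' {x.1} ∩ V ⁻¹' {y.1}) - P.real (U ⁻¹' {x.1}) * P.real (V ⁻¹' {y.1})) • L x y := by
    rw [e1, e2, e3]
    simp only [map_sum, map_smul, _root_.sum_apply,
      _root_.smul_apply, sub_smul, Finset.sum_sub_distrib, mul_smul]
    congr 1
    rw [Finset.sum_comm]
    refine Finset.sum_congr rfl fun x _ => ?_
    rw [Finset.smul_sum]
    refine Finset.sum_congr rfl fun y _ => ?_
    rw [smul_comm]
  rw [e4]
  have hb : ∀ (x : S) (y : T), ‖L x y‖ ≤ ‖L‖ * a * b := by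
    intro x y
    obtain ⟨ω, hω⟩ := hUf.ran _ x.2
    obtain ⟨ω', hω'⟩ := hVf.ran _ y.2
    rw [← hω, ← hω']
    refine (L.le_opNorm₂ _ _).trans ?_
    gcongr
    exacts [hU _, hV _]
  have key := h.fintype (fun x : S => U ⁻¹' {x.1}) (fun x : T => V ⁻¹' {x.1})
    (fun x => hUf.meas x) (fun x => hVf.meas x)
    (by
      intro x y hxy
      refine Set.disjoint_left.2 fun ω h1 h2 => hxy ?_
      ext; exact h1.symm.trans h2)
    (by
      intro x y hxy
      refine Set.disjoint_left.2 fun ω h1 h2 => hxy ?_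
      ext; exact h1.symm.trans h2)
    (by
      refine Set.eq_univ_of_forall fun ω => Set.mem_iUnion.2 ⟨⟨U ω, hUf.mem ω⟩, rfl⟩)
    (by
      refine Set.eq_univ_of_forall fun ω => Set.mem_iUnion.2 ⟨⟨V ω, hVf.mem ω⟩, rfl⟩)
  have hne : Nonempty Ω := by
    by_contra hne
    rw [not_nonempty_iff] at hne
    have := IsProbabilityMeasure.measure_univ (μ := P)
    rw [Set.univ_eq_empty_iff.2 hne] at this
    simp at this
  obtain ⟨ω0⟩ := hne
  have hb0 : 0 ≤ b := (norm_nonneg _).trans (hV ω0)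
  calc _ ≤ ∑ x : S, ∑ y : T,
      |P.real (U ⁻¹' {x.1} ∩ V ⁻¹' {y.1}) - P.real (U ⁻¹' {x.1}) * P.real (V ⁻¹' {y.1})| * (‖L‖ * a * b) := by
        refine (norm_sum_le _ _).trans (Finset.sum_le_sum fun x _ => ?_)
        refine (norm_sum_le _ _).trans (Finset.sum_le_sum fun y _ => ?_)
        rw [norm_smul, Real.norm_eq_abs]
        gcongr
        exact hb x y
    _ = (∑ x : S, ∑ y : T,
      |P.real (U ⁻¹' {x.1} ∩ V ⁻¹' {y.1}) - P.real (U ⁻¹' {x.1}) * P.real (V ⁻¹' {y.1})|) * (‖L‖ * a * b) := by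
        simp_rw [Finset.sum_mul]
    _ ≤ c * (‖L‖ * a * b) := by gcongr
    _ = _ := by ring

theorem cov_bounded (hA : A ≤ mΩ) (hB : B ≤ mΩ)
    (P : Measure Ω) [IsProbabilityMeasure P] {c : ℝ} (h : MixLe P A B c)
    [CompleteSpace E] [CompleteSpace F] [CompleteSpace G]
    (L : E →L[ℝ] F →L[ℝ] G) {U : Ω → E} {V : Ω → F} {a b : ℝ}
    (hUm : StronglyMeasurable[A] U) (hVm : StronglyMeasurable[B] V)
    (hU : ∀ ω, ‖U ω‖ ≤ a) (hV : ∀ ω, ‖V ω‖ ≤ b) (ha : 0 ≤ a) (hb : 0 ≤ b) :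
    ‖∫ ω, L (U ω) (V ω) ∂P - L (∫ ω, U ω ∂P) (∫ ω, V ω ∂P)‖ ≤ ‖L‖ * a * b * c := by
  obtain ⟨Un, S, fU, hUn, sU', tU⟩ := exists_finFib (A := A) hUm hU ha
  obtain ⟨Vn, T, fV, hVn, sV', tV⟩ := exists_finFib (A := B) hVm hV hb
  have sU : ∀ n, AEStronglyMeasurable (Un n) P :=
    fun n => ((sU' n).mono hA).aestronglyMeasurable
  have sV : ∀ n, AEStronglyMeasurable (Vn n) P :=
    fun n => ((sV' n).mono hB).aestronglyMeasurable
  have l1 : Tendsto (fun n => ∫ ω, Un n ω ∂P) atTop (𝓝 (∫ ω, U ω ∂P)) :=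
    tendsto_integral_of_dominated_convergence (fun _ => a) sU (integrable_const _)
      (fun n => ae_of_all _ (hUn n)) (ae_of_all _ tU)
  have l2 : Tendsto (fun n => ∫ ω, Vn n ω ∂P) atTop (𝓝 (∫ ω, V ω ∂P)) :=
    tendsto_integral_of_dominated_convergence (fun _ => b) sV (integrable_const _)
      (fun n => ae_of_all _ (hVn n)) (ae_of_all _ tV)
  have l3 : Tendsto (fun n => ∫ ω, L (Un n ω) (Vn n ω) ∂P) atTop (𝓝 (∫ ω, L (U ω) (V ω) ∂P)) := by
    refine tendsto_integral_of_dominated_convergence (fun _ => ‖L‖ * a * b) 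
      (fun n => L.aestronglyMeasurable_comp₂ (sU n) (sV n)) (integrable_const _)
      (fun n => ae_of_all _ fun ω => ?_) (ae_of_all _ fun ω => ?_)
    · refine (L.le_opNorm₂ _ _).trans ?_
      gcongr
      exacts [hUn _ _, hVn _ _]
    · exact (L.continuous₂.tendsto (U ω, V ω)).comp ((tU ω).prodMk_nhds (tV ω))
  have l4 := (l3.sub ((L.continuous₂.tendsto (∫ ω, U ω ∂P, ∫ ω, V ω ∂P)).comp (l1.prodMk_nhds l2))).norm
  exact le_of_tendsto' l4 fun n => cov_simple hA hB P h L (fU n) (fV n) (sV n) (hUn n) (hVn n) ha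

end Mixing

section Cov

variable {Ω 𝒵 : Type*} [mΩ : MeasurableSpace Ω] [m𝒵 : MeasurableSpace 𝒵]
set_option linter.unusedSectionVars false

/-- Bundled assumptions on the stationary mixing sequence. -/
structure MixSeq (P : Measure Ω) (Z : ℕ → Ω → 𝒵) (ε r C : ℝ) : Prop where
  meas : ∀ i, Measurable (Z i)
  stat : MeasurePreserving shift (P.map fun ω i => Z i ω) (P.map fun ω i => Z i ω)
  eps : 0 < ε
  hr : 6 * (1 + 2 / ε) < r
  mix : ∀ n : ℕ, 1 ≤ n → betaProc P Z n ≤ C * (n : ℝ) ^ (-r)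

variable {P : Measure Ω} [IsProbabilityMeasure P] {Z : ℕ → Ω → 𝒵} {ε r C : ℝ}

lemma MixSeq.C_nonneg (h : MixSeq P Z ε r C) : 0 ≤ C := by
  have h1 := h.mix 1 le_rfl
  have h2 := betaProc_nonneg P Z 1
  simp at h1
  linarith

lemma MixSeq.map_shift (h : MixSeq P Z ε r C) (s : ℕ) :
    P.map (fun ω i => Z (i + s) ω) = P.map (fun ω i => Z i ω) := by
  induction s with
  | zero => rfl
  | succ s ih =>
    have hm : Measurable (fun ω i => Z (i + s) ω) := measurable_pi_iff.2 fun i => h.meas _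
    have : (fun ω i => Z (i + (s + 1)) ω) = shift ∘ (fun ω i => Z (i + s) ω) := by
      funext ω i
      simp [shift, add_assoc, add_comm 1 s]
    rw [this, ← Measure.map_map h.stat.measurable hm, ih, h.stat.map_eq]

lemma MixSeq.integral_shift (h : MixSeq P Z ε r C) {G : Type*} [NormedAddCommGroup G]
    [NormedSpace ℝ G] (s : ℕ) {g : (ℕ → 𝒵) → G} (hg : StronglyMeasurable g) :
    ∫ ω, g (fun i => Z (i + s) ω) ∂P = ∫ ω, g (fun i => Z i ω) ∂P := by
  have hm : ∀ s, Measurable (fun ω i => Z (i + s) ω) :=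
    fun s => measurable_pi_iff.2 fun i => h.meas _
  have hm0 : Measurable (fun ω i => Z i ω) := measurable_pi_iff.2 fun i => h.meas _
  rw [← integral_map (hm s).aemeasurable hg.aestronglyMeasurable, h.map_shift,
    integral_map hm0.aemeasurable hg.aestronglyMeasurable]

lemma MixSeq.map_eq (h : MixSeq P Z ε r C) (s : ℕ) : P.map (Z s) = P.map (Z 0) := by
  have hm : ∀ s, Measurable (fun ω i => Z (i + s) ω) :=
    fun s => measurable_pi_iff.2 fun i => h.meas _
  have h1 := congrArg (fun μ => Measure.map (fun x : ℕ → 𝒵 => x 0) μ) (h.map_shift s)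
  have hm0 : Measurable (fun ω i => Z i ω) := measurable_pi_iff.2 fun i => h.meas _
  rw [Measure.map_map (measurable_pi_apply 0) (hm s),
    Measure.map_map (measurable_pi_apply 0) hm0] at h1
  simpa [Function.comp_def] using h1

lemma MixSeq.integral_eq (h : MixSeq P Z ε r C) {G : Type*} [NormedAddCommGroup G]
    [NormedSpace ℝ G] (s : ℕ) {g : 𝒵 → G} (hg : StronglyMeasurable g) :
    ∫ ω, g (Z s ω) ∂P = ∫ ω, g (Z 0 ω) ∂P := by
  rw [← integral_map (h.meas s).aemeasurable hg.aestronglyMeasurable, h.map_eq,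
    integral_map (h.meas 0).aemeasurable hg.aestronglyMeasurable]

lemma MixSeq.integrable_iff (h : MixSeq P Z ε r C) {G : Type*} [NormedAddCommGroup G]
    (s : ℕ) {g : 𝒵 → G} (hg : StronglyMeasurable g) :
    Integrable (fun ω => g (Z s ω)) P ↔ Integrable (fun ω => g (Z 0 ω)) P := by
  have h1 := integrable_map_measure (μ := P) (f := Z s) (g := g) hg.aestronglyMeasurable
    (h.meas s).aemeasurable
  have h2 := integrable_map_measure (μ := P) (f := Z 0) (g := g) hg.aestronglyMeasurable
    (h.meas 0).aemeasurable
  rw [h.map_eq] at h1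
  exact h1.symm.trans h2

/-- Centered functions in `L^{2+2ε}` with norm at most `N`. -/
structure Good {E : Type*} [NormedAddCommGroup E] [NormedSpace ℝ E]
    (P : Measure Ω) (Z : ℕ → Ω → 𝒵) (ε : ℝ) (V : 𝒵 → E) (N : ℝ) : Prop where
  sm : StronglyMeasurable V
  pos : 0 < N
  int : Integrable (fun ω => ‖V (Z 0 ω)‖ ^ (2 + 2 * ε)) P
  le : ∫ ω, ‖V (Z 0 ω)‖ ^ (2 + 2 * ε) ∂P ≤ N ^ (2 + 2 * ε)
  mean : ∫ ω, V (Z 0 ω) ∂P = 0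

lemma sq_le_of_lt {x M ε : ℝ} (hM : 0 < M) (hε : 0 < ε) (h : M ≤ x) :
    x ^ 2 ≤ M ^ (-(2 * ε)) * x ^ (2 + 2 * ε) := by
  have hx : 0 < x := hM.trans_le h
  rw [Real.rpow_add hx, Real.rpow_neg hM.le]
  have h1 : M ^ (2 * ε) ≤ x ^ (2 * ε) := Real.rpow_le_rpow hM.le h (by linarith)
  have h2 : 0 < M ^ (2 * ε) := Real.rpow_pos_of_pos hM _
  rw [Real.rpow_two, inv_mul_eq_div, le_div_iff₀ h2]
  gcongr

lemma sq_le_add {x N ε : ℝ} (hN : 0 < N) (hε : 0 < ε) (hx : 0 ≤ x) :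
    x ^ 2 ≤ N ^ 2 + N ^ (-(2 * ε)) * x ^ (2 + 2 * ε) := by
  rcases le_total x N with h | h
  · have : 0 ≤ N ^ (-(2 * ε)) * x ^ (2 + 2 * ε) := by positivity
    nlinarith
  · have := sq_le_of_lt hN hε h
    nlinarith [sq_nonneg N]

variable {E : Type*} [NormedAddCommGroup E] [NormedSpace ℝ E] {V : 𝒵 → E} {N : ℝ}

lemma rpow_neg_mul {N ε : ℝ} (hN : 0 < N) : N ^ (-(2 * ε)) * N ^ (2 + 2 * ε) = N ^ 2 := by
  rw [← Real.rpow_add hN, ← Real.rpow_two]; congr 1; ring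

lemma Good.sm_rpow (g : Good P Z ε V N) : StronglyMeasurable fun z => ‖V z‖ ^ (2 + 2 * ε) :=
  (g.sm.norm.measurable.pow_const _).stronglyMeasurable

lemma Good.int_s (h : MixSeq P Z ε r C) (g : Good P Z ε V N) (s : ℕ) :
    Integrable (fun ω => ‖V (Z s ω)‖ ^ (2 + 2 * ε)) P :=
  (h.integrable_iff s g.sm_rpow).2 g.int

lemma Good.le_s (h : MixSeq P Z ε r C) (g : Good P Z ε V N) (s : ℕ) :
    ∫ ω, ‖V (Z s ω)‖ ^ (2 + 2 * ε) ∂P ≤ N ^ (2 + 2 * ε) :=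
  (h.integral_eq s g.sm_rpow).trans_le g.le

lemma Good.mean_s (h : MixSeq P Z ε r C) (g : Good P Z ε V N) (s : ℕ) :
    ∫ ω, V (Z s ω) ∂P = 0 := (h.integral_eq s g.sm).trans g.mean

lemma Good.asm (h : MixSeq P Z ε r C) (g : Good P Z ε V N) (s : ℕ) :
    StronglyMeasurable (fun ω => V (Z s ω)) := g.sm.comp_measurable (h.meas s)

lemma Good.sq_int (h : MixSeq P Z ε r C) (g : Good P Z ε V N) (s : ℕ) :
    Integrable (fun ω => ‖V (Z s ω)‖ ^ 2) P := by
  refine Integrable.mono' ((integrable_const (N ^ 2)).add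
    ((g.int_s h s).const_mul (N ^ (-(2 * ε))))) ?_ (ae_of_all _ fun ω => ?_)
  · exact ((g.asm h s).norm.pow 2).aestronglyMeasurable
  · rw [Real.norm_of_nonneg (by positivity)]
    exact sq_le_add g.pos h.eps (norm_nonneg _)

lemma Good.sq_le (h : MixSeq P Z ε r C) (g : Good P Z ε V N) (s : ℕ) :
    ∫ ω, ‖V (Z s ω)‖ ^ 2 ∂P ≤ 2 * N ^ 2 := by
  calc _ ≤ ∫ ω, (N ^ 2 + N ^ (-(2 * ε)) * ‖V (Z s ω)‖ ^ (2 + 2 * ε)) ∂P := by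
        refine integral_mono (g.sq_int h s) ((integrable_const (N ^ 2)).add
          ((g.int_s h s).const_mul (N ^ (-(2 * ε))))) fun ω => sq_le_add g.pos h.eps (norm_nonneg _)
    _ = N ^ 2 + N ^ (-(2 * ε)) * ∫ ω, ‖V (Z s ω)‖ ^ (2 + 2 * ε) ∂P := by
        rw [integral_add (integrable_const (N ^ 2)) ((g.int_s h s).const_mul (N ^ (-(2 * ε)))),
          integral_const_mul]
        simp
    _ ≤ N ^ 2 + N ^ (-(2 * ε)) * N ^ (2 + 2 * ε) := by
        have := g.pos
        gcongr
        exact g.le_s h s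
    _ = _ := by rw [rpow_neg_mul g.pos]; ring

lemma Good.memLp (h : MixSeq P Z ε r C) (g : Good P Z ε V N) (s : ℕ) :
    MemLp (fun ω => V (Z s ω)) 2 P :=
  (memLp_two_iff_integrable_sq_norm (g.asm h s).aestronglyMeasurable).2 (g.sq_int h s)

lemma Good.integrable (h : MixSeq P Z ε r C) (g : Good P Z ε V N) (s : ℕ) :
    Integrable (fun ω => V (Z s ω)) P := (g.memLp h s).integrable (by norm_num)

/-- The truncated function. -/
def trn (V : 𝒵 → E) (M : ℝ) : 𝒵 → E := {z | ‖V z‖ ≤ M}.indicator V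

lemma trn_sm (hV : StronglyMeasurable V) (M : ℝ) : StronglyMeasurable (trn V M) :=
  hV.indicator (measurableSet_le hV.norm.measurable measurable_const)

lemma trn_le {M : ℝ} (hM : 0 ≤ M) (z : 𝒵) : ‖trn V M z‖ ≤ M := by
  by_cases hz : ‖V z‖ ≤ M
  · rwa [trn, Set.indicator_of_mem (by exact hz)]
  · rw [trn, Set.indicator_of_notMem (by exact hz)]; simpa

lemma trn_le' {M : ℝ} (z : 𝒵) : ‖trn V M z‖ ≤ ‖V z‖ := by
  by_cases hz : ‖V z‖ ≤ M
  · rw [trn, Set.indicator_of_mem (by exact hz)]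
  · rw [trn, Set.indicator_of_notMem (by exact hz)]; simp

lemma sub_trn_le' {M : ℝ} (z : 𝒵) : ‖V z - trn V M z‖ ≤ ‖V z‖ := by
  by_cases hz : ‖V z‖ ≤ M
  · rw [trn, Set.indicator_of_mem (by exact hz)]; simp
  · rw [trn, Set.indicator_of_notMem (by exact hz)]; simp

lemma sub_trn_sq {M ε : ℝ} (hM : 0 < M) (hε : 0 < ε) (z : 𝒵) :
    ‖V z - trn V M z‖ ^ 2 ≤ M ^ (-(2 * ε)) * ‖V z‖ ^ (2 + 2 * ε) := by
  by_cases hz : ‖V z‖ ≤ M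
  · rw [trn, Set.indicator_of_mem (by exact hz)]; simp; positivity
  · rw [trn, Set.indicator_of_notMem (by exact hz)]; simp only [sub_zero]
    exact sq_le_of_lt hM hε (not_le.1 hz).le

lemma Good.memLp_sub (h : MixSeq P Z ε r C) (g : Good P Z ε V N) (s : ℕ) (M : ℝ) :
    MemLp (fun ω => V (Z s ω) - trn V M (Z s ω)) 2 P :=
  (g.memLp h s).mono ((g.sm.sub (trn_sm g.sm M)).comp_measurable (h.meas s)).aestronglyMeasurable
    (ae_of_all _ fun _ => sub_trn_le' _)

lemma Good.memLp_trn (h : MixSeq P Z ε r C) (g : Good P Z ε V N) (s : ℕ) (M : ℝ) :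
    MemLp (fun ω => trn V M (Z s ω)) 2 P :=
  (g.memLp h s).mono ((trn_sm g.sm M).comp_measurable (h.meas s)).aestronglyMeasurable
    (ae_of_all _ fun _ => trn_le' _)

lemma Good.sub_trn_sq_le (h : MixSeq P Z ε r C) (g : Good P Z ε V N) (s : ℕ) {t : ℝ} (ht : 0 < t) :
    ∫ ω, ‖V (Z s ω) - trn V (N * t ^ (2 / ε)) (Z s ω)‖ ^ 2 ∂P ≤ N ^ 2 * t ^ (-4 : ℝ) := by
  have hN := g.pos
  have hε := h.eps
  set M := N * t ^ (2 / ε) with hMdef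
  have hM : 0 < M := by positivity
  calc _ ≤ ∫ ω, M ^ (-(2 * ε)) * ‖V (Z s ω)‖ ^ (2 + 2 * ε) ∂P := by
        refine integral_mono ?_ ((g.int_s h s).const_mul _) fun ω => sub_trn_sq hM h.eps _
        exact (memLp_two_iff_integrable_sq_norm (g.memLp_sub h s M).1).1 (g.memLp_sub h s M)
    _ ≤ M ^ (-(2 * ε)) * N ^ (2 + 2 * ε) := by
        rw [integral_const_mul]
        gcongr
        exact g.le_s h s
    _ = N ^ 2 * t ^ (-4 : ℝ) := by
        rw [hMdef, Real.mul_rpow hN.le (by positivity), mul_right_comm, rpow_neg_mul hN,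
          ← Real.rpow_mul ht.le]
        congr 2
        field_simp
        ring

lemma integral_norm_le_sq {U : Ω → E} (hU : MemLp U 2 P) {l : ℝ} (hl : 0 < l) :
    ‖∫ ω, U ω ∂P‖ ≤ (l * ∫ ω, ‖U ω‖ ^ 2 ∂P + l⁻¹) / 2 := by
  have hi := (memLp_two_iff_integrable_sq_norm hU.1).1 hU
  refine (norm_integral_le_integral_norm _).trans ?_
  calc _ ≤ ∫ ω, (l / 2 * ‖U ω‖ ^ 2 + l⁻¹ / 2) ∂P := by
        refine integral_mono (hU.integrable (by norm_num)).norm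
          ((hi.const_mul _).add (integrable_const _)) fun ω => ?_
        simp only
        have : l / 2 * ‖U ω‖ ^ 2 + l⁻¹ / 2 - ‖U ω‖ = l⁻¹ / 2 * (l * ‖U ω‖ - 1) ^ 2 := by
          field_simp; ring
        have : 0 ≤ l⁻¹ / 2 * (l * ‖U ω‖ - 1) ^ 2 := by positivity
        linarith
    _ = _ := by
        rw [integral_add (hi.const_mul _) (integrable_const _), integral_const_mul]
        simp; ring

variable {H : Type*} [NormedAddCommGroup H] [InnerProductSpace ℝ H]

lemma _root_.MeasureTheory.MemLp.integrable_inner_two {U W : Ω → H} (hU : MemLp U 2 P)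
    (hW : MemLp W 2 P) : Integrable (fun ω => inner ℝ (U ω) (W ω)) P := by
  have hi := (memLp_two_iff_integrable_sq_norm hU.1).1 hU
  have hj := (memLp_two_iff_integrable_sq_norm hW.1).1 hW
  refine (hi.add hj).mono' (hU.1.inner hW.1) (ae_of_all _ fun ω => ?_)
  refine (norm_inner_le_norm _ _).trans ?_
  simp only [Pi.add_apply]
  nlinarith [sq_nonneg (‖U ω‖ - ‖W ω‖), sq_nonneg ‖U ω‖, sq_nonneg ‖W ω‖]

lemma integral_inner_le_sq {U W : Ω → H} (hU : MemLp U 2 P) (hW : MemLp W 2 P) {l : ℝ} (hl : 0 < l) :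
    |∫ ω, inner ℝ (U ω) (W ω) ∂P| ≤ (l * ∫ ω, ‖U ω‖ ^ 2 ∂P + l⁻¹ * ∫ ω, ‖W ω‖ ^ 2 ∂P) / 2 := by
  have hi := (memLp_two_iff_integrable_sq_norm hU.1).1 hU
  have hj := (memLp_two_iff_integrable_sq_norm hW.1).1 hW
  rw [← Real.norm_eq_abs]
  refine (norm_integral_le_integral_norm _).trans ?_
  calc _ ≤ ∫ ω, (l / 2 * ‖U ω‖ ^ 2 + l⁻¹ / 2 * ‖W ω‖ ^ 2) ∂P := by
        refine integral_mono (hU.integrable_inner_two hW).norm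
          ((hi.const_mul _).add (hj.const_mul _)) fun ω => ?_
        simp only
        refine (norm_inner_le_norm _ _).trans ?_
        have : l / 2 * ‖U ω‖ ^ 2 + l⁻¹ / 2 * ‖W ω‖ ^ 2 - ‖U ω‖ * ‖W ω‖
          = l⁻¹ / 2 * (l * ‖U ω‖ - ‖W ω‖) ^ 2 := by
          field_simp; ring
        have : 0 ≤ l⁻¹ / 2 * (l * ‖U ω‖ - ‖W ω‖) ^ 2 := by positivity
        linarith
    _ = _ := by
        rw [integral_add (hi.const_mul _) (hj.const_mul _), integral_const_mul, integral_const_mul]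
        ring

theorem Good.cov_le [CompleteSpace H] (h : MixSeq P Z ε r C) {V : 𝒵 → H}
    (g : Good P Z ε V N) (s t : ℕ)
    (ht : 1 ≤ t) :
    |∫ ω, inner ℝ (V (Z s ω)) (V (Z (s + t) ω)) ∂P| ≤ (2 * C + 4) * N ^ 2 * ((t : ℝ) ^ 2)⁻¹ := by
  have hN := g.pos
  have hε := h.eps
  have hC := h.C_nonneg
  have ht1 : (1 : ℝ) ≤ t := by exact_mod_cast ht
  have ht0 : (0 : ℝ) < t := by linarith
  set M := N * (t : ℝ) ^ (2 / ε) with hMdef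
  have hM : 0 < M := by positivity
  have t4 : (t : ℝ) ^ (-4 : ℝ) = ((t : ℝ) ^ 4)⁻¹ := by
    rw [Real.rpow_neg ht0.le]; norm_cast
  have hsq : ∀ s, ∫ ω, ‖V (Z s ω) - trn V M (Z s ω)‖ ^ 2 ∂P ≤ N ^ 2 * ((t : ℝ) ^ 4)⁻¹ := by
    intro s
    rw [← t4]; exact g.sub_trn_sq_le h s ht0
  -- means of the truncated parts
  have hmean : ∀ s, ‖∫ ω, trn V M (Z s ω) ∂P‖ ≤ N * ((t : ℝ) ^ 2)⁻¹ := by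
    intro s
    have e : ∫ ω, trn V M (Z s ω) ∂P = - ∫ ω, (V (Z s ω) - trn V M (Z s ω)) ∂P := by
      rw [integral_sub (g.integrable h s) ((g.memLp_trn h s M).integrable (by norm_num)),
        g.mean_s h s]; simp
    rw [e, norm_neg]
    have hl : 0 < (t : ℝ) ^ 2 / N := by positivity
    refine (integral_norm_le_sq (g.memLp_sub h s M) hl).trans ?_
    calc _ ≤ ((t : ℝ) ^ 2 / N * (N ^ 2 * ((t : ℝ) ^ 4)⁻¹) + ((t : ℝ) ^ 2 / N)⁻¹) / 2 := by
          gcongr; exact hsq s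
      _ = _ := by field_simp; norm_num
  have hβ : 0 ≤ betaProc P Z t := betaProc_nonneg _ _ _
  have hb1 : |∫ ω, inner ℝ (trn V M (Z s ω)) (trn V M (Z (s + t) ω)) ∂P| ≤
      (2 * C + 1) * N ^ 2 * ((t : ℝ) ^ 2)⁻¹ := by
    have key := cov_bounded (sigmaUpTo_le h.meas (s + 1)) (sigmaFrom_le h.meas (s + t)) P
      (mixLe_betaProc P h.meas s t) (innerSL ℝ (E := H))
      (U := fun ω => trn V M (Z s ω)) (V := fun ω => trn V M (Z (s + t) ω)) (a := M) (b := M)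
      ((trn_sm g.sm M).comp_measurable (meas_upTo Z (Nat.lt_succ_self s)))
      ((trn_sm g.sm M).comp_measurable (meas_from Z le_rfl))
      (fun ω => trn_le hM.le _) (fun ω => trn_le hM.le _) hM.le hM.le
    simp only [innerSL_apply_apply ℝ] at key
    have k1 : ‖innerSL ℝ (E := H)‖ * M * M * (2 * betaProc P Z t) ≤ 2 * C * N ^ 2 * ((t : ℝ) ^ 2)⁻¹ := by
      have n1 : ‖innerSL ℝ (E := H)‖ ≤ 1 := norm_innerSL_le ℝ
      have n2 : M * M * betaProc P Z t ≤ C * N ^ 2 * ((t : ℝ) ^ 2)⁻¹ := by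
        calc M * M * betaProc P Z t ≤ M * M * (C * (t : ℝ) ^ (-r)) := by
              gcongr; exact h.mix t ht
          _ = C * N ^ 2 * (t : ℝ) ^ (2 / ε + 2 / ε + -r) := by
              rw [hMdef, Real.rpow_add ht0, Real.rpow_add ht0]; ring
          _ ≤ C * N ^ 2 * (t : ℝ) ^ (-2 : ℝ) := by
              gcongr
              have := h.hr
              have h3 : 0 < 2 / ε := by positivity
              linarith
          _ = _ := by
              rw [Real.rpow_neg ht0.le]; norm_cast
      calc _ = ‖innerSL ℝ (E := H)‖ * (2 * (M * M * betaProc P Z t)) := by ring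
        _ ≤ 1 * (2 * (C * N ^ 2 * ((t : ℝ) ^ 2)⁻¹)) := by
            gcongr
        _ = _ := by ring
    have k2 : |inner ℝ (∫ ω, trn V M (Z s ω) ∂P) (∫ ω, trn V M (Z (s + t) ω) ∂P)| ≤
        N ^ 2 * ((t : ℝ) ^ 2)⁻¹ := by
      rw [← Real.norm_eq_abs]
      refine (norm_inner_le_norm _ _).trans ?_
      calc _ ≤ N * ((t : ℝ) ^ 2)⁻¹ * (N * ((t : ℝ) ^ 2)⁻¹) := by
            gcongr
            exacts [hmean s, hmean _]
        _ = N ^ 2 * ((t : ℝ) ^ 2)⁻¹ * ((t : ℝ) ^ 2)⁻¹ := by ring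
        _ ≤ N ^ 2 * ((t : ℝ) ^ 2)⁻¹ * 1 := by
            gcongr
            apply inv_le_one_of_one_le₀
            exact one_le_pow₀ ht1
        _ = _ := by ring
    rw [Real.norm_eq_abs] at key
    have := abs_sub_abs_le_abs_sub (∫ ω, inner ℝ (trn V M (Z s ω)) (trn V M (Z (s + t) ω)) ∂P)
      (inner ℝ (∫ ω, trn V M (Z s ω) ∂P) (∫ ω, trn V M (Z (s + t) ω) ∂P))
    have e : (2 * C + 1) * N ^ 2 * ((t : ℝ) ^ 2)⁻¹ =
      2 * C * N ^ 2 * ((t : ℝ) ^ 2)⁻¹ + N ^ 2 * ((t : ℝ) ^ 2)⁻¹ := by ring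
    linarith
  have ht2 : 0 < (t : ℝ) ^ 2 := by positivity
  have hV2 : ∀ s, ∫ ω, ‖trn V M (Z s ω)‖ ^ 2 ∂P ≤ 2 * N ^ 2 := by
    intro s
    refine (integral_mono ?_ (g.sq_int h s) fun ω => ?_).trans (g.sq_le h s)
    · exact (memLp_two_iff_integrable_sq_norm (g.memLp_trn h s M).1).1 (g.memLp_trn h s M)
    · simp only
      gcongr
      exact trn_le' _
  have hb2 : |∫ ω, inner ℝ (trn V M (Z s ω)) (V (Z (s + t) ω) - trn V M (Z (s + t) ω)) ∂P| ≤
      3 / 2 * N ^ 2 * ((t : ℝ) ^ 2)⁻¹ := by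
    refine (integral_inner_le_sq (g.memLp_trn h s M) (g.memLp_sub h (s + t) M)
      (inv_pos.2 ht2)).trans ?_
    calc _ ≤ (((t : ℝ) ^ 2)⁻¹ * (2 * N ^ 2) + (((t : ℝ) ^ 2)⁻¹)⁻¹ * (N ^ 2 * ((t : ℝ) ^ 4)⁻¹)) / 2 := by
          gcongr
          exacts [hV2 s, hsq _]
      _ = _ := by field_simp; norm_num
  have hb3 : |∫ ω, inner ℝ (V (Z s ω) - trn V M (Z s ω)) (V (Z (s + t) ω)) ∂P| ≤
      3 / 2 * N ^ 2 * ((t : ℝ) ^ 2)⁻¹ := by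
    refine (integral_inner_le_sq (g.memLp_sub h s M) (g.memLp h (s + t)) ht2).trans ?_
    calc _ ≤ ((t : ℝ) ^ 2 * (N ^ 2 * ((t : ℝ) ^ 4)⁻¹) + ((t : ℝ) ^ 2)⁻¹ * (2 * N ^ 2)) / 2 := by
          gcongr
          exacts [hsq s, g.sq_le h _]
      _ = _ := by field_simp; norm_num
  have split : ∫ ω, inner ℝ (V (Z s ω)) (V (Z (s + t) ω)) ∂P =
      ∫ ω, inner ℝ (trn V M (Z s ω)) (trn V M (Z (s + t) ω)) ∂P +
      ∫ ω, inner ℝ (trn V M (Z s ω)) (V (Z (s + t) ω) - trn V M (Z (s + t) ω)) ∂P +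
      ∫ ω, inner ℝ (V (Z s ω) - trn V M (Z s ω)) (V (Z (s + t) ω)) ∂P := by
    have i1 := (g.memLp_trn h s M).integrable_inner_two (g.memLp_trn h (s + t) M)
    have i2 := (g.memLp_trn h s M).integrable_inner_two (g.memLp_sub h (s + t) M)
    have i3 := (g.memLp_sub h s M).integrable_inner_two (g.memLp h (s + t))
    have i12 : Integrable (fun ω => inner ℝ (trn V M (Z s ω)) (trn V M (Z (s + t) ω)) +
      inner ℝ (trn V M (Z s ω)) (V (Z (s + t) ω) - trn V M (Z (s + t) ω))) P := i1.add i2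
    rw [← integral_add i1 i2, ← integral_add i12 i3]
    refine integral_congr_ae (ae_of_all _ fun ω => ?_)
    simp only [inner_sub_left, inner_sub_right]
    ring
  rw [split]
  refine (abs_add_three _ _ _).trans ?_
  have e : (2 * C + 4) * N ^ 2 * ((t : ℝ) ^ 2)⁻¹ = (2 * C + 1) * N ^ 2 * ((t : ℝ) ^ 2)⁻¹ +
    3 / 2 * N ^ 2 * ((t : ℝ) ^ 2)⁻¹ + 3 / 2 * N ^ 2 * ((t : ℝ) ^ 2)⁻¹ := by ring
  linarith

end Cov

section L2
variable {Ω 𝒵 : Type*} [mΩ : MeasurableSpace Ω] [m𝒵 : MeasurableSpace 𝒵]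
set_option linter.unusedSectionVars false
variable {P : Measure Ω} [IsProbabilityMeasure P] {Z : ℕ → Ω → 𝒵} {ε r C : ℝ}

/-- Covariance decay profile on the integers. -/
def cz (C : ℝ) (z : ℤ) : ℝ := (2 * C + 4) * (((z : ℝ) ^ 2)⁻¹ + if z = 0 then 1 else 0)

/-- The constant in the second moment bound. -/
def KC (C : ℝ) : ℝ := ∑' z : ℤ, cz C z

lemma cz_nonneg {C : ℝ} (hC : 0 ≤ C) (z : ℤ) : 0 ≤ cz C z := by
  unfold cz
  split_ifs <;> positivity

lemma cz_summable (C : ℝ) : Summable (cz C) := by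
  refine Summable.mul_left _ (Summable.add ?_ ?_)
  · have := (Real.summable_one_div_int_pow (p := 2)).2 (by norm_num)
    simpa using this
  · exact summable_of_hasFiniteSupport ((Set.finite_singleton (0 : ℤ)).subset (by
      intro z hz
      by_contra h
      simp at hz h
      exact h hz))

lemma KC_nonneg {C : ℝ} (hC : 0 ≤ C) : 0 ≤ KC C := tsum_nonneg (cz_nonneg hC)

variable {H : Type*} [NormedAddCommGroup H] [InnerProductSpace ℝ H] {N : ℝ}

lemma Good.cov_cz [CompleteSpace H] (h : MixSeq P Z ε r C) {V : 𝒵 → H}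
    (g : Good P Z ε V N) (i j : ℕ) :
    |∫ ω, inner ℝ (V (Z i ω)) (V (Z j ω)) ∂P| ≤ N ^ 2 * cz C ((i : ℤ) - j) := by
  have key : ∀ s t : ℕ, |∫ ω, inner ℝ (V (Z s ω)) (V (Z (s + t) ω)) ∂P| ≤ N ^ 2 * cz C t := by
    intro s t
    rcases Nat.eq_zero_or_pos t with rfl | ht
    · have h1 := g.sq_le h s
      have h2 : 0 ≤ ∫ ω, ‖V (Z s ω)‖ ^ 2 ∂P := integral_nonneg fun ω => by positivity
      have hC := h.C_nonneg
      simp only [add_zero, real_inner_self_eq_norm_sq, cz, Nat.cast_zero, Int.cast_zero, if_true]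
      rw [abs_of_nonneg h2]
      norm_num
      nlinarith [sq_nonneg N, mul_nonneg hC (sq_nonneg N)]
    · refine (g.cov_le h s t ht).trans (le_of_eq ?_)
      have : (t : ℤ) ≠ 0 := by positivity
      simp only [cz, this, if_false, Int.cast_natCast]
      ring
  rcases le_total i j with hij | hij
  · obtain ⟨t, rfl⟩ := Nat.exists_eq_add_of_le hij
    refine (key i t).trans (le_of_eq ?_)
    simp [cz]
  · obtain ⟨t, rfl⟩ := Nat.exists_eq_add_of_le hij
    simp only [real_inner_comm]
    refine (key j t).trans (le_of_eq ?_)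
    simp [cz]

lemma sum_cz_le {C : ℝ} (hC : 0 ≤ C) (I : Finset ℕ) (i : ℕ) :
    ∑ j ∈ I, cz C ((i : ℤ) - j) ≤ KC C := by
  have hinj : Function.Injective fun j : ℕ => (i : ℤ) - j := by
    intro a b hab; simp at hab; exact hab
  have hs : Summable fun j : ℕ => cz C ((i : ℤ) - j) := (cz_summable C).comp_injective hinj
  exact (hs.sum_le_tsum I fun j _ => cz_nonneg hC _).trans
    (_root_.tsum_comp_le_tsum_of_inj (cz_summable C) (cz_nonneg hC) hinj)

lemma Good.memLp_sum (h : MixSeq P Z ε r C) {V : 𝒵 → H}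
    (g : Good P Z ε V N) (I : Finset ℕ) : MemLp (fun ω => ∑ i ∈ I, V (Z i ω)) 2 P :=
  memLp_finsetSum I fun i _ => g.memLp h i

lemma Good.sum_sq_eq (h : MixSeq P Z ε r C) {V : 𝒵 → H}
    (g : Good P Z ε V N) (I J : Finset ℕ) :
    ∫ ω, inner ℝ (∑ i ∈ I, V (Z i ω)) (∑ j ∈ J, V (Z j ω)) ∂P =
      ∑ i ∈ I, ∑ j ∈ J, ∫ ω, inner ℝ (V (Z i ω)) (V (Z j ω)) ∂P := by
  have hi : ∀ i j, Integrable (fun ω => inner ℝ (V (Z i ω)) (V (Z j ω))) P := fun i j =>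
    (g.memLp h i).integrable_inner_two (g.memLp h j)
  rw [Finset.sum_comm]
  simp only [sum_inner, inner_sum]
  rw [integral_finsetSum]
  · refine Finset.sum_congr rfl fun i _ => ?_
    rw [integral_finsetSum]
    exact fun j _ => hi _ _
  · exact fun i _ => integrable_finsetSum _ fun j _ => hi _ _

theorem Good.l2 [CompleteSpace H] (h : MixSeq P Z ε r C) {V : 𝒵 → H}
    (g : Good P Z ε V N) (I : Finset ℕ) :
    ∫ ω, ‖∑ i ∈ I, V (Z i ω)‖ ^ 2 ∂P ≤ KC C * N ^ 2 * I.card := by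
  have hC := h.C_nonneg
  simp only [← real_inner_self_eq_norm_sq]
  rw [g.sum_sq_eq h]
  calc _ ≤ ∑ i ∈ I, ∑ j ∈ I, N ^ 2 * cz C ((i : ℤ) - j) :=
        Finset.sum_le_sum fun i _ => Finset.sum_le_sum fun j _ =>
          (le_abs_self _).trans (g.cov_cz h i j)
    _ = ∑ i ∈ I, N ^ 2 * ∑ j ∈ I, cz C ((i : ℤ) - j) := by simp only [Finset.mul_sum]
    _ ≤ ∑ i ∈ I, N ^ 2 * KC C := Finset.sum_le_sum fun i _ =>
        mul_le_mul_of_nonneg_left (sum_cz_le hC I i) (sq_nonneg N)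
    _ = _ := by simp; ring

theorem Good.lrv (h : MixSeq P Z ε r C) {f : 𝒵 → ℝ} (g : Good P Z ε f N) :
    ∃ σ2 : ℝ, 0 ≤ σ2 ∧ σ2 ≤ KC C * N ^ 2 ∧
      Tendsto (fun n : ℕ => (n : ℝ)⁻¹ * ∫ ω, (∑ i ∈ Finset.range n, f (Z i ω)) ^ 2 ∂P)
      atTop (𝓝 σ2) := by
  have hC := h.C_nonneg
  set a : ℕ → ℝ := fun n => ∫ ω, (∑ i ∈ Finset.range n, f (Z i ω)) ^ 2 ∂P with ha
  set γ : ℕ → ℝ := fun t => ∫ ω, f (Z 0 ω) * f (Z t ω) ∂P with hγ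
  have hstat : ∀ s t, ∫ ω, f (Z s ω) * f (Z (s + t) ω) ∂P = γ t := by
    intro s t
    have hsm : StronglyMeasurable fun x : ℕ → 𝒵 => f (x 0) * f (x t) :=
      (g.sm.comp_measurable (measurable_pi_apply 0)).mul
        (g.sm.comp_measurable (measurable_pi_apply t))
    have := h.integral_shift s hsm
    simpa [add_comm, hγ] using this
  have hγb : ∀ t, |γ t| ≤ N ^ 2 * cz C t := by
    intro t
    have := g.cov_cz h 0 t
    simpa [hγ, cz, mul_comm] using this
  have hsum : Summable γ := by
    refine Summable.of_norm_bounded (g := fun t : ℕ => N ^ 2 * cz C t) ?_ hγb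
    exact ((cz_summable C).comp_injective Nat.cast_injective).mul_left _
  have hinc : ∀ n, a (n + 1) - a n = 2 * ∑ j ∈ Finset.range n, γ (j + 1) + γ 0 := by
    intro n
    have i1 := g.sum_sq_eq h (Finset.range n) {n}
    have m1 := g.memLp_sum h (Finset.range n)
    have i2 := (g.memLp_sum h (Finset.range n)).integrable_inner_two (g.memLp h n)
    have i3 := (memLp_two_iff_integrable_sq m1.1).1 m1
    have i4 := (memLp_two_iff_integrable_sq (g.memLp h n).1).1 (g.memLp h n)
    have e : a (n + 1) = a n + (2 * ∫ ω, inner ℝ (∑ i ∈ Finset.range n, f (Z i ω)) (f (Z n ω)) ∂P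
        + ∫ ω, f (Z n ω) ^ 2 ∂P) := by
      have i5 : Integrable (fun ω => 2 * inner ℝ (∑ i ∈ Finset.range n, f (Z i ω)) (f (Z n ω)) +
        f (Z n ω) ^ 2) P := (i2.const_mul 2).add i4
      rw [ha, ← integral_const_mul, ← integral_add (i2.const_mul 2) i4]
      simp only
      rw [← integral_add i3 i5]
      refine integral_congr_ae (ae_of_all _ fun ω => ?_)
      simp only [Finset.sum_range_succ, real_inner_eq_re_inner, Pi.add_apply]
      simp
      ring
    rw [e]
    simp only [Finset.sum_singleton] at i1
    rw [i1]
    have e2 : ∫ ω, f (Z n ω) ^ 2 ∂P = γ 0 := by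
      rw [← hstat n 0]; simp [sq]
    have e3 : ∑ i ∈ Finset.range n, ∫ ω, inner ℝ (f (Z i ω)) (f (Z n ω)) ∂P =
        ∑ j ∈ Finset.range n, γ (j + 1) := by
      rw [← Finset.sum_range_reflect]
      refine Finset.sum_congr rfl fun j hj => ?_
      have hj := Finset.mem_range.1 hj
      have : n = (n - 1 - j) + (j + 1) := by omega
      rw [← hstat (n - 1 - j) (j + 1), ← this]
      simp [mul_comm]
    rw [e2, e3]; ring
  have hlim : Tendsto (fun n => a (n + 1) - a n) atTop (𝓝 (2 * (∑' j, γ (j + 1)) + γ 0)) := by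
    simp only [hinc]
    refine ((Tendsto.const_mul 2 ?_).add_const _)
    exact ((summable_nat_add_iff 1).2 hsum).hasSum.tendsto_sum_nat
  have hces := hlim.cesaro
  have ha0 : a 0 = 0 := by simp [ha]
  have e : (fun n : ℕ => (n : ℝ)⁻¹ * ∑ i ∈ Finset.range n, (a (i + 1) - a i)) =
      fun n : ℕ => (n : ℝ)⁻¹ * a n := by
    funext n
    rw [Finset.sum_range_sub, ha0, sub_zero]
  rw [e] at hces
  refine ⟨_, ?_, ?_, hces⟩
  · refine ge_of_tendsto' hces fun n => ?_
    have : 0 ≤ a n := integral_nonneg fun ω => by positivity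
    positivity
  · refine le_of_tendsto hces ?_
    filter_upwards [eventually_gt_atTop 0] with n hn
    have := g.l2 h (Finset.range n)
    simp only [Real.norm_eq_abs, sq_abs, Finset.card_range] at this
    rw [inv_mul_le_iff₀ (by positivity)]
    linarith

end L2

section CLT
variable {Ω 𝒵 : Type*} [mΩ : MeasurableSpace Ω] [m𝒵 : MeasurableSpace 𝒵]
set_option linter.unusedSectionVars false
variable {P : Measure Ω} [IsProbabilityMeasure P] {Z : ℕ → Ω → 𝒵} {ε r C : ℝ}

/-- `exp (i x)`. -/
def ee (x : ℝ) : ℂ := Complex.exp (Complex.I * x)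

lemma norm_ee (x : ℝ) : ‖ee x‖ = 1 := Complex.norm_exp_I_mul_ofReal x

lemma ee_add (x y : ℝ) : ee (x + y) = ee x * ee y := by
  simp [ee, mul_add, Complex.exp_add]

lemma ee_zero : ee 0 = 1 := by simp [ee]

lemma ee_cont : Continuous ee := by unfold ee; fun_prop

lemma ee_lip (x y : ℝ) : ‖ee x - ee y‖ ≤ |x - y| := by
  have e : ee x - ee y = ee y * (ee (x - y) - 1) := by
    rw [mul_sub, ← ee_add]; simp
  rw [e, norm_mul, norm_ee, one_mul]
  exact Real.norm_exp_I_mul_ofReal_sub_one_le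

lemma ee_taylor {x : ℝ} (hx : |x| ≤ 1) :
    ‖ee x - (1 + Complex.I * x - (x : ℂ) ^ 2 / 2)‖ ≤ |x| ^ 3 := by
  have hn : ‖Complex.I * (x : ℂ)‖ = |x| := by simp
  have h := Complex.exp_bound (x := Complex.I * x) (by rw [hn]; exact hx) (n := 3) (by norm_num)
  rw [hn] at h
  have e : ∑ m ∈ Finset.range 3, (Complex.I * (x : ℂ)) ^ m / (m.factorial : ℂ) =
      1 + Complex.I * x - (x : ℂ) ^ 2 / 2 := by
    simp [Finset.sum_range_succ, mul_pow, Nat.factorial]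
    ring
  rw [e] at h
  refine h.trans ?_
  have : 0 ≤ |x| ^ 3 := by positivity
  norm_num [Nat.factorial]
  linarith

lemma int_norm_sq_le {E : Type*} [NormedAddCommGroup E] {U : Ω → E} (hU : MemLp U 2 P) :
    (∫ ω, ‖U ω‖ ∂P) ^ 2 ≤ ∫ ω, ‖U ω‖ ^ 2 ∂P := by
  have hi := (memLp_two_iff_integrable_sq_norm hU.1).1 hU
  have hj := (hU.integrable (by norm_num)).norm
  set c := ∫ ω, ‖U ω‖ ∂P with hc
  have h0 : 0 ≤ ∫ ω, (‖U ω‖ - c) ^ 2 ∂P := integral_nonneg fun ω => sq_nonneg _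
  have e : ∫ ω, (‖U ω‖ - c) ^ 2 ∂P = ∫ ω, ‖U ω‖ ^ 2 ∂P - c ^ 2 := by
    have : (fun ω => (‖U ω‖ - c) ^ 2) = fun ω => ‖U ω‖ ^ 2 - (2 * c * ‖U ω‖ - c ^ 2) := by
      funext ω; ring
    have i1 : Integrable (fun ω => 2 * c * ‖U ω‖ - c ^ 2) P :=
      (hj.const_mul _).sub (integrable_const _)
    rw [this, integral_sub hi i1, integral_sub (hj.const_mul _) (integrable_const _),
      integral_const_mul]
    simp [← hc]; ring
  linarith

/-- block sums -/
def blk (Z : ℕ → Ω → 𝒵) (f : 𝒵 → ℝ) (L p j : ℕ) (ω : Ω) : ℝ :=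
  ∑ i ∈ Finset.range p, f (Z (i + j * L) ω)

lemma pow_sub_pow_norm_le {a b : ℂ} (ha : ‖a‖ ≤ 1) (hb : ‖b‖ ≤ 1) (k : ℕ) :
    ‖a ^ k - b ^ k‖ ≤ k * ‖a - b‖ := by
  induction k with
  | zero => simp
  | succ k ih =>
    have e : a ^ (k + 1) - b ^ (k + 1) = (a ^ k - b ^ k) * a + b ^ k * (a - b) := by ring
    rw [e]
    refine (norm_add_le _ _).trans ?_
    rw [norm_mul, norm_mul, norm_pow]
    have h1 : ‖b‖ ^ k ≤ 1 := pow_le_one₀ (norm_nonneg _) hb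
    push_cast
    have := norm_nonneg (a - b)
    have := norm_nonneg (a ^ k - b ^ k)
    nlinarith

lemma norm_int_ee_le (U : Ω → ℝ) : ‖∫ ω, ee (U ω) ∂P‖ ≤ 1 := by
  refine (norm_integral_le_integral_norm _).trans ?_
  simp [norm_ee]

lemma blk_sm {A : MeasurableSpace Ω} {f : 𝒵 → ℝ} (hf : Measurable f) (L p j : ℕ)
    (hZ : ∀ i < p, Measurable[A] (Z (i + j * L))) : Measurable[A] (blk Z f L p j) := by
  unfold blk
  exact Finset.measurable_sum _ fun i hi => hf.comp (hZ i (Finset.mem_range.1 hi))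

lemma decouple (h : MixSeq P Z ε r C) {f : 𝒵 → ℝ} (hf : Measurable f) (t : ℝ) (p q k : ℕ) :
    ‖∫ ω, ee (t * ∑ j ∈ Finset.range k, blk Z f (p + q) p j ω) ∂P -
      (∫ ω, ee (t * blk Z f (p + q) p 0 ω) ∂P) ^ k‖ ≤ k * (2 * betaProc P Z q) := by
  induction k with
  | zero => simp [ee_zero]
  | succ k ih =>
    rcases Nat.eq_zero_or_pos k with rfl | hk
    · have := betaProc_nonneg P Z q
      simp
      exact this
    set χ := ∫ ω, ee (t * blk Z f (p + q) p 0 ω) ∂P with hχ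
    have hstat : ∫ ω, ee (t * blk Z f (p + q) p k ω) ∂P = χ := by
      have hsm : StronglyMeasurable fun x : ℕ → 𝒵 => ee (t * ∑ i ∈ Finset.range p, f (x i)) := by
        refine (ee_cont.measurable.comp (Measurable.const_mul ?_ _)).stronglyMeasurable
        exact Finset.measurable_sum _ fun i _ => hf.comp (measurable_pi_apply i)
      have := h.integral_shift (k * (p + q)) hsm
      simpa [blk, hχ] using this
    obtain ⟨k', rfl⟩ : ∃ k', k = k' + 1 := ⟨k - 1, by omega⟩
    set l := k' * (p + q) + p with hl
    have hlq : l + q = (k' + 1) * (p + q) := by rw [hl]; ring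
    have key := cov_bounded (sigmaUpTo_le h.meas (l + 1)) (sigmaFrom_le h.meas (l + q)) P
      (mixLe_betaProc P h.meas l q) (ContinuousLinearMap.mul ℝ ℂ)
      (U := fun ω => ee (t * ∑ j ∈ Finset.range (k' + 1), blk Z f (p + q) p j ω))
      (V := fun ω => ee (t * blk Z f (p + q) p (k' + 1) ω)) (a := 1) (b := 1)
      (by
        apply Measurable.stronglyMeasurable
        refine ee_cont.measurable.comp (Measurable.const_mul ?_ _)
        refine Finset.measurable_sum _ fun j hj => blk_sm hf _ _ _ fun i hi => meas_upTo Z ?_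
        have hj := Finset.mem_range.1 hj
        have : j * (p + q) ≤ k' * (p + q) := Nat.mul_le_mul_right _ (by omega)
        omega)
      (by
        apply Measurable.stronglyMeasurable
        refine ee_cont.measurable.comp (Measurable.const_mul ?_ _)
        refine blk_sm hf _ _ _ fun i hi => meas_from Z ?_
        omega)
      (fun ω => (norm_ee _).le) (fun ω => (norm_ee _).le) zero_le_one zero_le_one
    simp only [ContinuousLinearMap.mul_apply', ← ee_add, ← mul_add] at key
    rw [hstat] at key
    simp only [← Finset.sum_range_succ (fun j => blk Z f (p + q) p j _)] at key
    have n1 : ‖ContinuousLinearMap.mul ℝ ℂ‖ ≤ 1 := ContinuousLinearMap.opNorm_mul_le ℝ ℂ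
    have hβ := betaProc_nonneg P Z q
    set A := ∫ ω, ee (t * ∑ j ∈ Finset.range (k' + 1), blk Z f (p + q) p j ω) ∂P with hA
    set B := ∫ ω, ee (t * ∑ j ∈ Finset.range (k' + 1 + 1), blk Z f (p + q) p j ω) ∂P with hB
    have e : B - χ ^ (k' + 1 + 1) = (B - A * χ) + (A - χ ^ (k' + 1)) * χ := by ring
    rw [e]
    refine (norm_add_le _ _).trans ?_
    rw [norm_mul]
    have hχ1 : ‖χ‖ ≤ 1 := norm_int_ee_le _
    have h1 : ‖B - A * χ‖ ≤ 2 * betaProc P Z q := by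
      refine key.trans ?_
      nlinarith
    have h2 : ‖A - χ ^ (k' + 1)‖ * ‖χ‖ ≤ ‖A - χ ^ (k' + 1)‖ :=
      mul_le_of_le_one_right (norm_nonneg _) hχ1
    push_cast at ih ⊢
    linarith

end CLT

section CLT
variable {Ω 𝒵 : Type*} [mΩ : MeasurableSpace Ω] [m𝒵 : MeasurableSpace 𝒵]
set_option linter.unusedSectionVars false
variable {P : Measure Ω} [IsProbabilityMeasure P] {Z : ℕ → Ω → 𝒵} {ε r C : ℝ}

lemma exp_neg_taylor {v : ℝ} (h0 : 0 ≤ v) (h1 : v ≤ 1) :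
    ‖Complex.exp (-(v / 2 : ℝ)) - (1 - (v : ℂ) / 2)‖ ≤ v ^ 2 := by
  have h := Real.abs_exp_sub_one_sub_id_le (x := -(v / 2)) (by rw [abs_neg, abs_of_nonneg] <;> linarith)
  have e : Complex.exp (-(v / 2 : ℝ)) - (1 - (v : ℂ) / 2) =
      ((Real.exp (-(v / 2)) - 1 - (-(v / 2)) : ℝ) : ℂ) := by
    push_cast; ring
  rw [e, Complex.norm_real, Real.norm_eq_abs]
  refine h.trans ?_
  nlinarith

lemma single_block {B : Ω → ℝ} (hB : Measurable B) (hm : ∫ ω, B ω ∂P = 0) {b : ℝ}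
    (hb : ∀ ω, |B ω| ≤ b) (hb1 : b ≤ 1) :
    ‖∫ ω, ee (B ω) ∂P - Complex.exp (-((∫ ω, B ω ^ 2 ∂P) / 2 : ℝ))‖ ≤
      b * (∫ ω, B ω ^ 2 ∂P) + (∫ ω, B ω ^ 2 ∂P) ^ 2 := by
  set v := ∫ ω, B ω ^ 2 ∂P with hv
  have hb0 : 0 ≤ b := by
    obtain ⟨ω⟩ : Nonempty Ω := by
      by_contra hne
      rw [not_nonempty_iff] at hne
      have := measure_univ (μ := P)
      simp [Measure.eq_zero_of_isEmpty P] at this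
    exact (abs_nonneg _).trans (hb ω)
  have iB : Integrable B P := Integrable.of_bound hB.aestronglyMeasurable b (ae_of_all _ hb)
  have iB2 : Integrable (fun ω => B ω ^ 2) P := by
    refine Integrable.of_bound (hB.pow_const 2).aestronglyMeasurable (b ^ 2) (ae_of_all _ fun ω => ?_)
    rw [Real.norm_eq_abs, abs_pow]
    exact pow_le_pow_left₀ (abs_nonneg _) (hb ω) 2
  have iE : Integrable (fun ω => ee (B ω)) P :=
    Integrable.of_bound (ee_cont.measurable.comp hB).aestronglyMeasurable 1
      (ae_of_all _ fun ω => (norm_ee _).le)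
  have v0 : 0 ≤ v := integral_nonneg fun ω => sq_nonneg _
  have v1 : v ≤ 1 := by
    calc v ≤ ∫ ω, (1 : ℝ) ∂P := by
          refine integral_mono iB2 (integrable_const _) fun ω => ?_
          have := (hb ω).trans hb1
          simp only
          rw [← sq_abs]
          exact pow_le_one₀ (abs_nonneg _) this
      _ = 1 := by simp
  have iC : Integrable (fun ω => (1 + Complex.I * B ω - (B ω : ℂ) ^ 2 / 2)) P := by
    refine ((integrable_const _).add (iB.ofReal.const_mul _)).sub ?_
    have := (iB2.ofReal (𝕜 := ℂ)).div_const 2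
    simpa using this
  have e1 : ∫ ω, (1 + Complex.I * B ω - (B ω : ℂ) ^ 2 / 2) ∂P = 1 - (v : ℂ) / 2 := by
    have j1 : Integrable (fun ω => (1 : ℂ) + Complex.I * B ω) P :=
      (integrable_const _).add (iB.ofReal.const_mul _)
    have j2 : Integrable (fun ω => (B ω : ℂ) ^ 2 / 2) P := by
      have := (iB2.ofReal (𝕜 := ℂ)).div_const 2
      simpa using this
    have j3 : Integrable (fun ω => Complex.I * (B ω : ℂ)) P := iB.ofReal.const_mul _
    rw [integral_sub j1 j2, integral_add (integrable_const _) j3, integral_const_mul,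
      integral_complex_ofReal, hm, integral_div]
    have : ∫ ω, (B ω : ℂ) ^ 2 ∂P = (v : ℂ) := by
      rw [hv, ← integral_complex_ofReal]; simp
    rw [this]
    simp
  have h1 : ‖∫ ω, ee (B ω) ∂P - (1 - (v : ℂ) / 2)‖ ≤ b * v := by
    rw [← e1, ← integral_sub iE iC]
    refine (norm_integral_le_integral_norm _).trans ?_
    rw [hv, ← integral_const_mul]
    refine integral_mono (iE.sub iC).norm (iB2.const_mul _) fun ω => ?_
    simp only
    refine (ee_taylor ((hb ω).trans hb1)).trans ?_
    have : |B ω| ^ 3 = |B ω| * B ω ^ 2 := by rw [← sq_abs]; ring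
    rw [this]
    gcongr
    exact hb ω
  have h2 := exp_neg_taylor v0 v1
  have e : ∫ ω, ee (B ω) ∂P - Complex.exp (-(v / 2 : ℝ)) =
    (∫ ω, ee (B ω) ∂P - (1 - (v : ℂ) / 2)) - (Complex.exp (-(v / 2 : ℝ)) - (1 - (v : ℂ) / 2)) := by
    ring
  rw [e]
  refine (norm_sub_le _ _).trans ?_
  linarith

/-- The block index set. -/
def blkSet (L p k : ℕ) : Finset ℕ :=
  (Finset.range k ×ˢ Finset.range p).image fun x => x.2 + x.1 * L

lemma blk_inj {L p k : ℕ} (hL : p ≤ L) :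
    Set.InjOn (fun x : ℕ × ℕ => x.2 + x.1 * L) (Finset.range k ×ˢ Finset.range p : Finset (ℕ × ℕ)) := by
  rintro ⟨a, b⟩ h ⟨c, d⟩ h' e
  simp only [Finset.coe_product, Finset.coe_range, Set.mem_prod, Set.mem_Iio] at h h' e
  have hb : b < L := by omega
  have hd : d < L := by omega
  have h1 := congrArg (· % L) e
  simp [Nat.add_mul_mod_self_right, Nat.mod_eq_of_lt hb, Nat.mod_eq_of_lt hd] at h1
  subst h1
  have h2 : a * L = c * L := by omega
  have : a = c := Nat.eq_of_mul_eq_mul_right (by omega) h2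
  simp [this]

lemma blkSet_card {L p k : ℕ} (hL : p ≤ L) : (blkSet L p k).card = k * p := by
  rw [blkSet, Finset.card_image_of_injOn (blk_inj hL)]; simp

lemma blkSet_subset {L p k n : ℕ} (hL : p ≤ L) (hk : k * L ≤ n) : blkSet L p k ⊆ Finset.range n := by
  intro i hi
  simp only [blkSet, Finset.mem_image, Finset.mem_product, Finset.mem_range, Prod.exists] at hi ⊢
  obtain ⟨a, b, ⟨ha, hb⟩, rfl⟩ := hi
  have : (a + 1) * L ≤ k * L := Nat.mul_le_mul_right _ ha
  have : (a + 1) * L = a * L + L := by ring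
  omega

lemma sum_blk {L p k : ℕ} (hL : p ≤ L) (f : 𝒵 → ℝ) (ω : Ω) :
    ∑ j ∈ Finset.range k, blk Z f L p j ω = ∑ i ∈ blkSet L p k, f (Z i ω) := by
  rw [blkSet, Finset.sum_image (blk_inj hL), Finset.sum_product]; rfl

/-- The quantitative Bernstein block estimate. -/
lemma bernstein_block (h : MixSeq P Z ε r C) {f : 𝒵 → ℝ} {N M : ℝ} (g : Good P Z ε f N)
    (hM : ∀ z, |f z| ≤ M) (t : ℝ) (ht : 0 ≤ t) (n p q k : ℕ) (hk : k * (p + q) ≤ n)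
    (hsmall : t * (p * M) ≤ 1) :
    ‖∫ ω, ee (t * ∑ i ∈ Finset.range n, f (Z i ω)) ∂P -
      Complex.exp (-(k * (t ^ 2 * ∫ ω, (∑ i ∈ Finset.range p, f (Z i ω)) ^ 2 ∂P) / 2 : ℝ))‖ ≤
    t * √ (KC C * N ^ 2 * (n - k * p)) + k * (2 * betaProc P Z q) +
      k * (t * (p * M) * (t ^ 2 * (KC C * N ^ 2 * p)) + (t ^ 2 * (KC C * N ^ 2 * p)) ^ 2) := by
  have hf : Measurable f := g.sm.measurable
  have hC := h.C_nonneg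
  have hKC := KC_nonneg hC
  set V := ∫ ω, (∑ i ∈ Finset.range p, f (Z i ω)) ^ 2 ∂P with hV
  have hV0 : 0 ≤ V := integral_nonneg fun ω => sq_nonneg _
  have hVle : V ≤ KC C * N ^ 2 * p := by
    have := g.l2 h (Finset.range p)
    simpa using this
  have hpL : p ≤ p + q := Nat.le_add_right _ _
  -- step 1 : drop the gaps
  have s1 : ‖∫ ω, ee (t * ∑ i ∈ Finset.range n, f (Z i ω)) ∂P -
      ∫ ω, ee (t * ∑ j ∈ Finset.range k, blk Z f (p + q) p j ω) ∂P‖ ≤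
      t * √ (KC C * N ^ 2 * (n - k * p)) := by
    have hsm : ∀ I : Finset ℕ, Measurable fun ω => ∑ i ∈ I, f (Z i ω) := fun I =>
      Finset.measurable_sum _ fun i _ => hf.comp (h.meas i)
    have ie : ∀ I : Finset ℕ, Integrable (fun ω => ee (t * ∑ i ∈ I, f (Z i ω))) P := fun I =>
      Integrable.of_bound (ee_cont.measurable.comp ((hsm I).const_mul _)).aestronglyMeasurable 1
        (ae_of_all _ fun ω => (norm_ee _).le)
    simp only [sum_blk hpL]
    rw [← integral_sub (ie _) (ie _)]
    refine (norm_integral_le_integral_norm _).trans ?_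
    set R := Finset.range n \ blkSet (p + q) p k with hR
    have hcard : (R.card : ℝ) = n - k * p := by
      have h1 : R.card = n - k * p := by
        rw [hR, Finset.card_sdiff_of_subset (blkSet_subset hpL hk), blkSet_card hpL, Finset.card_range]
      have h2 : k * p ≤ n := (Nat.mul_le_mul_left k hpL).trans hk
      rw [h1, Nat.cast_sub h2]; push_cast; rfl
    have m := g.memLp_sum h R
    have a1 := int_norm_sq_le m
    have a2 := g.l2 h R
    rw [hcard] at a2
    have a3 : ∫ ω, ‖∑ i ∈ R, f (Z i ω)‖ ∂P ≤ √ (KC C * N ^ 2 * (n - k * p)) :=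
      Real.le_sqrt_of_sq_le (a1.trans a2)
    refine le_trans ?_ (mul_le_mul_of_nonneg_left a3 ht)
    rw [← integral_const_mul]
    refine integral_mono ((ie _).sub (ie _)).norm
      (((m.integrable (by norm_num)).norm).const_mul _) fun ω => ?_
    simp only
    refine (ee_lip _ _).trans (le_of_eq ?_)
    rw [← mul_sub, abs_mul, abs_of_nonneg ht, hR, Real.norm_eq_abs,
      ← Finset.sum_sdiff (blkSet_subset hpL hk)]
    simp
  have s2 := decouple h hf t p q k
  -- step 3 : block characteristic function
  have hblk0 : blk Z f (p + q) p 0 = fun ω => ∑ i ∈ Finset.range p, f (Z i ω) := by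
    funext ω; simp [blk]
  have s3 : ‖(∫ ω, ee (t * blk Z f (p + q) p 0 ω) ∂P) ^ k -
      Complex.exp (-(k * (t ^ 2 * V) / 2 : ℝ))‖ ≤
      k * (t * (p * M) * (t ^ 2 * (KC C * N ^ 2 * p)) + (t ^ 2 * (KC C * N ^ 2 * p)) ^ 2) := by
    have e : Complex.exp (-(k * (t ^ 2 * V) / 2 : ℝ)) =
        Complex.exp (-(t ^ 2 * V / 2 : ℝ)) ^ k := by
      rw [← Complex.exp_nat_mul]; congr 1; push_cast; ring
    rw [e]
    have hM0 : 0 ≤ M := by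
      obtain ⟨ω⟩ : Nonempty Ω := by
        by_contra hne
        rw [not_nonempty_iff] at hne
        have := measure_univ (μ := P)
        simp [Measure.eq_zero_of_isEmpty P] at this
      exact (abs_nonneg _).trans (hM (Z 0 ω))
    have hn2 : ‖Complex.exp (-(t ^ 2 * V / 2 : ℝ))‖ ≤ 1 := by
      rw [Complex.norm_exp]
      have : 0 ≤ t ^ 2 * V / 2 := by positivity
      simp only [Complex.neg_re, Complex.ofReal_re, Real.exp_le_one_iff]
      linarith
    refine (pow_sub_pow_norm_le (norm_int_ee_le _) hn2 k).trans ?_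
    gcongr
    have hB : Measurable fun ω => t * blk Z f (p + q) p 0 ω :=
      (blk_sm hf _ _ _ fun i _ => h.meas _).const_mul _
    have hmean : ∫ ω, t * blk Z f (p + q) p 0 ω ∂P = 0 := by
      rw [integral_const_mul, hblk0]
      rw [integral_finsetSum _ fun i _ => g.integrable h i]
      simp [g.mean_s h]
    have hb : ∀ ω, |t * blk Z f (p + q) p 0 ω| ≤ t * (p * M) := by
      intro ω
      rw [abs_mul, abs_of_nonneg ht, hblk0]
      refine mul_le_mul_of_nonneg_left ?_ ht
      refine (Finset.abs_sum_le_sum_abs _ _).trans ?_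
      refine (Finset.sum_le_sum fun i _ => hM _).trans (by simp)
    have hsq : ∫ ω, (t * blk Z f (p + q) p 0 ω) ^ 2 ∂P = t ^ 2 * V := by
      simp only [mul_pow]
      rw [integral_const_mul, hblk0]
    have := single_block hB hmean hb hsmall
    rw [hsq] at this
    refine this.trans ?_
    gcongr
  have e : ∀ a b c d : ℂ, a - d = (a - b) + (b - c) + (c - d) := by intros; ring
  rw [e _ (∫ ω, ee (t * ∑ j ∈ Finset.range k, blk Z f (p + q) p j ω) ∂P)
    ((∫ ω, ee (t * blk Z f (p + q) p 0 ω) ∂P) ^ k)]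
  exact (norm_add₃_le).trans (by linarith)

end CLT

section CLT
variable {Ω 𝒵 : Type*} [mΩ : MeasurableSpace Ω] [m𝒵 : MeasurableSpace 𝒵]
set_option linter.unusedSectionVars false
variable {P : Measure Ω} [IsProbabilityMeasure P] {Z : ℕ → Ω → 𝒵} {ε r C : ℝ}

/-- Integer eighth root. -/
def mm (n : ℕ) : ℕ := Nat.findGreatest (fun m => m ^ 8 ≤ n) n

lemma mm_pow_le (n : ℕ) : mm n ^ 8 ≤ n :=
  Nat.findGreatest_spec (P := fun m => m ^ 8 ≤ n) (m := 0) (Nat.zero_le _) (by simp)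

lemma le_mm {K n : ℕ} (h : K ^ 8 ≤ n) : K ≤ mm n :=
  Nat.le_findGreatest ((Nat.le_self_pow (by norm_num) K).trans h) h

lemma lt_mm (n : ℕ) : n < (mm n + 1) ^ 8 := by
  by_contra h
  have := le_mm (not_lt.1 h)
  omega

lemma mm_tendsto : Tendsto mm atTop atTop :=
  tendsto_atTop.2 fun K => (eventually_ge_atTop (K ^ 8)).mono fun _ h => le_mm h

lemma mm_tendsto_real : Tendsto (fun n => ((mm n : ℝ))⁻¹) atTop (𝓝 0) :=
  tendsto_inv_atTop_zero.comp (tendsto_natCast_atTop_atTop.comp mm_tendsto)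

/-- number of blocks -/
def kk (n : ℕ) : ℕ := n / (mm n ^ 3 + mm n ^ 2)

lemma kk_le (n : ℕ) : kk n * (mm n ^ 3 + mm n ^ 2) ≤ n := Nat.div_mul_le_self _ _

lemma kk_gap {n : ℕ} (hn : 1 ≤ n) :
    ((n : ℝ) - kk n * (mm n ^ 3 : ℕ)) / n ≤ 3 * (mm n : ℝ)⁻¹ ∧ (kk n : ℝ) * (mm n ^ 3 : ℕ) ≤ n := by
  have hm1 : 1 ≤ mm n := le_mm (by simpa using hn)
  have hm : (1 : ℝ) ≤ mm n := by exact_mod_cast hm1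
  have h1 : (n : ℝ) < (kk n + 1) * ((mm n : ℝ) ^ 3 + (mm n : ℝ) ^ 2) := by
    have : n < (kk n + 1) * (mm n ^ 3 + mm n ^ 2) := by
      have := Nat.lt_div_mul_add (a := n) (b := mm n ^ 3 + mm n ^ 2) (by positivity)
      rw [kk, add_mul, one_mul]; exact this
    exact_mod_cast this
  have h2 : (kk n : ℝ) * ((mm n : ℝ) ^ 3 + (mm n : ℝ) ^ 2) ≤ n := by exact_mod_cast kk_le n
  have h3 : (mm n : ℝ) ^ 8 ≤ n := by exact_mod_cast mm_pow_le n
  have hn0 : (0 : ℝ) < n := by exact_mod_cast hn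
  push_cast
  set m : ℝ := (mm n : ℝ) with hmdef
  set k : ℝ := (kk n : ℝ) with hkdef
  have hk0 : 0 ≤ k := by positivity
  have hm0 : 0 < m := by linarith
  have a1 : k * m ^ 3 ≤ n := by nlinarith [mul_nonneg hk0 (sq_nonneg m)]
  refine ⟨?_, a1⟩
  rw [div_le_iff₀ hn0]
  have a2 : (n : ℝ) - k * m ^ 3 ≤ m ^ 3 + m ^ 2 + k * m ^ 2 := by nlinarith
  have a3 : k * m ^ 2 ≤ m⁻¹ * n := by
    rw [le_inv_mul_iff₀ hm0]; nlinarith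
  have a4 : m ^ 3 + m ^ 2 ≤ 2 * m⁻¹ * n := by
    rw [mul_assoc, mul_left_comm, le_inv_mul_iff₀ hm0]
    have b2 : m ^ 4 ≤ m ^ 8 := pow_le_pow_right₀ hm (by norm_num)
    have b3 : m ^ 3 ≤ m ^ 4 := pow_le_pow_right₀ hm (by norm_num)
    nlinarith
  linarith

lemma clt_bound (h : MixSeq P Z ε r C) {f : 𝒵 → ℝ} {N M : ℝ} (g : Good P Z ε f N)
    (hM : ∀ z, |f z| ≤ M) (hM0 : 0 ≤ M) {n : ℕ} (hn : 1 ≤ n) (hMm : M ≤ mm n) :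
    ‖∫ ω, ee ((√n)⁻¹ * ∑ i ∈ Finset.range n, f (Z i ω)) ∂P -
      Complex.exp (-((kk n * (mm n ^ 3 : ℕ) / n * (((mm n ^ 3 : ℕ) : ℝ)⁻¹ *
        ∫ ω, (∑ i ∈ Finset.range (mm n ^ 3), f (Z i ω)) ^ 2 ∂P)) / 2 : ℝ))‖ ≤
    √ (KC C * N ^ 2 * (3 * (mm n : ℝ)⁻¹)) + (512 * C + M * (KC C * N ^ 2) + (KC C * N ^ 2) ^ 2)
      * (mm n : ℝ)⁻¹ := by
  have hC := h.C_nonneg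
  have hK0 : 0 ≤ KC C * N ^ 2 := mul_nonneg (KC_nonneg hC) (sq_nonneg _)
  set K := KC C * N ^ 2 with hK
  have hm1 : 1 ≤ mm n := le_mm (by simpa using hn)
  have hm : (1 : ℝ) ≤ mm n := by exact_mod_cast hm1
  obtain ⟨g1, g2⟩ := kk_gap hn
  have h3 : (mm n : ℝ) ^ 8 ≤ n := by exact_mod_cast mm_pow_le n
  have h4 : (n : ℝ) ≤ 256 * (mm n : ℝ) ^ 8 := by
    have : (n : ℝ) ≤ (mm n + 1 : ℝ) ^ 8 := by exact_mod_cast (lt_mm n).le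
    calc (n : ℝ) ≤ (mm n + 1 : ℝ) ^ 8 := this
      _ ≤ (2 * mm n : ℝ) ^ 8 := by gcongr; linarith
      _ = _ := by ring
  have hn0 : (0 : ℝ) < n := by exact_mod_cast hn
  have hsn : (mm n : ℝ) ^ 4 ≤ √n := by
    apply Real.le_sqrt_of_sq_le
    rw [← pow_mul]; exact h3
  have hm0 : (0 : ℝ) < mm n := by linarith
  have hs0 : 0 < √(n : ℝ) := Real.sqrt_pos.2 hn0
  have hss : √(n : ℝ) ^ 2 = n := Real.sq_sqrt hn0.le
  have b1 : (√(n : ℝ))⁻¹ * (((mm n ^ 3 : ℕ) : ℝ) * M) ≤ M * (mm n : ℝ)⁻¹ := by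
    rw [inv_mul_le_iff₀ hs0]
    push_cast
    calc (mm n : ℝ) ^ 3 * M = (mm n : ℝ) ^ 4 * (M * (mm n : ℝ)⁻¹) := by field_simp
      _ ≤ √n * (M * (mm n : ℝ)⁻¹) := by gcongr
  have hsmall : (√(n : ℝ))⁻¹ * (((mm n ^ 3 : ℕ) : ℝ) * M) ≤ 1 := by
    refine b1.trans ?_
    rw [mul_inv_le_iff₀ hm0]; linarith
  have key := bernstein_block h g hM (√(n : ℝ))⁻¹ (by positivity) n (mm n ^ 3) (mm n ^ 2) (kk n) (kk_le n)
    hsmall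
  set V := ∫ ω, (∑ i ∈ Finset.range (mm n ^ 3), f (Z i ω)) ^ 2 ∂P with hV
  have e1 : (kk n * ((√(n : ℝ))⁻¹ ^ 2 * V) / 2 : ℝ) = (kk n * (mm n ^ 3 : ℕ) / n *
      (((mm n ^ 3 : ℕ) : ℝ)⁻¹ * V)) / 2 := by
    rw [inv_pow, hss]; push_cast; field_simp
  rw [e1] at key
  refine key.trans ?_
  rw [← hK]
  have c1 : (√(n : ℝ))⁻¹ * √ (K * (n - kk n * (mm n ^ 3 : ℕ))) ≤ √ (K * (3 * (mm n : ℝ)⁻¹)) := by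
    rw [← Real.sqrt_inv, ← Real.sqrt_mul (by positivity)]
    apply Real.sqrt_le_sqrt
    calc (n : ℝ)⁻¹ * (K * (n - kk n * (mm n ^ 3 : ℕ))) =
          K * ((n - kk n * (mm n ^ 3 : ℕ)) / n) := by ring
      _ ≤ _ := by gcongr
  have c2 : (kk n : ℝ) * (2 * betaProc P Z (mm n ^ 2)) ≤ 512 * C * (mm n : ℝ)⁻¹ := by
    have hβ : betaProc P Z (mm n ^ 2) ≤ C * ((mm n : ℝ) ^ 12)⁻¹ := by
      refine (h.mix _ (Nat.one_le_pow _ _ hm1)).trans ?_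
      gcongr
      push_cast
      calc ((mm n : ℝ) ^ 2) ^ (-r) ≤ ((mm n : ℝ) ^ 2) ^ (-6 : ℝ) := by
            apply Real.rpow_le_rpow_of_exponent_le (one_le_pow₀ hm)
            have := h.hr
            have := h.eps
            have : 0 < 2 / ε := by positivity
            linarith
        _ = ((mm n : ℝ) ^ 12)⁻¹ := by
            rw [Real.rpow_neg (by positivity)]
            norm_cast
            rw [← pow_mul]
    have hkn : (kk n : ℝ) ≤ n := by
      have : kk n ≤ n := Nat.div_le_self _ _
      exact_mod_cast this
    have hβ0 := betaProc_nonneg P Z (mm n ^ 2)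
    calc (kk n : ℝ) * (2 * betaProc P Z (mm n ^ 2)) ≤
        (256 * (mm n : ℝ) ^ 8) * (2 * (C * ((mm n : ℝ) ^ 12)⁻¹)) := by
          gcongr; exact hkn.trans h4
      _ = 512 * C * ((mm n : ℝ) ^ 4)⁻¹ := by field_simp; ring
      _ ≤ 512 * C * (mm n : ℝ)⁻¹ := by
          gcongr
          exact le_self_pow₀ hm (by norm_num)
  have c3 : (kk n : ℝ) * ((√(n : ℝ))⁻¹ * ((mm n ^ 3 : ℕ) * M) * ((√(n : ℝ))⁻¹ ^ 2 * (K * (mm n ^ 3 : ℕ)))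
      + ((√(n : ℝ))⁻¹ ^ 2 * (K * (mm n ^ 3 : ℕ))) ^ 2) ≤ (M * K + K ^ 2) * (mm n : ℝ)⁻¹ := by
    rw [inv_pow, hss]
    set s := (√(n : ℝ))⁻¹ * ((mm n ^ 3 : ℕ) * M) with hs
    have hs0 : 0 ≤ s := by positivity
    set p : ℝ := ((mm n ^ 3 : ℕ) : ℝ) with hp
    have hp0 : 0 < p := by positivity
    have d1 : (kk n : ℝ) * p / n ≤ 1 := by rw [div_le_one hn0]; exact g2
    have d2 : p / n ≤ (mm n : ℝ)⁻¹ := by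
      rw [div_le_iff₀ hn0, le_inv_mul_iff₀ hm0, hp]
      push_cast
      calc (mm n : ℝ) * (mm n : ℝ) ^ 3 = (mm n : ℝ) ^ 4 := by ring
        _ ≤ (mm n : ℝ) ^ 8 := pow_le_pow_right₀ hm (by norm_num)
        _ ≤ n := h3
    calc (kk n : ℝ) * (s * ((n : ℝ)⁻¹ * (K * p)) + ((n : ℝ)⁻¹ * (K * p)) ^ 2) =
        ((kk n : ℝ) * p / n) * (s * K + K ^ 2 * (p / n)) := by ring
      _ ≤ 1 * ((M * (mm n : ℝ)⁻¹) * K + K ^ 2 * (mm n : ℝ)⁻¹) := by gcongr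
      _ = _ := by ring
  have e2 : (512 * C + M * K + K ^ 2) * (mm n : ℝ)⁻¹ =
    512 * C * (mm n : ℝ)⁻¹ + (M * K + K ^ 2) * (mm n : ℝ)⁻¹ := by ring
  rw [e2]
  linarith

theorem clt_bounded (h : MixSeq P Z ε r C) {f : 𝒵 → ℝ} {N M σ2 : ℝ} (g : Good P Z ε f N)
    (hM : ∀ z, |f z| ≤ M) (hM0 : 0 ≤ M)
    (hσ : Tendsto (fun n : ℕ => (n : ℝ)⁻¹ * ∫ ω, (∑ i ∈ Finset.range n, f (Z i ω)) ^ 2 ∂P)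
      atTop (𝓝 σ2)) :
    Tendsto (fun n : ℕ => ∫ ω, ee ((√n)⁻¹ * ∑ i ∈ Finset.range n, f (Z i ω)) ∂P) atTop
      (𝓝 (Complex.exp (-(σ2 / 2 : ℝ)))) := by
  have hfrac : Tendsto (fun n : ℕ => (kk n : ℝ) * (mm n ^ 3 : ℕ) / n) atTop (𝓝 1) := by
    have l0 : Tendsto (fun n : ℕ => 1 - 3 * (mm n : ℝ)⁻¹) atTop (𝓝 1) := by
      simpa using (mm_tendsto_real.const_mul 3).const_sub 1
    refine tendsto_of_tendsto_of_tendsto_of_le_of_le' l0 tendsto_const_nhds ?_ ?_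
    · filter_upwards [eventually_ge_atTop 1] with n hn
      obtain ⟨g1, g2⟩ := kk_gap hn
      have hn0 : (0 : ℝ) < n := by exact_mod_cast hn
      rw [sub_div, div_self hn0.ne'] at g1
      linarith
    · filter_upwards [eventually_ge_atTop 1] with n hn
      obtain ⟨g1, g2⟩ := kk_gap hn
      have hn0 : (0 : ℝ) < n := by exact_mod_cast hn
      rw [div_le_one hn0]; exact g2
  have hp : Tendsto (fun n => mm n ^ 3) atTop atTop :=
    (tendsto_pow_atTop (by norm_num)).comp mm_tendsto
  have hv := hfrac.mul (hσ.comp hp)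
  rw [one_mul] at hv
  have hexp : Tendsto (fun n : ℕ => Complex.exp (-((kk n * (mm n ^ 3 : ℕ) / n * (((mm n ^ 3 : ℕ) : ℝ)⁻¹ *
        ∫ ω, (∑ i ∈ Finset.range (mm n ^ 3), f (Z i ω)) ^ 2 ∂P)) / 2 : ℝ))) atTop
      (𝓝 (Complex.exp (-(σ2 / 2 : ℝ)))) := by
    have hc : Continuous fun x : ℝ => Complex.exp (-(x / 2 : ℝ)) := by fun_prop
    exact (hc.tendsto σ2).comp hv
  have hdiff : Tendsto (fun n : ℕ => ∫ ω, ee ((√n)⁻¹ * ∑ i ∈ Finset.range n, f (Z i ω)) ∂P -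
      Complex.exp (-((kk n * (mm n ^ 3 : ℕ) / n * (((mm n ^ 3 : ℕ) : ℝ)⁻¹ *
        ∫ ω, (∑ i ∈ Finset.range (mm n ^ 3), f (Z i ω)) ^ 2 ∂P)) / 2 : ℝ))) atTop (𝓝 0) := by
    have lim : Tendsto (fun n => √ (KC C * N ^ 2 * (3 * (mm n : ℝ)⁻¹)) +
        (512 * C + M * (KC C * N ^ 2) + (KC C * N ^ 2) ^ 2) * (mm n : ℝ)⁻¹) atTop (𝓝 0) := by
      have t1 := ((mm_tendsto_real.const_mul 3).const_mul (KC C * N ^ 2)).sqrt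
      have t2 := mm_tendsto_real.const_mul (512 * C + M * (KC C * N ^ 2) + (KC C * N ^ 2) ^ 2)
      simpa using t1.add t2
    refine squeeze_zero_norm' ?_ lim
    have : ∀ᶠ n in atTop, M ≤ mm n :=
      (tendsto_natCast_atTop_atTop.comp mm_tendsto).eventually_ge_atTop M
    filter_upwards [this, eventually_ge_atTop 1] with n hn1 hn2
    exact clt_bound h g hM hM0 hn2 hn1
  have := hdiff.add hexp
  simpa using this

end CLT

section CLT
variable {Ω 𝒵 : Type*} [mΩ : MeasurableSpace Ω] [m𝒵 : MeasurableSpace 𝒵]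
set_option linter.unusedSectionVars false
variable {P : Measure Ω} [IsProbabilityMeasure P] {Z : ℕ → Ω → 𝒵} {ε r C : ℝ}

lemma approx_lim {E : Type*} [NormedAddCommGroup E] {a : ℕ → E} {b : ℕ → ℕ → E} {bl : ℕ → E} {al : E}
    {c : ℕ → ℝ} (hc : Tendsto c atTop (𝓝 0)) (h1 : ∀ M, ∀ᶠ n in atTop, ‖a n - b M n‖ ≤ c M)
    (h2 : ∀ M, Tendsto (b M) atTop (𝓝 (bl M))) (h3 : Tendsto bl atTop (𝓝 al)) :
    Tendsto a atTop (𝓝 al) := by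
  rw [Metric.tendsto_atTop']
  intro δ hδ
  have e1 : ∀ᶠ M in atTop, c M < δ / 3 := hc.eventually_lt_const (by linarith)
  have e2 : ∀ᶠ M in atTop, dist (bl M) al < δ / 3 := (Metric.tendsto_nhds.1 h3) _ (by linarith)
  obtain ⟨M, hM1, hM2⟩ := (e1.and e2).exists
  have e3 : ∀ᶠ n in atTop, dist (b M n) (bl M) < δ / 3 := (Metric.tendsto_nhds.1 (h2 M)) _ (by linarith)
  obtain ⟨n0, hn0⟩ := eventually_atTop.1 (e3.and (h1 M))
  refine ⟨n0, fun n hn => ?_⟩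
  obtain ⟨h4, h5⟩ := hn0 n hn.le
  rw [← dist_eq_norm] at h5
  have := dist_triangle4 (a n) (b M n) (bl M) al
  linarith

lemma rpow_add_le_two {a b s : ℝ} (ha : 0 ≤ a) (hb : 0 ≤ b) (hs : 0 ≤ s) :
    (a + b) ^ s ≤ 2 ^ s * (a ^ s + b ^ s) := by
  have ha' : 0 ≤ a ^ s := by positivity
  have hb' : 0 ≤ b ^ s := by positivity
  have h2 : (0 : ℝ) ≤ 2 ^ s := by positivity
  rcases le_total a b with h | h
  · calc (a + b) ^ s ≤ (2 * b) ^ s := Real.rpow_le_rpow (by positivity) (by linarith) hs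
      _ = 2 ^ s * b ^ s := Real.mul_rpow (by norm_num) hb
      _ ≤ _ := by gcongr; linarith
  · calc (a + b) ^ s ≤ (2 * a) ^ s := Real.rpow_le_rpow (by positivity) (by linarith) hs
      _ = 2 ^ s * a ^ s := Real.mul_rpow (by norm_num) ha
      _ ≤ _ := by gcongr; linarith

variable {E : Type*} [NormedAddCommGroup E] [NormedSpace ℝ E]

lemma Good.of_int {V : 𝒵 → E} (hε : 0 < ε) (sm : StronglyMeasurable V)
    (int : Integrable (fun ω => ‖V (Z 0 ω)‖ ^ (2 + 2 * ε)) P) (mean : ∫ ω, V (Z 0 ω) ∂P = 0)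
    {η : ℝ} (hη : 0 < η) :
    Good P Z ε V ((∫ ω, ‖V (Z 0 ω)‖ ^ (2 + 2 * ε) ∂P) ^ (2 + 2 * ε)⁻¹ + η) where
  sm := sm
  pos := by
    have : 0 ≤ ∫ ω, ‖V (Z 0 ω)‖ ^ (2 + 2 * ε) ∂P := integral_nonneg fun ω => by positivity
    positivity
  int := int
  le := by
    have : 0 ≤ ∫ ω, ‖V (Z 0 ω)‖ ^ (2 + 2 * ε) ∂P := integral_nonneg fun ω => by positivity
    calc _ = ((∫ ω, ‖V (Z 0 ω)‖ ^ (2 + 2 * ε) ∂P) ^ (2 + 2 * ε)⁻¹) ^ (2 + 2 * ε) := by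
          rw [Real.rpow_inv_rpow this (by positivity)]
      _ ≤ _ := by gcongr; linarith
  mean := mean

lemma Good.seq {V : ℕ → 𝒵 → E} {G : 𝒵 → ℝ} (hZ : Measurable (Z 0)) (hε : 0 < ε)
    (sm : ∀ M, StronglyMeasurable (V M))
    (hG : Integrable (fun ω => G (Z 0 ω) ^ (2 + 2 * ε)) P) (hV : ∀ M z, ‖V M z‖ ≤ G z)
    (mean : ∀ M, ∫ ω, V M (Z 0 ω) ∂P = 0) (hlim : ∀ z, Tendsto (fun M => V M z) atTop (𝓝 0)) :
    ∃ N : ℕ → ℝ, Tendsto N atTop (𝓝 0) ∧ ∀ M, Good P Z ε (V M) (N M) := by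
  have hs : 0 < 2 + 2 * ε := by positivity
  have hm : ∀ M, AEStronglyMeasurable (fun ω => ‖V M (Z 0 ω)‖ ^ (2 + 2 * ε)) P := fun M =>
    (((sm M).norm.measurable.pow_const _).comp hZ).aestronglyMeasurable
  have hb : ∀ M, ∀ᵐ ω ∂P, ‖‖V M (Z 0 ω)‖ ^ (2 + 2 * ε)‖ ≤ G (Z 0 ω) ^ (2 + 2 * ε) := fun M =>
    ae_of_all _ fun ω => by
      rw [Real.norm_of_nonneg (by positivity)]
      exact Real.rpow_le_rpow (norm_nonneg _) (hV _ _) hs.le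
  have hInt : ∀ M, Integrable (fun ω => ‖V M (Z 0 ω)‖ ^ (2 + 2 * ε)) P := fun M =>
    hG.mono' (hm M) (hb M)
  refine ⟨fun M => (∫ ω, ‖V M (Z 0 ω)‖ ^ (2 + 2 * ε) ∂P) ^ (2 + 2 * ε)⁻¹ + 1 / ((M : ℝ) + 1), ?_,
    fun M => Good.of_int hε (sm M) (hInt M) (mean M) (by positivity)⟩
  have t1 : Tendsto (fun M => ∫ ω, ‖V M (Z 0 ω)‖ ^ (2 + 2 * ε) ∂P) atTop (𝓝 (∫ _, (0 : ℝ) ∂P)) := by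
    refine tendsto_integral_of_dominated_convergence _ hm hG hb (ae_of_all _ fun ω => ?_)
    have := ((hlim (Z 0 ω)).norm).rpow_const (p := 2 + 2 * ε) (Or.inr hs.le)
    simpa [Real.zero_rpow hs.ne'] using this
  rw [integral_zero] at t1
  have t2 := (t1.rpow_const (p := (2 + 2 * ε)⁻¹) (Or.inr (by positivity))).add
    (tendsto_one_div_add_atTop_nhds_zero_nat (𝕜 := ℝ))
  rw [Real.zero_rpow (by positivity), add_zero] at t2
  exact t2

lemma Good.exists_add {V W : 𝒵 → E} {N N' : ℝ} (h : MixSeq P Z ε r C) (g : Good P Z ε V N)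
    (g' : Good P Z ε W N') : ∃ N'', Good P Z ε (fun z => V z + W z) N'' := by
  have hε := h.eps
  refine ⟨_, Good.of_int h.eps (g.sm.add g'.sm) ?_ ?_ one_pos⟩
  · refine Integrable.mono' ((g.int.add g'.int).const_mul (2 ^ (2 + 2 * ε))) ?_ (ae_of_all _ fun ω => ?_)
    · exact (((g.sm.add g'.sm).norm.measurable.pow_const _).comp (h.meas 0)).aestronglyMeasurable
    · rw [Real.norm_of_nonneg (by positivity)]
      refine (Real.rpow_le_rpow (norm_nonneg _) (norm_add_le _ _) (by positivity)).trans ?_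
      exact rpow_add_le_two (norm_nonneg _) (norm_nonneg _) (by positivity)
  · change ∫ ω, (V (Z 0 ω) + W (Z 0 ω)) ∂P = 0
    rw [integral_add (g.integrable h 0) (g'.integrable h 0), g.mean, g'.mean, add_zero]

lemma Good.exists_clm {F : Type*} [NormedAddCommGroup F] [NormedSpace ℝ F] [CompleteSpace E]
    [CompleteSpace F] {V : 𝒵 → E} {N : ℝ} (h : MixSeq P Z ε r C) (g : Good P Z ε V N)
    (T : E →L[ℝ] F) : ∃ N'', Good P Z ε (fun z => T (V z)) N'' := by
  have hε := h.eps
  have sm : StronglyMeasurable fun z => T (V z) := T.continuous.comp_stronglyMeasurable g.sm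
  refine ⟨_, Good.of_int h.eps sm ?_ ?_ one_pos⟩
  · refine Integrable.mono' (g.int.const_mul (‖T‖ ^ (2 + 2 * ε))) ?_ (ae_of_all _ fun ω => ?_)
    · exact ((sm.norm.measurable.pow_const _).comp (h.meas 0)).aestronglyMeasurable
    · rw [Real.norm_of_nonneg (by positivity), ← Real.mul_rpow (norm_nonneg _) (norm_nonneg _)]
      exact Real.rpow_le_rpow (norm_nonneg _) (T.le_opNorm _) (by positivity)
  · rw [T.integral_comp_comm (g.integrable h 0), g.mean, map_zero]

theorem clt_scalar (h : MixSeq P Z ε r C) {f : 𝒵 → ℝ} {N σ2 : ℝ} (g : Good P Z ε f N)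
    (hσ : Tendsto (fun n : ℕ => (n : ℝ)⁻¹ * ∫ ω, (∑ i ∈ Finset.range n, f (Z i ω)) ^ 2 ∂P)
      atTop (𝓝 σ2)) :
    Tendsto (fun n : ℕ => ∫ ω, ee ((√n)⁻¹ * ∑ i ∈ Finset.range n, f (Z i ω)) ∂P) atTop
      (𝓝 (Complex.exp (-(σ2 / 2 : ℝ)))) := by
  have hε := h.eps
  have hC := h.C_nonneg
  have hKC := KC_nonneg hC
  have itr : ∀ M : ℕ, Integrable (fun ω => trn f M (Z 0 ω)) P := fun M =>
    (g.memLp_trn h 0 M).integrable (by norm_num)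
  set μM : ℕ → ℝ := fun M => ∫ ω, trn f M (Z 0 ω) ∂P with hμ
  set A := ∫ ω, |f (Z 0 ω)| ∂P with hA
  have hμA : ∀ M, |μM M| ≤ A := fun M => by
    rw [hμ, hA, ← Real.norm_eq_abs]
    refine (norm_integral_le_integral_norm _).trans ?_
    exact integral_mono (itr M).norm (g.integrable h 0).norm fun ω => trn_le' _
  have htrl : ∀ z, Tendsto (fun M : ℕ => trn f M z) atTop (𝓝 (f z)) := by
    intro z
    refine tendsto_const_nhds.congr' ?_
    filter_upwards [tendsto_natCast_atTop_atTop.eventually_ge_atTop ‖f z‖] with M hM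
    rw [trn, Set.indicator_of_mem (by exact hM)]
  have hμl : Tendsto μM atTop (𝓝 0) := by
    rw [← g.mean]
    refine tendsto_integral_of_dominated_convergence (fun ω => ‖f (Z 0 ω)‖)
      (fun M => (itr M).1) (g.integrable h 0).norm (fun M => ae_of_all _ fun ω => trn_le' _)
      (ae_of_all _ fun ω => htrl _)
  set fM : ℕ → 𝒵 → ℝ := fun M z => trn f M z - μM M with hfM
  have fMsm : ∀ M, StronglyMeasurable (fM M) := fun M => (trn_sm g.sm M).sub stronglyMeasurable_const
  have hAp : 0 ≤ A := integral_nonneg fun ω => abs_nonneg _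
  obtain ⟨Ns, hNs, hgood⟩ := Good.seq (P := P) (Z := Z) (V := fun M z => f z - fM M z)
    (G := fun z => ‖f z‖ + A) (h.meas 0) hε (fun M => g.sm.sub (fMsm M))
    (by
      refine Integrable.mono' ((g.int.add (integrable_const (A ^ (2 + 2 * ε)))).const_mul
        (2 ^ (2 + 2 * ε))) ?_ (ae_of_all _ fun ω => ?_)
      · exact (((g.sm.norm.measurable.add_const A).pow_const _).comp (h.meas 0)).aestronglyMeasurable
      · rw [Real.norm_of_nonneg (by positivity)]
        exact rpow_add_le_two (norm_nonneg _) hAp (by positivity))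
    (by
      intro M z
      have e : f z - fM M z = (f z - trn f M z) + μM M := by simp only [hfM]; ring
      rw [e]
      refine (norm_add_le _ _).trans (add_le_add (sub_trn_le' _) (hμA M)))
    (by
      intro M
      simp only [hfM]
      have i1 : Integrable (fun ω => trn f M (Z 0 ω) - μM M) P := (itr M).sub (integrable_const _)
      rw [integral_sub (g.integrable h 0) i1, integral_sub (itr M) (integrable_const _), g.mean]
      simp [hμ])
    (by
      intro z
      have := ((htrl z).sub hμl).const_sub (f z)
      simpa using this)
  have gfM : ∀ M, ∃ N', Good P Z ε (fM M) N' := by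
    intro M
    obtain ⟨N', g'⟩ := (hgood M).exists_clm h (-ContinuousLinearMap.id ℝ ℝ)
    obtain ⟨N'', g''⟩ := g.exists_add h g'
    refine ⟨N'', ?_⟩
    convert g'' using 2
    simp
  have hclt : ∀ M, ∃ s2, 0 ≤ s2 ∧ Tendsto (fun n : ℕ => (n : ℝ)⁻¹ * ∫ ω, (∑ i ∈ Finset.range n, fM M (Z i ω)) ^ 2 ∂P)
      atTop (𝓝 s2) ∧ Tendsto (fun n : ℕ => ∫ ω, ee ((√n)⁻¹ * ∑ i ∈ Finset.range n, fM M (Z i ω)) ∂P) atTop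
      (𝓝 (Complex.exp (-(s2 / 2 : ℝ)))) := by
    intro M
    obtain ⟨N', g'⟩ := gfM M
    obtain ⟨s2, h0, -, hs2⟩ := g'.lrv h
    refine ⟨s2, h0, hs2, clt_bounded h g' (M := M + A) (fun z => ?_) (by positivity) hs2⟩
    simp only [hfM]
    rw [sub_eq_add_neg]
    refine (abs_add_le _ _).trans (add_le_add ((Real.norm_eq_abs _).symm.trans_le (trn_le (Nat.cast_nonneg M) z)) ?_)
    rw [abs_neg]; exact hμA M
  choose s2 hs0 hs2 hcl using hclt
  -- difference bound in L2
  have hdiff : ∀ M n, ∫ ω, (∑ i ∈ Finset.range n, f (Z i ω) - ∑ i ∈ Finset.range n, fM M (Z i ω)) ^ 2 ∂P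
      ≤ KC C * Ns M ^ 2 * n := by
    intro M n
    have := (hgood M).l2 h (Finset.range n)
    simpa [Finset.sum_sub_distrib] using this
  have hvar : ∀ M, |σ2 - s2 M| ≤ Ns M * (KC C * (1 + 8 * N ^ 2 + 2 * Ns M ^ 2)) := by
    intro M
    have hδ := (hgood M).pos
    have lim : Tendsto (fun n : ℕ => |(n : ℝ)⁻¹ * ∫ ω, (∑ i ∈ Finset.range n, f (Z i ω)) ^ 2 ∂P -
      (n : ℝ)⁻¹ * ∫ ω, (∑ i ∈ Finset.range n, fM M (Z i ω)) ^ 2 ∂P|) atTop (𝓝 |σ2 - s2 M|) :=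
      (hσ.sub (hs2 M)).abs
    refine le_of_tendsto lim ?_
    filter_upwards [eventually_gt_atTop 0] with n hn
    have hn0 : (0 : ℝ) < n := by exact_mod_cast hn
    obtain ⟨N', g'⟩ := gfM M
    have m1 := g.memLp_sum h (Finset.range n)
    have m2 := g'.memLp_sum h (Finset.range n)
    set a := fun ω => ∑ i ∈ Finset.range n, f (Z i ω)
    set b := fun ω => ∑ i ∈ Finset.range n, fM M (Z i ω)
    have i1 := (memLp_two_iff_integrable_sq m1.1).1 m1
    have i2 := (memLp_two_iff_integrable_sq m2.1).1 m2
    have m3 := m1.sub m2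
    have i3 := (memLp_two_iff_integrable_sq m3.1).1 m3
    rw [← mul_sub, ← integral_sub i1 i2, abs_mul, abs_of_pos (inv_pos.2 hn0), inv_mul_le_iff₀ hn0,
      ← Real.norm_eq_abs]
    refine (norm_integral_le_integral_norm _).trans ?_
    set δ := Ns M
    calc ∫ ω, ‖a ω ^ 2 - b ω ^ 2‖ ∂P ≤
        ∫ ω, ((δ⁻¹ + 2 * δ) * ((a - b) ω ^ 2) + 8 * δ * (a ω ^ 2)) ∂P := by
          refine integral_mono (i1.sub i2).norm ((i3.const_mul _).add (i1.const_mul _)) fun ω => ?_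
          simp only [Pi.sub_apply]
          set x := a ω
          set y := b ω
          have e : x ^ 2 - y ^ 2 = (x - y) * (2 * x - (x - y)) := by ring
          rw [Real.norm_eq_abs, e, abs_mul]
          set u := |x - y|
          set w := |2 * x - (x - y)|
          have hw : w ^ 2 ≤ 8 * x ^ 2 + 2 * (x - y) ^ 2 := by
            rw [sq_abs]; nlinarith [sq_nonneg (2 * x + (x - y))]
          have hu : u ^ 2 = (x - y) ^ 2 := sq_abs _
          have h1 : u * w ≤ δ⁻¹ * u ^ 2 + δ * w ^ 2 := by
            have e : δ⁻¹ * u ^ 2 + δ * w ^ 2 - u * w =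
              δ⁻¹ * ((u - δ * w / 2) ^ 2 + 3 / 4 * (δ * w) ^ 2) := by field_simp; ring
            have : 0 ≤ δ⁻¹ * ((u - δ * w / 2) ^ 2 + 3 / 4 * (δ * w) ^ 2) := by positivity
            linarith
          rw [← hu] at hw ⊢
          have : δ * w ^ 2 ≤ δ * (8 * x ^ 2 + 2 * u ^ 2) := by gcongr
          linarith
      _ = (δ⁻¹ + 2 * δ) * ∫ ω, ((a - b) ω ^ 2) ∂P + 8 * δ * ∫ ω, (a ω ^ 2) ∂P := by
          rw [integral_add (i3.const_mul _) (i1.const_mul _), integral_const_mul, integral_const_mul]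
      _ ≤ (δ⁻¹ + 2 * δ) * (KC C * δ ^ 2 * n) + 8 * δ * (KC C * N ^ 2 * n) := by
          gcongr
          · exact hdiff M n
          · have := g.l2 h (Finset.range n)
            simpa using this
      _ = _ := by field_simp; ring
  have hsl : Tendsto s2 atTop (𝓝 σ2) := by
    have t : Tendsto (fun M => Ns M * (KC C * (1 + 8 * N ^ 2 + 2 * Ns M ^ 2))) atTop (𝓝 0) := by
      have := hNs.mul ((((hNs.pow 2).const_mul 2).const_add (1 + 8 * N ^ 2)).const_mul (KC C))
      simpa using this
    rw [tendsto_iff_norm_sub_tendsto_zero]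
    refine squeeze_zero (fun _ => norm_nonneg _) (fun M => ?_) t
    rw [← norm_neg, neg_sub]
    exact hvar M
  refine approx_lim (b := fun M n => ∫ ω, ee ((√n)⁻¹ * ∑ i ∈ Finset.range n, fM M (Z i ω)) ∂P)
    (c := fun M => √ (KC C * Ns M ^ 2)) ?_ ?_ hcl ?_
  · have := ((hNs.pow 2).const_mul (KC C)).sqrt
    simpa using this
  · intro M
    filter_upwards [eventually_gt_atTop 0] with n hn
    have hn0 : (0 : ℝ) < n := by exact_mod_cast hn
    obtain ⟨N', g'⟩ := gfM M
    have ie : ∀ f : 𝒵 → ℝ, Measurable f → Integrable (fun ω => ee ((√n)⁻¹ * ∑ i ∈ Finset.range n, f (Z i ω))) P := by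
      intro f hf
      refine Integrable.of_bound (ee_cont.measurable.comp (Measurable.const_mul ?_ _)).aestronglyMeasurable 1
        (ae_of_all _ fun ω => (norm_ee _).le)
      exact Finset.measurable_sum _ fun i _ => hf.comp (h.meas i)
    have j1 := ie f g.sm.measurable
    have j2 := ie _ g'.sm.measurable
    rw [← integral_sub j1 j2]
    refine (norm_integral_le_integral_norm _).trans ?_
    have m := (hgood M).memLp_sum h (Finset.range n)
    have a1 := int_norm_sq_le m
    have a2 := (hgood M).l2 h (Finset.range n)
    rw [Finset.card_range] at a2
    have a3 : ∫ ω, ‖∑ i ∈ Finset.range n, (f (Z i ω) - fM M (Z i ω))‖ ∂P ≤ √ (KC C * Ns M ^ 2 * n) :=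
      Real.le_sqrt_of_sq_le (a1.trans a2)
    have hsn : 0 < √(n : ℝ) := Real.sqrt_pos.2 hn0
    have a4 : √ (KC C * Ns M ^ 2 ) = (√n)⁻¹ * √ (KC C * Ns M ^ 2 * n) := by
      rw [Real.sqrt_mul (by positivity) (n : ℝ)]; field_simp
    rw [a4]
    refine le_trans ?_ (mul_le_mul_of_nonneg_left a3 (inv_nonneg.2 hsn.le))
    rw [← integral_const_mul]
    refine integral_mono (j1.sub j2).norm (((m.integrable (by norm_num)).norm).const_mul _) fun ω => ?_
    simp only
    refine (ee_lip _ _).trans (le_of_eq ?_)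
    rw [← mul_sub, abs_mul, abs_of_pos (inv_pos.2 hsn), Real.norm_eq_abs, ← Finset.sum_sub_distrib]
  · have hc : Continuous fun x : ℝ => Complex.exp (-(x / 2 : ℝ)) := by fun_prop
    exact (hc.tendsto σ2).comp hsl

end CLT

section PD

universe u

set_option linter.unusedSectionVars false

/-- Positive semidefinite real kernels. -/
structure PDK {T : Type*} (K : T → T → ℝ) : Prop where
  symm : ∀ s t, K s t = K t s
  nonneg : ∀ (n : ℕ) (x : Fin n → T) (c : Fin n → ℝ), 0 ≤ ∑ i, ∑ j, c i * c j * K (x i) (x j)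

lemma PDK.finset {T : Type*} {K : T → T → ℝ} (h : PDK K) {ι : Type*} (s : Finset ι) (x : ι → T)
    (c : ι → ℝ) : 0 ≤ ∑ i ∈ s, ∑ j ∈ s, c i * c j * K (x i) (x j) := by
  have := h.nonneg s.card (fun i => x (s.equivFin.symm i)) (fun i => c (s.equivFin.symm i))
  rw [← Finset.sum_coe_sort s, ← s.equivFin.symm.sum_comp]
  refine this.trans (le_of_eq (Finset.sum_congr rfl fun i _ => ?_))
  rw [← Finset.sum_coe_sort s, ← s.equivFin.symm.sum_comp]

lemma PDK.of_inner {T E : Type*} [NormedAddCommGroup E] [InnerProductSpace ℝ E] (Φ : T → E) :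
    PDK (fun s t => inner ℝ (Φ s) (Φ t)) where
  symm s t := real_inner_comm _ _
  nonneg n x c := by
    have : ∑ i, ∑ j, c i * c j * inner ℝ (Φ (x i)) (Φ (x j)) =
        inner ℝ (∑ i, c i • Φ (x i)) (∑ i, c i • Φ (x i)) := by
      rw [sum_inner]
      refine Finset.sum_congr rfl fun i _ => ?_
      rw [inner_sum]
      refine Finset.sum_congr rfl fun j _ => ?_
      rw [real_inner_smul_left, real_inner_smul_right]; ring
    rw [this]
    exact real_inner_self_nonneg

/-- Kolmogorov/Moore: a psd kernel is a Gram kernel. -/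
lemma PDK.exists_repr {T : Type u} {K : T → T → ℝ} (h : PDK K) :
    ∃ (H : Type u) (_ : NormedAddCommGroup H) (_ : InnerProductSpace ℝ H) (_ : CompleteSpace H)
      (Φ : T → H), ∀ s t, inner ℝ (Φ s) (Φ t) = K s t := by
  let M : Matrix T T (ℝ →L[ℝ] ℝ) := Matrix.of fun s t => K s t • ContinuousLinearMap.id ℝ ℝ
  have hM : M.PosSemidef := by
    have tf := (RKHS.posSemidef_tfae (K := M)).out 0 2
    rw [tf]
    refine ⟨?_, fun vv => ?_⟩
    · ext s t
      have e1 : star (ContinuousLinearMap.id ℝ ℝ) = ContinuousLinearMap.id ℝ ℝ :=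
        star_one (ℝ →L[ℝ] ℝ)
      simp [M, Matrix.conjTranspose, h.symm s t, e1]
    · simp only [Finsupp.sum, M]
      refine (h.finset vv.support id (fun t => vv t)).trans (le_of_eq ?_)
      simp only [RCLike.re_to_real, id]
      refine Finset.sum_congr rfl fun i _ => Finset.sum_congr rfl fun j _ => ?_
      simp [h.symm i j]; ring
  have : Fact M.PosSemidef := ⟨hM⟩
  refine ⟨RKHS.OfKernel M, inferInstance, inferInstance, inferInstance,
    fun t => RKHS.kerFun (RKHS.OfKernel M) t 1, fun s t => ?_⟩
  have := RKHS.kernel_inner (RKHS.OfKernel M) t s 1 1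
  rw [RKHS.OfKernel.kernel_ofKernel] at this
  rw [← this]
  simp [M, h.symm s t]

lemma PDK.mul {T : Type u} {K L : T → T → ℝ} (h : PDK K) (h' : PDK L) :
    PDK (fun s t => K s t * L s t) := by
  obtain ⟨H, i1, i2, i3, Φ, hΦ⟩ := h.exists_repr
  obtain ⟨H', j1, j2, j3, Ψ, hΨ⟩ := h'.exists_repr
  have := PDK.of_inner (fun t => Φ t ⊗ₜ[ℝ] Ψ t)
  simpa [hΦ, hΨ] using this

lemma PDK.one {T : Type*} : PDK (fun _ _ : T => (1 : ℝ)) := by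
  simpa using PDK.of_inner (fun _ : T => (1 : ℝ))

lemma PDK.pow {T : Type u} {K : T → T → ℝ} (h : PDK K) (k : ℕ) : PDK (fun s t => K s t ^ k) := by
  induction k with
  | zero => simpa using PDK.one
  | succ k ih => simpa [pow_succ] using ih.mul h

lemma PDK.smul {T : Type*} {K : T → T → ℝ} (h : PDK K) {a : ℝ} (ha : 0 ≤ a) :
    PDK (fun s t => a * K s t) where
  symm s t := by rw [h.symm]
  nonneg n x c := by
    have := mul_nonneg ha (h.nonneg n x c)
    refine this.trans (le_of_eq ?_)
    rw [Finset.mul_sum]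
    refine Finset.sum_congr rfl fun i _ => ?_
    rw [Finset.mul_sum]
    exact Finset.sum_congr rfl fun j _ => by ring

lemma PDK.exp {T : Type u} {K : T → T → ℝ} (h : PDK K) : PDK (fun s t => Real.exp (K s t)) where
  symm s t := by rw [h.symm]
  nonneg n x c := by
    have hs : HasSum (fun k : ℕ => ∑ i, ∑ j, c i * c j * ((k.factorial : ℝ)⁻¹ * K (x i) (x j) ^ k))
        (∑ i, ∑ j, c i * c j * Real.exp (K (x i) (x j))) := by
      refine hasSum_sum fun i _ => hasSum_sum fun j _ => HasSum.mul_left _ ?_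
      have := NormedSpace.exp_series_hasSum_exp' (𝕂 := ℝ) (K (x i) (x j))
      rw [← Real.exp_eq_exp_ℝ] at this
      simpa using this
    refine hs.nonneg fun k => ?_
    exact ((h.pow k).smul (a := (k.factorial : ℝ)⁻¹) (by positivity)).nonneg n x c

lemma PDK.scale {T : Type*} {K : T → T → ℝ} (h : PDK K) (g : T → ℝ) :
    PDK (fun s t => g s * g t * K s t) where
  symm s t := by rw [h.symm]; ring
  nonneg n x c := by
    refine (h.nonneg n x (fun i => c i * g (x i))).trans (le_of_eq ?_)
    exact Finset.sum_congr rfl fun i _ => Finset.sum_congr rfl fun j _ => by ring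

lemma PDK.gauss {T : Type u} {E : Type*} [NormedAddCommGroup E] [InnerProductSpace ℝ E] (e : T → E)
    {a : ℝ} (ha : 0 ≤ a) : PDK (fun s t => Real.exp (-a * ‖e s - e t‖ ^ 2)) := by
  have := (((PDK.of_inner e).smul (a := 2 * a) (by positivity)).exp).scale
    (fun t => Real.exp (-a * ‖e t‖ ^ 2))
  refine (funext₂ fun s t => ?_ : (fun s t => Real.exp (-a * ‖e s - e t‖ ^ 2)) = _) ▸ this
  rw [← Real.exp_add, ← Real.exp_add, norm_sub_sq_real]
  congr 1; ring

lemma PDK.resolvent {T : Type u} {E : Type*} [NormedAddCommGroup E] [InnerProductSpace ℝ E] (e : T → E)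
    {t : ℝ} (ht : 0 < t) : PDK (fun s s' => (t + ‖e s - e s'‖ ^ 2)⁻¹) where
  symm s s' := by rw [norm_sub_rev]
  nonneg n x c := by
    have key : ∀ y : ℝ, 0 ≤ y → IntegrableOn (fun a => Real.exp (-(t + y) * a)) (Set.Ioi 0) ∧
        ∫ a in Set.Ioi (0 : ℝ), Real.exp (-(t + y) * a) = (t + y)⁻¹ := by
      intro y hy
      have hneg : -(t + y) < 0 := by linarith
      refine ⟨integrableOn_exp_mul_Ioi hneg 0, ?_⟩
      rw [integral_exp_mul_Ioi hneg]
      rw [mul_zero, Real.exp_zero, neg_div_neg_eq, one_div]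
    have e1 : ∑ i, ∑ j, c i * c j * (t + ‖e (x i) - e (x j)‖ ^ 2)⁻¹ =
        ∫ a in Set.Ioi (0 : ℝ), ∑ i, ∑ j, c i * c j * Real.exp (-(t + ‖e (x i) - e (x j)‖ ^ 2) * a) := by
      rw [integral_finsetSum]
      · refine Finset.sum_congr rfl fun i _ => ?_
        rw [integral_finsetSum]
        · refine Finset.sum_congr rfl fun j _ => ?_
          rw [integral_const_mul, (key _ (sq_nonneg _)).2]
        · exact fun j _ => (key _ (sq_nonneg _)).1.const_mul _
      · exact fun i _ => integrable_finsetSum _ fun j _ => (key _ (sq_nonneg _)).1.const_mul _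
    rw [e1]
    refine setIntegral_nonneg measurableSet_Ioi fun a ha => ?_
    have := ((PDK.gauss e (le_of_lt ha)).smul (a := Real.exp (-t * a)) (by positivity)).nonneg n x c
    refine this.trans (le_of_eq ?_)
    refine Finset.sum_congr rfl fun i _ => Finset.sum_congr rfl fun j _ => ?_
    rw [← Real.exp_add]
    congr 2; ring

lemma cnd_rpow {T : Type u} {E : Type*} [NormedAddCommGroup E] [InnerProductSpace ℝ E] (e : T → E)
    {p : ℝ} (hp : p ∈ Set.Ioo (0 : ℝ) 1) (n : ℕ) (x : Fin n → T) (c : Fin n → ℝ)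
    (hc : ∑ i, c i = 0) : ∑ i, ∑ j, c i * c j * (‖e (x i) - e (x j)‖ ^ 2) ^ p ≤ 0 := by
  have hpos := Real.integral_rpowIntegrand₀₁_one_pos hp
  set A := ∫ t in Set.Ioi (0 : ℝ), Real.rpowIntegrand₀₁ p t 1
  have hInt : ∀ i j, IntegrableOn (fun t => Real.rpowIntegrand₀₁ p t (‖e (x i) - e (x j)‖ ^ 2)) (Set.Ioi 0) :=
    fun i j => Real.integrableOn_rpowIntegrand₀₁_Ioi hp (sq_nonneg _)
  have e1 : (∑ i, ∑ j, c i * c j * (‖e (x i) - e (x j)‖ ^ 2) ^ p) * A =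
      ∫ t in Set.Ioi (0 : ℝ), ∑ i, ∑ j, c i * c j * Real.rpowIntegrand₀₁ p t (‖e (x i) - e (x j)‖ ^ 2) := by
    rw [integral_finsetSum, Finset.sum_mul]
    · refine Finset.sum_congr rfl fun i _ => ?_
      rw [integral_finsetSum, Finset.sum_mul]
      · refine Finset.sum_congr rfl fun j _ => ?_
        rw [integral_const_mul, Real.integral_rpowIntegrand₀₁_eq_rpow_mul_const hp (sq_nonneg _)]
        ring
      · exact fun j _ => (hInt i j).const_mul _
    · exact fun i _ => integrable_finsetSum _ fun j _ => (hInt i j).const_mul _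
  have e2 : (∑ i, ∑ j, c i * c j * (‖e (x i) - e (x j)‖ ^ 2) ^ p) * A ≤ 0 := by
    rw [e1]
    refine setIntegral_nonpos measurableSet_Ioi fun t ht => ?_
    have ht : 0 < t := ht
    have := mul_nonneg (Real.rpow_nonneg ht.le p) ((PDK.resolvent e ht).nonneg n x c)
    have e3 : ∑ i, ∑ j, c i * c j * Real.rpowIntegrand₀₁ p t (‖e (x i) - e (x j)‖ ^ 2) =
        t ^ p * t⁻¹ * ((∑ i, c i) * ∑ j, c j) -
        t ^ p * ∑ i, ∑ j, c i * c j * (t + ‖e (x i) - e (x j)‖ ^ 2)⁻¹ := by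
      rw [Finset.sum_mul_sum, Finset.mul_sum, Finset.mul_sum, ← Finset.sum_sub_distrib]
      refine Finset.sum_congr rfl fun i _ => ?_
      rw [Finset.mul_sum, Finset.mul_sum, ← Finset.sum_sub_distrib]
      refine Finset.sum_congr rfl fun j _ => ?_
      rw [Real.rpowIntegrand₀₁]; ring
    rw [e3, hc]
    linarith
  by_contra hcon
  push Not at hcon
  nlinarith

/-- Schoenberg embedding. -/
lemma schoenberg {T : Type u} {E : Type*} [NormedAddCommGroup E] [InnerProductSpace ℝ E] (e : T → E)
    {p : ℝ} (hp : p ∈ Set.Ioo (0 : ℝ) 1) (t₀ : T) :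
    ∃ (H : Type u) (_ : NormedAddCommGroup H) (_ : InnerProductSpace ℝ H) (_ : CompleteSpace H)
      (Φ : T → H), Φ t₀ = 0 ∧ ∀ s t, ‖Φ s - Φ t‖ ^ 2 = (‖e s - e t‖ ^ 2) ^ p := by
  set D : T → T → ℝ := fun s t => (‖e s - e t‖ ^ 2) ^ p with hD
  have Dsymm : ∀ s t, D s t = D t s := fun s t => by simp only [hD]; rw [norm_sub_rev]
  have D0 : ∀ s, D s s = 0 := fun s => by simp [hD, Real.zero_rpow hp.1.ne']
  have hK : PDK (fun s t => 2⁻¹ * (D s t₀ + D t t₀ - D s t)) := by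
    refine ⟨fun s t => by rw [Dsymm s t]; ring, fun n x c => ?_⟩
    have := cnd_rpow e hp (n + 1) (Fin.cons t₀ x) (Fin.cons (-∑ i, c i) c) (by
      simp [Fin.sum_univ_succ])
    simp only [Fin.sum_univ_succ, Fin.cons_zero, Fin.cons_succ] at this
    change (-∑ i, c i) * (-∑ i, c i) * D t₀ t₀ + (∑ j, (-∑ i, c i) * c j * D t₀ (x j)) +
      ∑ i, (c i * (-∑ i, c i) * D (x i) t₀ + ∑ j, c i * c j * D (x i) (x j)) ≤ 0 at this
    rw [D0, Finset.sum_add_distrib] at this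
    have a1 : ∑ j, (-∑ i, c i) * c j * D t₀ (x j) = - ((∑ i, c i) * ∑ j, c j * D (x j) t₀) := by
      rw [Finset.mul_sum, ← Finset.sum_neg_distrib (f := fun i => (∑ i, c i) * (c i * D (x i) t₀))]
      exact Finset.sum_congr rfl fun j _ => by rw [Dsymm]; ring
    have a2 : ∑ i, c i * (-∑ i, c i) * D (x i) t₀ = - ((∑ i, c i) * ∑ j, c j * D (x j) t₀) := by
      rw [Finset.mul_sum, ← Finset.sum_neg_distrib (f := fun i => (∑ i, c i) * (c i * D (x i) t₀))]
      exact Finset.sum_congr rfl fun j _ => by ring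
    have a3 : ∑ i, ∑ j, c i * c j * (2⁻¹ * (D (x i) t₀ + D (x j) t₀ - D (x i) (x j))) =
        2⁻¹ * ((∑ i, c i * D (x i) t₀) * (∑ j, c j) + (∑ i, c i) * (∑ j, c j * D (x j) t₀) -
          ∑ i, ∑ j, c i * c j * D (x i) (x j)) := by
      rw [Finset.sum_mul_sum, Finset.sum_mul_sum, ← Finset.sum_add_distrib, ← Finset.sum_sub_distrib,
        Finset.mul_sum]
      refine Finset.sum_congr rfl fun i _ => ?_
      rw [← Finset.sum_add_distrib, ← Finset.sum_sub_distrib, Finset.mul_sum]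
      exact Finset.sum_congr rfl fun j _ => by ring
    rw [a3]
    rw [a1, a2] at this
    nlinarith
  obtain ⟨H, i1, i2, i3, Φ, hΦ⟩ := hK.exists_repr
  refine ⟨H, i1, i2, i3, Φ, ?_, fun s t => ?_⟩
  · have := hΦ t₀ t₀
    rw [real_inner_self_eq_norm_sq, D0] at this
    simpa using this
  · rw [norm_sub_sq_real, ← real_inner_self_eq_norm_sq, ← real_inner_self_eq_norm_sq, hΦ, hΦ, hΦ, D0, D0]
    ring

end PD

section Dcov

universe u v

set_option linter.unusedSectionVars false

lemma dM_eq {X H : Type*} [MeasurableSpace X] [NormedAddCommGroup H] [InnerProductSpace ℝ H]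
    [CompleteSpace H] (Φ : X → H) (μ : Measure X) [IsProbabilityMeasure μ] (hΦ : MemLp Φ 2 μ)
    (ρ : X → X → ℝ) (hρ : ∀ x x', ρ x x' = ‖Φ x - Φ x'‖ ^ 2) (x x' : X) :
    dM ρ μ x x' = -2 * inner ℝ (Φ x - ∫ a, Φ a ∂μ) (Φ x' - ∫ a, Φ a ∂μ) := by
  set m := ∫ a, Φ a ∂μ with hm
  set s := ∫ a, ‖Φ a‖ ^ 2 ∂μ with hs
  have i1 : Integrable Φ μ := hΦ.integrable (by norm_num)
  have i2 : Integrable (fun a => ‖Φ a‖ ^ 2) μ := (memLp_two_iff_integrable_sq_norm hΦ.1).1 hΦ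
  have i3 : ∀ y, Integrable (fun a => inner ℝ (Φ y) (Φ a)) μ := fun y => i1.const_inner _
  have ha : ∀ y, aM ρ μ y = ‖Φ y‖ ^ 2 - 2 * inner ℝ (Φ y) m + s := by
    intro y
    simp only [aM, hρ, norm_sub_sq_real]
    have j1 : Integrable (fun a => ‖Φ y‖ ^ 2 - 2 * inner ℝ (Φ y) (Φ a)) μ :=
      (integrable_const _).sub ((i3 y).const_mul 2)
    rw [integral_add j1 i2, integral_sub (integrable_const _) ((i3 y).const_mul 2), integral_const_mul,
      integral_inner i1]
    simp
    ring
  have hd : DM ρ μ = 2 * s - 2 * ‖m‖ ^ 2 := by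
    have k1 : Integrable (fun p : X × X => ‖Φ p.1‖ ^ 2) (μ.prod μ) := i2.comp_fst μ
    have k2 : Integrable (fun p : X × X => ‖Φ p.2‖ ^ 2) (μ.prod μ) := i2.comp_snd μ
    have m1 : AEStronglyMeasurable (fun p : X × X => Φ p.1) (μ.prod μ) := hΦ.1.comp_fst
    have m2 : AEStronglyMeasurable (fun p : X × X => Φ p.2) (μ.prod μ) := hΦ.1.comp_snd
    have hInt : Integrable (fun p : X × X => ρ p.1 p.2) (μ.prod μ) := by
      simp only [hρ]
      refine Integrable.mono' ((k1.const_mul 2).add (k2.const_mul 2)) ((m1.sub m2).norm.pow 2)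
        (ae_of_all _ fun p => ?_)
      rw [Real.norm_of_nonneg (by positivity)]
      simp only [Pi.add_apply]
      have := norm_sub_le (Φ p.1) (Φ p.2)
      have h0 := norm_nonneg (Φ p.1 - Φ p.2)
      nlinarith [sq_nonneg (‖Φ p.1‖ - ‖Φ p.2‖)]
    rw [DM, integral_prod _ hInt]
    have : ∀ y, ∫ a, ρ y a ∂μ = ‖Φ y‖ ^ 2 - 2 * inner ℝ (Φ y) m + s := ha
    simp only [this]
    have i4 : Integrable (fun a => inner ℝ (Φ a) m) μ := i1.inner_const _
    have j1 : Integrable (fun a => ‖Φ a‖ ^ 2 - 2 * inner ℝ (Φ a) m) μ := i2.sub (i4.const_mul 2)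
    rw [integral_add j1 (integrable_const _), integral_sub i2 (i4.const_mul 2), integral_const_mul]
    have e : ∫ a, inner ℝ (Φ a) m ∂μ = ‖m‖ ^ 2 := by
      simp_rw [real_inner_comm m]
      rw [integral_inner i1, real_inner_self_eq_norm_sq]
    rw [e]
    simp
    ring
  rw [dM, ha, ha, hd, hρ, norm_sub_sq_real, inner_sub_left, inner_sub_right, inner_sub_right,
    real_inner_self_eq_norm_sq, real_inner_comm (Φ x') m]
  ring

lemma exists_tensor (H₁ : Type u) (H₂ : Type v) [NormedAddCommGroup H₁] [InnerProductSpace ℝ H₁]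
    [NormedAddCommGroup H₂] [InnerProductSpace ℝ H₂] :
    ∃ (H : Type (max u v)) (_ : NormedAddCommGroup H) (_ : InnerProductSpace ℝ H) (_ : CompleteSpace H)
      (B : H₁ →L[ℝ] H₂ →L[ℝ] H), ∀ a a' b b', inner ℝ (B a b) (B a' b') = inner ℝ a a' * inner ℝ b b' := by
  refine ⟨UniformSpace.Completion (TensorProduct ℝ H₁ H₂), inferInstance, inferInstance, inferInstance,
    (ContinuousLinearMap.compL ℝ H₂ (TensorProduct ℝ H₁ H₂) _ UniformSpace.Completion.toComplL) ∘L
      TensorProduct.mkL ℝ H₁ H₂, fun a a' b b' => ?_⟩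
  simp

lemma inner_prod_integral {Z H : Type*} [MeasurableSpace Z] [NormedAddCommGroup H] [InnerProductSpace ℝ H]
    [CompleteSpace H] (θ : Measure Z) [SFinite θ] (u : Z → H) (hu : Integrable u θ) :
    ∫ p : Z × Z, inner ℝ (u p.1) (u p.2) ∂(θ.prod θ) = ‖∫ z, u z ∂θ‖ ^ 2 := by
  have hInt : Integrable (fun p : Z × Z => inner ℝ (u p.1) (u p.2)) (θ.prod θ) := by
    refine Integrable.mono' (hu.norm.mul_prod hu.norm) (hu.1.comp_fst.inner hu.1.comp_snd)
      (ae_of_all _ fun p => norm_inner_le_norm _ _)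
  rw [integral_prod _ hInt]
  simp only [integral_inner hu]
  simp_rw [real_inner_comm (∫ z, u z ∂θ)]
  rw [integral_inner hu, real_inner_self_eq_norm_sq]

variable {X Y H₁ H₂ H : Type*} [MeasurableSpace X] [MeasurableSpace Y]
  [NormedAddCommGroup H₁] [InnerProductSpace ℝ H₁] [CompleteSpace H₁]
  [NormedAddCommGroup H₂] [InnerProductSpace ℝ H₂] [CompleteSpace H₂]
  [NormedAddCommGroup H] [InnerProductSpace ℝ H] [CompleteSpace H]

lemma deltaTheta_eq (B : H₁ →L[ℝ] H₂ →L[ℝ] H)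
    (hB : ∀ a a' b b', inner ℝ (B a b) (B a' b') = inner ℝ a a' * inner ℝ b b')
    (Φ : X → H₁) (Ψ : Y → H₂) (θ : Measure (X × Y)) [IsProbabilityMeasure θ]
    (hΦ : MemLp Φ 2 (θ.map Prod.fst)) (hΨ : MemLp Ψ 2 (θ.map Prod.snd))
    (ρX : X → X → ℝ) (ρY : Y → Y → ℝ)
    (hρX : ∀ x x', ρX x x' = ‖Φ x - Φ x'‖ ^ 2) (hρY : ∀ x x', ρY x x' = ‖Ψ x - Ψ x'‖ ^ 2) (z z' : X × Y) :
    deltaTheta ρX ρY θ z z' = 4 * inner ℝ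
      (B (Φ z.1 - ∫ a, Φ a ∂(θ.map Prod.fst)) (Ψ z.2 - ∫ a, Ψ a ∂(θ.map Prod.snd)))
      (B (Φ z'.1 - ∫ a, Φ a ∂(θ.map Prod.fst)) (Ψ z'.2 - ∫ a, Ψ a ∂(θ.map Prod.snd))) := by
  have : IsProbabilityMeasure (θ.map Prod.fst) := Measure.isProbabilityMeasure_map (by fun_prop)
  have : IsProbabilityMeasure (θ.map Prod.snd) := Measure.isProbabilityMeasure_map (by fun_prop)
  rw [deltaTheta, dM_eq Φ _ hΦ ρX hρX, dM_eq Ψ _ hΨ ρY hρY, hB]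
  ring

lemma integral_emp {Ω 𝒵 E : Type*} [MeasurableSpace 𝒵] [NormedAddCommGroup E] [NormedSpace ℝ E]
    [CompleteSpace E] (Z : ℕ → Ω → 𝒵) (n : ℕ) (ω : Ω) (f : 𝒵 → E) (hf : StronglyMeasurable f) :
    ∫ z, f z ∂(emp Z n ω) = (n : ℝ)⁻¹ • ∑ i ∈ Finset.range n, f (Z i ω) := by
  rw [emp, integral_smul_measure, integral_finsetSum_measure]
  · congr 1
    · simp
    · exact Finset.sum_congr rfl fun i _ => integral_dirac' _ _ hf
  · exact fun i _ => integrable_dirac' hf (by simp)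

lemma memLp_emp {Ω 𝒵 E : Type*} [MeasurableSpace 𝒵] [NormedAddCommGroup E]
    (Z : ℕ → Ω → 𝒵) (n : ℕ) (hn : n ≠ 0) (ω : Ω) (f : 𝒵 → E) (hf : StronglyMeasurable f) :
    MemLp f 2 (emp Z n ω) := by
  rw [memLp_two_iff_integrable_sq_norm hf.aestronglyMeasurable, emp]
  refine Integrable.smul_measure ?_ (by simp [hn])
  rw [integrable_finsetSum_measure]
  exact fun i _ => integrable_dirac' (hf.norm.pow 2) (by simp)

lemma isProb_emp {Ω 𝒵 : Type*} [MeasurableSpace 𝒵] (Z : ℕ → Ω → 𝒵) (n : ℕ) (hn : n ≠ 0) (ω : Ω) :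
    IsProbabilityMeasure (emp Z n ω) := by
  constructor
  simp only [emp, Measure.smul_apply, Measure.finsetSum_apply, measure_univ, Finset.sum_const,
    Finset.card_range, smul_eq_mul, nsmul_eq_mul, mul_one]
  exact ENNReal.inv_mul_cancel (by simpa using hn) (by simp)

lemma dcov_emp {Ω : Type*} (B : H₁ →L[ℝ] H₂ →L[ℝ] H)
    (hB : ∀ a a' b b', inner ℝ (B a b) (B a' b') = inner ℝ a a' * inner ℝ b b')
    (Φ : X → H₁) (Ψ : Y → H₂) (hΦ : StronglyMeasurable Φ) (hΨ : StronglyMeasurable Ψ)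
    (ρX : X → X → ℝ) (ρY : Y → Y → ℝ)
    (hρX : ∀ x x', ρX x x' = ‖Φ x - Φ x'‖ ^ 2) (hρY : ∀ x x', ρY x x' = ‖Ψ x - Ψ x'‖ ^ 2)
    (Z : ℕ → Ω → X × Y) (n : ℕ) (hn : n ≠ 0) (ω : Ω) :
    (n : ℝ) * dcov ρX ρY (emp Z n ω) =
      (2 * ‖(√n)⁻¹ • ∑ i ∈ Finset.range n, B (Φ (Z i ω).1) (Ψ (Z i ω).2) -
        √n • B ((n : ℝ)⁻¹ • ∑ i ∈ Finset.range n, Φ (Z i ω).1)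
          ((n : ℝ)⁻¹ • ∑ i ∈ Finset.range n, Ψ (Z i ω).2)‖) ^ 2 := by
  have := isProb_emp Z n hn ω
  have s1 : StronglyMeasurable (fun z : X × Y => Φ z.1) := hΦ.comp_measurable measurable_fst
  have s2 : StronglyMeasurable (fun z : X × Y => Ψ z.2) := hΨ.comp_measurable measurable_snd
  have m1 : MemLp Φ 2 ((emp Z n ω).map Prod.fst) :=
    (memLp_map_measure_iff hΦ.aestronglyMeasurable measurable_fst.aemeasurable).2
      (memLp_emp Z n hn ω _ s1)
  have m2 : MemLp Ψ 2 ((emp Z n ω).map Prod.snd) :=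
    (memLp_map_measure_iff hΨ.aestronglyMeasurable measurable_snd.aemeasurable).2
      (memLp_emp Z n hn ω _ s2)
  have e1 : ∫ a, Φ a ∂((emp Z n ω).map Prod.fst) = (n : ℝ)⁻¹ • ∑ i ∈ Finset.range n, Φ (Z i ω).1 := by
    rw [integral_map measurable_fst.aemeasurable hΦ.aestronglyMeasurable, integral_emp Z n ω _ s1]
  have e2 : ∫ a, Ψ a ∂((emp Z n ω).map Prod.snd) = (n : ℝ)⁻¹ • ∑ i ∈ Finset.range n, Ψ (Z i ω).2 := by
    rw [integral_map measurable_snd.aemeasurable hΨ.aestronglyMeasurable, integral_emp Z n ω _ s2]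
  simp only [dcov, deltaTheta_eq B hB Φ Ψ (emp Z n ω) m1 m2 ρX ρY hρX hρY]
  rw [e1, e2]
  set a := (n : ℝ)⁻¹ • ∑ i ∈ Finset.range n, Φ (Z i ω).1 with ha
  set b := (n : ℝ)⁻¹ • ∑ i ∈ Finset.range n, Ψ (Z i ω).2 with hb
  have hc : Continuous fun p : H₁ × H₂ => B p.1 p.2 := B.isBoundedBilinearMap.continuous
  have s3 : StronglyMeasurable (fun z : X × Y => B (Φ z.1 - a) (Ψ z.2 - b)) :=
    hc.comp_stronglyMeasurable ((s1.sub stronglyMeasurable_const).prodMk (s2.sub stronglyMeasurable_const))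
  rw [integral_const_mul, inner_prod_integral (emp Z n ω) (fun z : X × Y => B (Φ z.1 - a) (Ψ z.2 - b))
    ((memLp_emp Z n hn ω _ s3).integrable (by norm_num)), integral_emp Z n ω _ s3]
  have hn0 : (0 : ℝ) < n := by exact_mod_cast Nat.pos_of_ne_zero hn
  have hsn : 0 < √(n : ℝ) := Real.sqrt_pos.2 hn0
  have hss : √(n : ℝ) ^ 2 = n := Real.sq_sqrt hn0.le
  have ha' : ∑ i ∈ Finset.range n, Φ (Z i ω).1 = (n : ℝ) • a := by rw [ha, smul_inv_smul₀ hn0.ne']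
  have hb' : ∑ i ∈ Finset.range n, Ψ (Z i ω).2 = (n : ℝ) • b := by rw [hb, smul_inv_smul₀ hn0.ne']
  have e3 : ∑ i ∈ Finset.range n, B (Φ (Z i ω).1 - a) (Ψ (Z i ω).2 - b) =
      ∑ i ∈ Finset.range n, B (Φ (Z i ω).1) (Ψ (Z i ω).2) - (n : ℝ) • B a b := by
    simp only [map_sub, _root_.sub_apply, Finset.sum_sub_distrib]
    rw [← map_sum (B a), ← _root_.sum_apply, ← map_sum B, ha', hb']
    simp only [map_smul, _root_.smul_apply, Finset.sum_const, Finset.card_range, ← Nat.cast_smul_eq_nsmul ℝ]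
    abel
  have e4 : (√n)⁻¹ • ∑ i ∈ Finset.range n, B (Φ (Z i ω).1) (Ψ (Z i ω).2) - √n • B a b =
      √(n : ℝ) • ((n : ℝ)⁻¹ • ∑ i ∈ Finset.range n, B (Φ (Z i ω).1 - a) (Ψ (Z i ω).2 - b)) := by
    rw [e3, smul_sub, smul_sub, inv_smul_smul₀ hn0.ne', smul_smul]
    congr 2
    field_simp
    exact hss.symm
  rw [e4, norm_smul (√(n : ℝ)), Real.norm_of_nonneg hsn.le]
  rw [mul_pow, mul_pow, hss]
  ring

end Dcov

section Reduction

universe u v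

set_option linter.unusedSectionVars false

lemma sq_le_one_add_rpow {x ε : ℝ} (hx : 0 ≤ x) (hε : 0 < ε) : x ^ 2 ≤ 1 + x ^ (2 + 2 * ε) := by
  have h0 : 0 ≤ x ^ (2 + 2 * ε) := by positivity
  rcases le_total x 1 with h | h
  · nlinarith
  · have := Real.rpow_le_rpow_of_exponent_le h (by linarith : (2 : ℝ) ≤ 2 + 2 * ε)
    rw [Real.rpow_two] at this
    linarith

lemma memLp_two_of_rpow {X H : Type*} [MeasurableSpace X] [NormedAddCommGroup H] {μ : Measure X}
    [IsFiniteMeasure μ] {Φ : X → H} {ε : ℝ} (hε : 0 < ε) (hs : StronglyMeasurable Φ)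
    (hi : Integrable (fun x => ‖Φ x‖ ^ (2 + 2 * ε)) μ) : MemLp Φ 2 μ := by
  rw [memLp_two_iff_integrable_sq_norm hs.aestronglyMeasurable]
  refine Integrable.mono' ((integrable_const (1 : ℝ)).add hi) (hs.norm.pow 2).aestronglyMeasurable
    (ae_of_all _ fun x => ?_)
  rw [Real.norm_of_nonneg (by positivity)]
  exact sq_le_one_add_rpow (norm_nonneg _) hε

lemma embed1 {X : Type u} [MetricSpace X] [TopologicalSpace.SeparableSpace X] [MeasurableSpace X]
    [BorelSpace X] {H₁ : Type*} [NormedAddCommGroup H₁] [InnerProductSpace ℝ H₁]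
    (e : X → H₁) (he : ∀ x x' : X, ‖e x - e x'‖ = dist x x') {β ε : ℝ} (hβ : β ∈ Set.Ioo (1 : ℝ) 2)
    (hε : 0 < ε) (x₀ : X) (μ : Measure X) [IsProbabilityMeasure μ]
    (hmom : Integrable (fun x => dist x x₀ ^ ((1 + ε) * β)) μ) :
    ∃ (H : Type u) (_ : NormedAddCommGroup H) (_ : InnerProductSpace ℝ H) (_ : CompleteSpace H)
      (Φ : X → H), StronglyMeasurable Φ ∧ ∫ x, Φ x ∂μ = 0 ∧
      Integrable (fun x => ‖Φ x‖ ^ (2 + 2 * ε)) μ ∧ ∀ x x', dist x x' ^ β = ‖Φ x - Φ x'‖ ^ 2 := by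
  have hβ0 : 0 < β := by linarith [hβ.1]
  obtain ⟨H, i1, i2, i3, Φ, hΦ0, hΦ⟩ := schoenberg e (p := β / 2)
    ⟨by linarith [hβ.1], by linarith [hβ.2]⟩ x₀
  have hd : ∀ x x', dist x x' ^ β = ‖Φ x - Φ x'‖ ^ 2 := by
    intro x x'
    rw [hΦ, he, ← Real.rpow_natCast, ← Real.rpow_mul dist_nonneg]
    congr 1; push_cast; ring
  have hc : Continuous Φ := by
    rw [continuous_iff_continuousAt]
    intro x
    rw [ContinuousAt, tendsto_iff_norm_sub_tendsto_zero]
    have h1 : ∀ y, ‖Φ y - Φ x‖ = √ (dist y x ^ β) := fun y => by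
      rw [hd, Real.sqrt_sq (norm_nonneg _)]
    simp only [h1]
    have : Continuous fun y => √ (dist y x ^ β) :=
      (Real.continuous_sqrt.comp ((continuous_id.dist continuous_const).rpow_const fun _ => Or.inr hβ0.le))
    have := this.tendsto x
    simpa [Real.zero_rpow hβ0.ne'] using this
  have : SecondCountableTopology X := UniformSpace.secondCountable_of_separable X
  have sm : StronglyMeasurable Φ := hc.stronglyMeasurable
  have hInt : Integrable (fun x => ‖Φ x‖ ^ (2 + 2 * ε)) μ := by
    refine hmom.congr (ae_of_all _ fun x => ?_)
    have h1 : ‖Φ x‖ ^ (2 : ℝ) = dist x x₀ ^ β := by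
      rw [hd, hΦ0, sub_zero, Real.rpow_two]
    simp only
    rw [show 2 + 2 * ε = 2 * (1 + ε) by ring, Real.rpow_mul (norm_nonneg _), h1,
      ← Real.rpow_mul dist_nonneg, mul_comm]
  have hL : Integrable Φ μ := (memLp_two_of_rpow hε sm hInt).integrable (by norm_num)
  refine ⟨H, i1, i2, i3, fun x => Φ x - ∫ a, Φ a ∂μ, sm.sub stronglyMeasurable_const, ?_, ?_, ?_⟩
  · rw [integral_sub hL (integrable_const _)]
    simp
  · refine Integrable.mono' ((hInt.add (integrable_const (‖∫ a, Φ a ∂μ‖ ^ (2 + 2 * ε)))).const_mul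
      (2 ^ (2 + 2 * ε))) ?_ (ae_of_all _ fun x => ?_)
    · exact ((sm.sub stronglyMeasurable_const).norm.measurable.pow_const _).aestronglyMeasurable
    · rw [Real.norm_of_nonneg (by positivity)]
      refine (Real.rpow_le_rpow (norm_nonneg _) (norm_sub_le _ _) (by positivity)).trans ?_
      exact rpow_add_le_two (norm_nonneg _) (norm_nonneg _) (by positivity)
  · intro x x'
    rw [hd, sub_sub_sub_cancel_right]

theorem reduction (β : ℝ) (hβ : β ∈ Set.Ioo (1 : ℝ) 2)
    {X : Type u} {Y : Type v}
    [MetricSpace X] [TopologicalSpace.SeparableSpace X] [MeasurableSpace X] [BorelSpace X]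
    [MetricSpace Y] [TopologicalSpace.SeparableSpace Y] [MeasurableSpace Y] [BorelSpace Y]
    {H₁ H₂ : Type*}
    [NormedAddCommGroup H₁] [InnerProductSpace ℝ H₁]
    [NormedAddCommGroup H₂] [InnerProductSpace ℝ H₂]
    (φemb : X → H₁) (hφ : ∀ x x' : X, ‖φemb x - φemb x'‖ = dist x x')
    (ψemb : Y → H₂) (hψ : ∀ y y' : Y, ‖ψemb y - ψemb y'‖ = dist y y')
    {Ω : Type*} [MeasurableSpace Ω] (P : Measure Ω) [IsProbabilityMeasure P]
    (Z : ℕ → Ω → X × Y)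
    (θ : Measure (X × Y)) (hθ : θ = P.map (Z 0))
    (hindep : θ = (θ.map Prod.fst).prod (θ.map Prod.snd))
    (ε : ℝ) (x₀ : X) (y₀ : Y)
    (hmomX : Integrable (fun x => dist x x₀ ^ ((1 + ε) * β)) (θ.map Prod.fst))
    (hmomY : Integrable (fun y => dist y y₀ ^ ((1 + ε) * β)) (θ.map Prod.snd))
    (r : ℝ) (C : ℝ) (h : MixSeq P Z ε r C) :
    ∃ (H : Type (max u v)) (_ : NormedAddCommGroup H) (_ : InnerProductSpace ℝ H) (_ : CompleteSpace H)
      (w : X × Y → H) (N K : ℝ) (D : ℕ → Ω → H), Good P Z ε w N ∧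
      (∀ z z', deltaTheta (fun a b : X => dist a b ^ β)
          (fun a b : Y => dist a b ^ β) θ z z' = 4 * inner ℝ (w z) (w z')) ∧
      (∀ n : ℕ, n ≠ 0 → ∀ ω, (n : ℝ) * dcov (fun a b : X => dist a b ^ β)
                (fun a b : Y => dist a b ^ β) (emp Z n ω) =
          (2 * ‖(√n)⁻¹ • ∑ i ∈ Finset.range n, w (Z i ω) - D n ω‖) ^ 2) ∧
      (∀ n, StronglyMeasurable (D n)) ∧ (∀ n : ℕ, n ≠ 0 → Integrable (D n) P ∧ ∫ ω, ‖D n ω‖ ∂P ≤ K * (√n)⁻¹) := by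
  have hε := h.eps
  have hZ0 := h.meas 0
  have pθ : IsProbabilityMeasure θ := hθ ▸ Measure.isProbabilityMeasure_map hZ0.aemeasurable
  have p1 : IsProbabilityMeasure (θ.map Prod.fst) := Measure.isProbabilityMeasure_map (by fun_prop)
  have p2 : IsProbabilityMeasure (θ.map Prod.snd) := Measure.isProbabilityMeasure_map (by fun_prop)
  obtain ⟨E₁, i1, i2, i3, Φ, smΦ, mΦ, iΦ, dΦ⟩ := embed1 φemb hφ hβ hε x₀ (θ.map Prod.fst) hmomX
  obtain ⟨E₂, j1, j2, j3, Ψ, smΨ, mΨ, iΨ, dΨ⟩ := embed1 ψemb hψ hβ hε y₀ (θ.map Prod.snd) hmomY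
  obtain ⟨H, k1, k2, k3, B, hB⟩ := exists_tensor E₁ E₂
  have hc : Continuous fun p : E₁ × E₂ => B p.1 p.2 := B.isBoundedBilinearMap.continuous
  have s1 : StronglyMeasurable (fun z : X × Y => Φ z.1) := smΦ.comp_measurable measurable_fst
  have s2 : StronglyMeasurable (fun z : X × Y => Ψ z.2) := smΨ.comp_measurable measurable_snd
  have sw : StronglyMeasurable (fun z : X × Y => B (Φ z.1) (Ψ z.2)) :=
    hc.comp_stronglyMeasurable (s1.prodMk s2)
  have nB : ∀ a b, ‖B a b‖ = ‖a‖ * ‖b‖ := by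
    intro a b
    have := hB a a b b
    rw [real_inner_self_eq_norm_sq, real_inner_self_eq_norm_sq, real_inner_self_eq_norm_sq, ← mul_pow] at this
    exact (sq_eq_sq₀ (norm_nonneg _) (by positivity)).1 this
  -- transfer to P
  have tr : ∀ {E : Type (max u v)} [NormedAddCommGroup E] [NormedSpace ℝ E] (f : X × Y → E), StronglyMeasurable f →
      ∫ ω, f (Z 0 ω) ∂P = ∫ z, f z ∂θ := by
    intro E _ _ f hf
    rw [hθ, integral_map hZ0.aemeasurable hf.aestronglyMeasurable]
  have tri : ∀ (f : X × Y → ℝ), Integrable f θ → Integrable (fun ω => f (Z 0 ω)) P := by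
    intro f hf
    rw [hθ] at hf
    exact hf.comp_measurable hZ0
  have gΦ := Good.of_int (P := P) (Z := Z) (V := fun z : X × Y => Φ z.1) hε s1
    (tri _ (iΦ.comp_measurable measurable_fst)) (by
      have e : P.map (fun ω => (Z 0 ω).1) = θ.map Prod.fst := by
        rw [hθ, Measure.map_map measurable_fst hZ0]; rfl
      rw [← mΦ, ← e, integral_map hZ0.fst.aemeasurable smΦ.aestronglyMeasurable]) one_pos
  have gΨ := Good.of_int (P := P) (Z := Z) (V := fun z : X × Y => Ψ z.2) hε s2
    (tri _ (iΨ.comp_measurable measurable_snd)) (by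
      have e : P.map (fun ω => (Z 0 ω).2) = θ.map Prod.snd := by
        rw [hθ, Measure.map_map measurable_snd hZ0]; rfl
      rw [← mΨ, ← e, integral_map hZ0.snd.aemeasurable smΨ.aestronglyMeasurable]) one_pos
  have iw : Integrable (fun z : X × Y => ‖B (Φ z.1) (Ψ z.2)‖ ^ (2 + 2 * ε)) θ := by
    rw [hindep]
    refine (iΦ.mul_prod iΨ).congr (ae_of_all _ fun z => ?_)
    simp only [nB]
    rw [Real.mul_rpow (norm_nonneg _) (norm_nonneg _)]
  have LΨ : Integrable Ψ (θ.map Prod.snd) := (memLp_two_of_rpow hε smΨ iΨ).integrable (by norm_num)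
  have mw : ∫ z : X × Y, B (Φ z.1) (Ψ z.2) ∂θ = 0 := by
    have iw1 : Integrable (fun z : X × Y => B (Φ z.1) (Ψ z.2)) θ :=
      (memLp_two_of_rpow hε sw iw).integrable (by norm_num)
    rw [hindep] at iw1 ⊢
    rw [integral_prod _ iw1]
    have : ∀ x, ∫ y, B (Φ x) (Ψ y) ∂(θ.map Prod.snd) = 0 := by
      intro x
      rw [(B (Φ x)).integral_comp_comm LΨ, mΨ, map_zero]
    simp [this]
  have gw := Good.of_int (P := P) (Z := Z) (V := fun z : X × Y => B (Φ z.1) (Ψ z.2)) hε sw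
    (tri _ iw) (by rw [tr _ sw, mw]) one_pos
  obtain ⟨N₁, gΦ⟩ : ∃ N₁, Good P Z ε (fun z : X × Y => Φ z.1) N₁ := ⟨_, gΦ⟩
  obtain ⟨N₂, gΨ⟩ : ∃ N₂, Good P Z ε (fun z : X × Y => Ψ z.2) N₂ := ⟨_, gΨ⟩
  have sa : ∀ n : ℕ, StronglyMeasurable fun ω => (n : ℝ)⁻¹ • ∑ i ∈ Finset.range n, Φ (Z i ω).1 := fun n =>
    (Finset.stronglyMeasurable_fun_sum _ fun i _ => s1.comp_measurable (h.meas i)).const_smul _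
  have sb : ∀ n : ℕ, StronglyMeasurable fun ω => (n : ℝ)⁻¹ • ∑ i ∈ Finset.range n, Ψ (Z i ω).2 := fun n =>
    (Finset.stronglyMeasurable_fun_sum _ fun i _ => s2.comp_measurable (h.meas i)).const_smul _
  have sD : ∀ n : ℕ, StronglyMeasurable fun ω => √(n : ℝ) • B ((n : ℝ)⁻¹ • ∑ i ∈ Finset.range n, Φ (Z i ω).1)
      ((n : ℝ)⁻¹ • ∑ i ∈ Finset.range n, Ψ (Z i ω).2) := fun n =>
    (hc.comp_stronglyMeasurable ((sa n).prodMk (sb n))).const_smul _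
  refine ⟨H, k1, k2, k3, fun z => B (Φ z.1) (Ψ z.2), _, KC C * (N₁ ^ 2 + N₂ ^ 2),
    fun n ω => √(n : ℝ) • B ((n : ℝ)⁻¹ • ∑ i ∈ Finset.range n, Φ (Z i ω).1)
      ((n : ℝ)⁻¹ • ∑ i ∈ Finset.range n, Ψ (Z i ω).2), gw, ?_, ?_, sD, ?_⟩
  · intro z z'
    rw [deltaTheta_eq B hB Φ Ψ θ (memLp_two_of_rpow hε smΦ iΦ) (memLp_two_of_rpow hε smΨ iΨ) _ _ dΦ dΨ,
      mΦ, mΨ]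
    simp
  · intro n hn ω
    exact dcov_emp B hB Φ Ψ smΦ smΨ _ _ dΦ dΨ Z n hn ω
  · intro n hn
    have hn0 : (0 : ℝ) < n := by exact_mod_cast Nat.pos_of_ne_zero hn
    have hsn : 0 < √(n : ℝ) := Real.sqrt_pos.2 hn0
    have hss : √(n : ℝ) ^ 2 = n := Real.sq_sqrt hn0.le
    have l1 := gΦ.l2 h (Finset.range n)
    have l2 := gΨ.l2 h (Finset.range n)
    rw [Finset.card_range] at l1 l2
    have m1 := gΦ.memLp_sum h (Finset.range n)
    have m2 := gΨ.memLp_sum h (Finset.range n)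
    have i1 := (memLp_two_iff_integrable_sq_norm m1.1).1 m1
    have i2 := (memLp_two_iff_integrable_sq_norm m2.1).1 m2
    have hbd : ∀ ω, ‖√(n : ℝ) • B ((n : ℝ)⁻¹ • ∑ i ∈ Finset.range n, Φ (Z i ω).1)
        ((n : ℝ)⁻¹ • ∑ i ∈ Finset.range n, Ψ (Z i ω).2)‖ ≤ ((√n)⁻¹ * (n : ℝ)⁻¹) *
        (‖∑ i ∈ Finset.range n, Φ (Z i ω).1‖ ^ 2 + ‖∑ i ∈ Finset.range n, Ψ (Z i ω).2‖ ^ 2) := by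
      intro ω
      rw [norm_smul, nB, norm_smul, norm_smul, Real.norm_of_nonneg hsn.le,
        Real.norm_of_nonneg (inv_nonneg.2 hn0.le)]
      set a := ‖∑ i ∈ Finset.range n, Φ (Z i ω).1‖
      set b := ‖∑ i ∈ Finset.range n, Ψ (Z i ω).2‖
      have ha : 0 ≤ a := norm_nonneg _
      have hb : 0 ≤ b := norm_nonneg _
      have e1 : √(n : ℝ) * ((n : ℝ)⁻¹ * a * ((n : ℝ)⁻¹ * b)) = ((√n)⁻¹ * (n : ℝ)⁻¹) * (a * b) := by
        field_simp
        rw [hss]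
      rw [e1]
      gcongr
      nlinarith [sq_nonneg (a - b), mul_nonneg ha hb]
    have ib := (i1.add i2).const_mul ((√n)⁻¹ * (n : ℝ)⁻¹)
    have iD := Integrable.mono' ib (sD n).aestronglyMeasurable (ae_of_all _ hbd)
    refine ⟨iD, (integral_mono iD.norm ib hbd).trans ?_⟩
    simp only [Pi.add_apply]
    rw [integral_const_mul, integral_add i1 i2]
    calc _ ≤ ((√n)⁻¹ * (n : ℝ)⁻¹) * (KC C * N₁ ^ 2 * n + KC C * N₂ ^ 2 * n) := by gcongr
      _ = _ := by field_simp

end Reduction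

section Spectral

set_option linter.unusedSectionVars false

universe u

variable {H : Type u} [NormedAddCommGroup H] [InnerProductSpace ℝ H] [CompleteSpace H]

lemma exists_basis_of_family (V : ℝ → Submodule ℝ H) (hV : ∀ μ, IsClosed (V μ : Set H))
    (ho : OrthogonalFamily ℝ (fun μ => V μ) fun μ => (V μ).subtypeₗᵢ)
    (hb : (⨆ μ, V μ)ᗮ = ⊥) :
    ∃ (ι : Type u) (b : HilbertBasis ι ℝ H) (c : ι → ℝ), ∀ i, b i ∈ V (c i) := by
  have hcl : ∀ μ : ℝ, CompleteSpace (V μ) := fun μ => (hV μ).completeSpace_coe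
  choose W B hB using fun μ : ℝ => exists_hilbertBasis ℝ (V μ)
  obtain ⟨v, hv⟩ : ∃ v : (Σ μ : ℝ, W μ) → H, v = fun a => ((B a.1 a.2 : V a.1) : H) :=
    ⟨_, rfl⟩
  have on : Orthonormal ℝ v := by
    rw [hv]
    exact ho.orthonormal_sigma_orthonormal
      (v_family := fun μ i => B μ i) (fun μ => (B μ).orthonormal)
  have hbot : (Submodule.span ℝ (Set.range v))ᗮ = ⊥ := by
    rw [eq_bot_iff, ← hb]
    intro a ha
    rw [← Submodule.iInf_orthogonal, Submodule.mem_iInf]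
    intro μ
    rw [Submodule.mem_orthogonal]
    intro x hx
    have h1 := ((B μ).hasSum_repr ⟨x, hx⟩).mapL (Submodule.subtypeL _)
    have h2 := h1.mapL (innerSL ℝ a)
    have h3 : ∀ i, innerSL ℝ a ((Submodule.subtypeL _) ((B μ).repr ⟨x, hx⟩ i • B μ i)) = 0 := by
      intro i
      rw [Submodule.mem_orthogonal] at ha
      have := ha (v ⟨μ, i⟩) (Submodule.subset_span ⟨⟨μ, i⟩, rfl⟩)
      rw [hv] at this
      simp only [map_smul, innerSL_apply_apply, Submodule.subtypeL_apply]
      rw [real_inner_comm, this]; simp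
    simp only [h3] at h2
    have := h2.unique hasSum_zero
    simp only [innerSL_apply_apply, Submodule.subtypeL_apply] at this
    rw [real_inner_comm]; exact this
  refine ⟨(Σ μ : ℝ, W μ), HilbertBasis.mkOfOrthogonalEqBot on hbot, fun a => a.1, fun i => ?_⟩
  rw [HilbertBasis.coe_mkOfOrthogonalEqBot, hv]
  exact (B i.1 i.2).2

/-- A Hilbert basis of eigenvectors for a compact symmetric operator. -/
lemma exists_eigen_basis (T : H →L[ℝ] H) (hT : IsCompactOperator T)
    (hs : (T : H →ₗ[ℝ] H).IsSymmetric) :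
    ∃ (ι : Type u) (b : HilbertBasis ι ℝ H) (c : ι → ℝ), ∀ i, T (b i) = c i • b i := by
  obtain ⟨ι, b, c, h⟩ := exists_basis_of_family
    (fun μ => Module.End.eigenspace (T : H →ₗ[ℝ] H) μ) (fun μ => by
      have : (Module.End.eigenspace (T : H →ₗ[ℝ] H) μ : Set H) = {x | T x = μ • x} := by
        ext x; simp
      rw [this]
      exact isClosed_eq T.continuous (continuous_const_smul μ)) hs.orthogonalFamily_eigenspaces
    (ContinuousLinearMap.orthogonalComplement_iSup_eigenspaces_eq_bot hT hs)
  exact ⟨ι, b, c, fun i => Module.End.mem_eigenspace_iff.1 (h i)⟩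

variable {𝒵 : Type*} [MeasurableSpace 𝒵]

lemma exists_cov (θ : Measure 𝒵) [IsProbabilityMeasure θ] (w : 𝒵 → H) (sm : StronglyMeasurable w)
    (hw : MemLp w 2 θ) : ∃ T : H →L[ℝ] H, IsCompactOperator T ∧
      ∀ a b, inner ℝ (T a) b = ∫ z, inner ℝ (w z) a * inner ℝ (w z) b ∂θ := by
  let F : 𝒵 → H →L[ℝ] H := fun z => (innerSL ℝ (w z)).smulRight (w z)
  have hFn : ∀ z, ‖F z‖ = ‖w z‖ ^ 2 := fun z => by
    simp [F, ContinuousLinearMap.norm_smulRight_apply, sq]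
  have hFs : StronglyMeasurable F := by
    have : F = fun z => ContinuousLinearMap.smulRightL ℝ H H (innerSL ℝ (w z)) (w z) := by
      funext z; rfl
    rw [this]
    have hc : Continuous fun x : H => ContinuousLinearMap.smulRightL ℝ H H (innerSL ℝ x) x := by fun_prop
    exact hc.comp_stronglyMeasurable sm
  have hFi : Integrable F θ := by
    refine Integrable.mono' ((memLp_two_iff_integrable_sq_norm hw.1).1 hw) hFs.aestronglyMeasurable
      (ae_of_all _ fun z => (hFn z).le)
  refine ⟨∫ z, F z ∂θ, ?_, fun a b => ?_⟩
  · have hcv : Convex ℝ {f : H →L[ℝ] H | IsCompactOperator f} := by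
      intro f hf g hg a b _ _ _
      exact (hf.smul a).add (hg.smul b)
    refine hcv.integral_mem isClosed_setOfPred_isCompactOperator (ae_of_all _ fun z => ?_) hFi
    have h1 : IsCompactOperator (innerSL ℝ (w z) : H →L[ℝ] ℝ) :=
      isCompactOperator_of_locallyCompactSpace_dom (innerSL ℝ (w z) : H →L[ℝ] ℝ)
    exact h1.clm_comp ((ContinuousLinearMap.id ℝ ℝ).smulRight (w z))
  · rw [ContinuousLinearMap.integral_apply hFi, real_inner_comm, ← integral_inner]
    · refine integral_congr_ae (ae_of_all _ fun z => ?_)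
      simp only [F, ContinuousLinearMap.smulRight_apply, innerSL_apply_apply, inner_smul_right]
      rw [real_inner_comm b]
    · exact hFi.apply_continuousLinearMap a

/-- Karhunen–Loève basis. -/
theorem spectral (θ : Measure 𝒵) [IsProbabilityMeasure θ] (w : 𝒵 → H) (sm : StronglyMeasurable w)
    (hw : MemLp w 2 θ) : ∃ (e : ℕ → H) (c : ℕ → ℝ),
      (∀ k, 0 ≤ c k) ∧ (∀ k, c k ≠ 0 → ‖e k‖ = 1) ∧ (∀ k, ‖e k‖ ≤ 1) ∧
      (∀ i j, i ≠ j → inner ℝ (e i) (e j) = 0) ∧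
      (∀ k a, ∫ z, inner ℝ (w z) (e k) * inner ℝ (w z) a ∂θ = c k * inner ℝ (e k) a) ∧
      (∀ k z, inner ℝ (w z) (e k) ≠ 0 → ‖e k‖ = 1) ∧
      (∀ z, HasSum (fun k => inner ℝ (w z) (e k) • e k) (w z)) := by
  obtain ⟨T, hT, hTi⟩ := exists_cov θ w sm hw
  have hs : (T : H →ₗ[ℝ] H).IsSymmetric := by
    intro a b
    change inner ℝ (T a) b = inner ℝ a (T b)
    rw [hTi, real_inner_comm, hTi]
    simp only [mul_comm]
  obtain ⟨ι, b, c, hc⟩ := exists_eigen_basis T hT hs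
  have hcb : ∀ i a, c i * inner ℝ (b i) a = ∫ z, inner ℝ (w z) (b i) * inner ℝ (w z) a ∂θ := by
    intro i a
    rw [← hTi, hc, real_inner_smul_left]
  have bn : ∀ i, ‖b i‖ = 1 := fun i => b.orthonormal.1 i
  have hc0 : ∀ i, 0 ≤ c i := by
    intro i
    have := hcb i (b i)
    rw [real_inner_self_eq_norm_sq, bn, one_pow, mul_one] at this
    rw [this]
    exact integral_nonneg fun z => mul_self_nonneg _
  -- countable support
  have hcount : Set.Countable {i | ∃ z, inner ℝ (w z) (b i) ≠ 0} := by
    obtain ⟨S, hSc, hS⟩ := sm.isSeparable_range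
    have h1 : ∀ x : H, Set.Countable {i | inner ℝ x (b i) ≠ 0} := by
      intro x
      have := (b.hasSum_repr x).summable.countable_support
      refine this.mono fun i hi => ?_
      simp only [Function.mem_support]
      rw [b.repr_apply_apply, real_inner_comm]
      refine smul_ne_zero hi ?_
      intro h0
      have := bn i
      rw [h0] at this; simp at this
    refine (hSc.biUnion fun x _ => h1 x).mono ?_
    rintro i ⟨z, hz⟩
    by_contra hcon
    simp only [Set.mem_iUnion, not_exists] at hcon
    have hcl : IsClosed {x : H | inner ℝ x (b i) = (0 : ℝ)} :=
      isClosed_eq (by fun_prop) continuous_const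
    have : closure S ⊆ {x : H | inner ℝ x (b i) = (0 : ℝ)} := hcl.closure_subset_iff.2 fun x hx => by
      have := hcon x hx
      simpa using this
    exact hz (this (hS ⟨z, rfl⟩))
  set S : Set ι := {i | ∃ z, inner ℝ (w z) (b i) ≠ 0} with hS
  obtain ⟨f, hf⟩ : ∃ f : S → ℕ, Function.Injective f := Set.countable_iff_exists_injective.1 hcount
  let e : ℕ → H := Function.extend f (fun i : S => b i) 0
  let c' : ℕ → ℝ := Function.extend f (fun i : S => c i) 0
  have ef : ∀ i, e (f i) = b i := fun i => hf.extend_apply _ _ _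
  have cf : ∀ i, c' (f i) = c i := fun i => hf.extend_apply _ _ _
  have e0 : ∀ k, (¬ ∃ i, f i = k) → e k = 0 := fun k hk => Function.extend_apply' _ _ _ hk
  have c0 : ∀ k, (¬ ∃ i, f i = k) → c' k = 0 := fun k hk => Function.extend_apply' _ _ _ hk
  refine ⟨e, c', fun k => ?_, fun k => ?_, fun k => ?_, fun i j hij => ?_, fun k a => ?_, fun k z => ?_,
    fun z => ?_⟩
  · by_cases hk : ∃ i, f i = k
    · obtain ⟨i, rfl⟩ := hk; rw [cf]; exact hc0 _
    · rw [c0 k hk]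
  · by_cases hk : ∃ i, f i = k
    · obtain ⟨i, rfl⟩ := hk; rw [ef]; exact fun _ => bn _
    · rw [c0 k hk]; exact fun h => absurd rfl h
  · by_cases hk : ∃ i, f i = k
    · obtain ⟨i, rfl⟩ := hk; rw [ef]; exact (bn _).le
    · rw [e0 k hk]; simp
  · by_cases hi : ∃ l, f l = i
    · by_cases hj : ∃ l, f l = j
      · obtain ⟨i, rfl⟩ := hi
        obtain ⟨j, rfl⟩ := hj
        rw [ef, ef]
        refine b.orthonormal.2 fun h => hij ?_
        rw [Subtype.ext h]
      · rw [e0 j hj]; simp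
    · rw [e0 i hi]; simp
  · by_cases hk : ∃ i, f i = k
    · obtain ⟨i, rfl⟩ := hk; rw [ef, cf]; exact (hcb _ _).symm
    · rw [e0 k hk]; simp
  · by_cases hk : ∃ i, f i = k
    · obtain ⟨i, rfl⟩ := hk; rw [ef]; exact fun _ => bn _
    · rw [e0 k hk]; simp
  · rw [← hf.hasSum_iff]
    · have h1 : HasSum (fun i => inner ℝ (w z) (b i) • b i) (w z) := by
        have := b.hasSum_repr (w z)
        simpa only [b.repr_apply_apply, real_inner_comm] using this
      have h2 := (hasSum_subtype_iff_of_support_subset (s := S) (f := fun i => inner ℝ (w z) (b i) • b i)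
        (a := w z) (fun i hi => ?_)).2 h1
      · have : (fun k => inner ℝ (w z) (e k) • e k) ∘ f =
            (fun i => inner ℝ (w z) (b i) • b i) ∘ (Subtype.val : S → ι) := by
          funext i
          simp only [Function.comp_apply, ef]
        rw [this]; exact h2
      · refine ⟨z, fun h0 => hi ?_⟩
        simp [h0]
    · intro k hk
      rw [e0 k hk]; simp

end Spectral

section GaussSeq

set_option linter.unusedSectionVars false

lemma map_sum_gauss (M : ℕ) (b : ℕ → ℝ) :
    (Measure.infinitePi fun _ : ℕ => gaussianReal 0 1).map (fun ω => ∑ i ∈ Finset.range M, b i * ω i) =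
      gaussianReal 0 (Real.toNNReal (∑ i ∈ Finset.range M, b i ^ 2)) := by
  have hm : ∀ i, Measurable fun ω : ℕ → ℝ => b i * ω i := fun i => by fun_prop
  have hind : iIndepFun (fun i (ω : ℕ → ℝ) => b i * ω i) (Measure.infinitePi fun _ : ℕ => gaussianReal 0 1) :=
    iIndepFun_infinitePi (X := fun i x => b i * x) (fun i => by fun_prop)
  have h1 := iIndepFun.charFun_map_fun_finsetSum_eq_prod (s := Finset.range M)
    (fun i _ => (hm i).aemeasurable) (hind.restrict _)
  have hlaw : ∀ i, (Measure.infinitePi fun _ : ℕ => gaussianReal 0 1).map (fun ω => b i * ω i) =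
      gaussianReal 0 (.mk (b i ^ 2) (sq_nonneg _) * 1) := by
    intro i
    have e : (fun ω : ℕ → ℝ => b i * ω i) = (fun x => b i * x) ∘ (fun ω => ω i) := rfl
    rw [e, ← Measure.map_map (by fun_prop) (by fun_prop), Measure.infinitePi_map_eval,
      gaussianReal_map_const_mul, mul_zero]
  have hp : IsProbabilityMeasure ((Measure.infinitePi fun _ : ℕ => gaussianReal 0 1).map
      (fun ω => ∑ i ∈ Finset.range M, b i * ω i)) :=
    Measure.isProbabilityMeasure_map (Finset.measurable_fun_sum _ fun i _ => hm i).aemeasurable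
  refine Measure.ext_of_charFun ?_
  rw [h1]
  funext t
  simp only [Finset.prod_apply, hlaw, charFun_gaussianReal]
  rw [← Complex.exp_sum]
  congr 1
  rw [Real.coe_toNNReal _ (Finset.sum_nonneg fun i _ => sq_nonneg _)]
  simp [Finset.sum_mul, Finset.sum_div]

theorem exists_gauss (K : ℕ → ℕ → ℝ) (hK : PDK K) :
    ∃ (Ω' : Type) (_ : MeasurableSpace Ω') (P' : Measure Ω') (_ : IsProbabilityMeasure P')
      (G : ℕ → Ω' → ℝ), (∀ k, Measurable (G k)) ∧ ∀ (M : ℕ) (a : ℕ → ℝ),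
      P'.map (fun ω => ∑ k ∈ Finset.range M, a k * G k ω) = gaussianReal 0
        (Real.toNNReal (∑ i ∈ Finset.range M, ∑ j ∈ Finset.range M, a i * a j * K i j)) := by
  obtain ⟨H, i1, i2, i3, Φ, hΦ⟩ := hK.exists_repr
  let g := InnerProductSpace.gramSchmidt ℝ Φ
  have hex : ∀ k, ∃ c : ℕ → ℝ, ∑ i ∈ Finset.range (k + 1), c i • g i = Φ k := by
    intro k
    have : Φ k ∈ Submodule.span ℝ (g '' (Finset.range (k + 1) : Finset ℕ)) := by
      have e : ((Finset.range (k + 1) : Finset ℕ) : Set ℕ) = Set.Iic k := by ext x; simp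
      rw [e, InnerProductSpace.span_gramSchmidt_Iic]
      exact Submodule.subset_span ⟨k, Set.mem_Iic.2 le_rfl, rfl⟩
    rwa [Submodule.mem_span_image_finset_iff_exists_fun'] at this
  choose c hc using hex
  have ext : ∀ {E : Type} [AddCommMonoid E] (k M : ℕ) (f : ℕ → E), k < M →
      ∑ i ∈ Finset.range (k + 1), f i = ∑ i ∈ Finset.range M, if i ≤ k then f i else 0 := by
    intro E _ k M f hkM
    rw [← Finset.sum_filter]
    congr 1
    ext x; simp; omega
  let d : ℕ → ℕ → ℝ := fun k i => if i ≤ k then c k i else 0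
  have hd : ∀ k M, k < M → Φ k = ∑ i ∈ Finset.range M, d k i • g i := by
    intro k M hkM
    rw [← hc k, ext k M _ hkM]
    refine Finset.sum_congr rfl fun i _ => ?_
    simp only [d]; split_ifs <;> simp
  refine ⟨ℕ → ℝ, inferInstance, Measure.infinitePi fun _ => gaussianReal 0 1, inferInstance,
    fun k ω => ∑ i ∈ Finset.range (k + 1), (c k i * ‖g i‖) * ω i, fun k => by fun_prop, fun M a => ?_⟩
  have e1 : (fun ω : ℕ → ℝ => ∑ k ∈ Finset.range M, a k * ∑ i ∈ Finset.range (k + 1), (c k i * ‖g i‖) * ω i)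
      = fun ω => ∑ i ∈ Finset.range M, ((∑ k ∈ Finset.range M, a k * d k i) * ‖g i‖) * ω i := by
    funext ω
    calc _ = ∑ k ∈ Finset.range M, a k * ∑ i ∈ Finset.range M, (d k i * ‖g i‖) * ω i := by
          refine Finset.sum_congr rfl fun k hk => ?_
          rw [ext k M _ (Finset.mem_range.1 hk)]
          congr 1
          refine Finset.sum_congr rfl fun i _ => ?_
          simp only [d]; split_ifs <;> simp
      _ = _ := by
          simp only [Finset.mul_sum, Finset.sum_mul]
          rw [Finset.sum_comm]
          refine Finset.sum_congr rfl fun i _ => Finset.sum_congr rfl fun k _ => ?_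
          ring
  rw [e1, map_sum_gauss]
  congr 2
  -- both are ‖∑ a k Φ k‖²
  have n1 : ∑ i ∈ Finset.range M, ∑ j ∈ Finset.range M, a i * a j * K i j =
      ‖∑ k ∈ Finset.range M, a k • Φ k‖ ^ 2 := by
    rw [← real_inner_self_eq_norm_sq, sum_inner]
    refine Finset.sum_congr rfl fun i _ => ?_
    rw [inner_sum]
    refine Finset.sum_congr rfl fun j _ => ?_
    rw [real_inner_smul_left, real_inner_smul_right, hΦ]; ring
  have n2 : ∑ k ∈ Finset.range M, a k • Φ k =
      ∑ i ∈ Finset.range M, (∑ k ∈ Finset.range M, a k * d k i) • g i := by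
    calc _ = ∑ k ∈ Finset.range M, a k • ∑ i ∈ Finset.range M, d k i • g i :=
          Finset.sum_congr rfl fun k hk => by rw [← hd k M (Finset.mem_range.1 hk)]
      _ = _ := by
          simp only [Finset.smul_sum, Finset.sum_smul, smul_smul]
          rw [Finset.sum_comm]
  rw [n1, n2]
  generalize hq : (fun i => ∑ k ∈ Finset.range M, a k * d k i) = q
  have hq' : ∀ i, ∑ k ∈ Finset.range M, a k * d k i = q i := fun i => congrFun hq i
  simp only [hq']
  rw [← real_inner_self_eq_norm_sq, sum_inner]
  refine Finset.sum_congr rfl fun i hi => ?_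
  rw [inner_sum, Finset.sum_eq_single i]
  · rw [real_inner_smul_left, real_inner_smul_right, real_inner_self_eq_norm_sq]; ring
  · intro j _ hj
    rw [real_inner_smul_left, real_inner_smul_right,
      InnerProductSpace.gramSchmidt_orthogonal ℝ Φ hj.symm]
    simp
  · intro h; exact absurd hi h

end GaussSeq

section LongRun

set_option linter.unusedSectionVars false

variable {Ω 𝒵 : Type*} [mΩ : MeasurableSpace Ω] [m𝒵 : MeasurableSpace 𝒵]
variable {P : Measure Ω} [IsProbabilityMeasure P] {Z : ℕ → Ω → 𝒵} {ε r C N : ℝ}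
variable {H : Type*} [NormedAddCommGroup H] [InnerProductSpace ℝ H] [CompleteSpace H] {w : 𝒵 → H}

/-- partial sums of a projection -/
def SS (Z : ℕ → Ω → 𝒵) (w : 𝒵 → H) (n : ℕ) (x : H) (ω : Ω) : ℝ :=
  ∑ t ∈ Finset.range n, inner ℝ (w (Z t ω)) x

lemma SS_eq (n : ℕ) (x : H) (ω : Ω) : SS Z w n x ω = inner ℝ (∑ t ∈ Finset.range n, w (Z t ω)) x := by
  rw [SS, sum_inner]

lemma SS_sum {ι : Type*} (s : Finset ι) (a : ι → ℝ) (x : ι → H) (n : ℕ) (ω : Ω) :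
    SS Z w n (∑ i ∈ s, a i • x i) ω = ∑ i ∈ s, a i * SS Z w n (x i) ω := by
  rw [SS_eq, inner_sum]
  simp only [SS_eq, real_inner_smul_right]

lemma Good.exists_inner (h : MixSeq P Z ε r C) (g : Good P Z ε w N) (x : H) :
    ∃ N', Good P Z ε (fun z => inner ℝ (w z) x) N' := by
  obtain ⟨N', g'⟩ := g.exists_clm h (innerSL ℝ x)
  refine ⟨N', ?_⟩
  convert g' using 2 with z
  rw [innerSL_apply_apply, real_inner_comm]

lemma Good.memLp_SS (h : MixSeq P Z ε r C) (g : Good P Z ε w N) (n : ℕ) (x : H) :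
    MemLp (SS Z w n x) 2 P := by
  obtain ⟨N', g'⟩ := g.exists_inner h x
  exact g'.memLp_sum h (Finset.range n)

lemma Good.int_SS (h : MixSeq P Z ε r C) (g : Good P Z ε w N) (n : ℕ) (x y : H) :
    Integrable (fun ω => SS Z w n x ω * SS Z w n y ω) P :=
  (g.memLp_SS h n x).integrable_mul (g.memLp_SS h n y)

lemma Good.quad (h : MixSeq P Z ε r C) (g : Good P Z ε w N) {ι : Type*} (s : Finset ι) (a : ι → ℝ)
    (x : ι → H) (n : ℕ) :
    ∑ i ∈ s, ∑ j ∈ s, a i * a j * ((n : ℝ)⁻¹ * ∫ ω, SS Z w n (x i) ω * SS Z w n (x j) ω ∂P) =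
      (n : ℝ)⁻¹ * ∫ ω, SS Z w n (∑ i ∈ s, a i • x i) ω ^ 2 ∂P := by
  have e : ∀ ω, SS Z w n (∑ i ∈ s, a i • x i) ω ^ 2 =
      ∑ i ∈ s, ∑ j ∈ s, (a i * a j) * (SS Z w n (x i) ω * SS Z w n (x j) ω) := by
    intro ω
    rw [SS_sum, sq, Finset.sum_mul_sum]
    refine Finset.sum_congr rfl fun i _ => Finset.sum_congr rfl fun j _ => ?_
    ring
  simp only [e]
  rw [integral_finsetSum _ fun i _ => integrable_finsetSum _ fun j _ => (g.int_SS h n _ _).const_mul _,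
    Finset.mul_sum]
  refine Finset.sum_congr rfl fun i _ => ?_
  rw [integral_finsetSum _ fun j _ => (g.int_SS h n _ _).const_mul _, Finset.mul_sum]
  refine Finset.sum_congr rfl fun j _ => ?_
  rw [integral_const_mul]; ring

theorem Good.lrc (h : MixSeq P Z ε r C) (g : Good P Z ε w N) : ∃ Q : H → H → ℝ, PDK Q ∧
    ∀ x y, Tendsto (fun n : ℕ => (n : ℝ)⁻¹ * ∫ ω, SS Z w n x ω * SS Z w n y ω ∂P) atTop (𝓝 (Q x y)) := by
  have hex : ∀ x y, ∃ q, Tendsto (fun n : ℕ => (n : ℝ)⁻¹ * ∫ ω, SS Z w n x ω * SS Z w n y ω ∂P)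
      atTop (𝓝 q) := by
    intro x y
    have hl : ∀ x, ∃ σ, Tendsto (fun n : ℕ => (n : ℝ)⁻¹ * ∫ ω, SS Z w n x ω ^ 2 ∂P) atTop (𝓝 σ) := by
      intro x
      obtain ⟨N', g'⟩ := g.exists_inner h x
      obtain ⟨σ, _, _, hσ⟩ := g'.lrv h
      exact ⟨σ, hσ⟩
    obtain ⟨a, ha⟩ := hl (x + y)
    obtain ⟨b, hb⟩ := hl (x - y)
    refine ⟨_, ((ha.sub hb).const_mul (1 / 4)).congr fun n => ?_⟩
    have i1 : ∀ x, Integrable (fun ω => SS Z w n x ω ^ 2) P := fun x => by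
      simpa only [sq] using g.int_SS h n x x
    rw [← mul_sub, ← integral_sub (i1 _) (i1 _), ← mul_assoc, mul_comm (1 / 4 : ℝ), mul_assoc,
      ← integral_const_mul]
    congr 1
    refine integral_congr_ae (ae_of_all _ fun ω => ?_)
    simp only [SS_eq, inner_add_right, inner_sub_right]
    ring
  choose Q hQ using hex
  refine ⟨Q, ⟨fun s t => ?_, fun n x c => ?_⟩, hQ⟩
  · refine tendsto_nhds_unique (hQ s t) ((hQ t s).congr fun n => ?_)
    simp only [mul_comm (SS Z w n t _)]
  · refine ge_of_tendsto' (tendsto_finset_sum Finset.univ fun i _ => tendsto_finset_sum Finset.univ fun j _ =>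
      (hQ (x i) (x j)).const_mul (c i * c j)) fun m => ?_
    rw [g.quad h]
    exact mul_nonneg (by positivity) (integral_nonneg fun ω => sq_nonneg _)

lemma Good.lim_sq (h : MixSeq P Z ε r C) (g : Good P Z ε w N) {Q : H → H → ℝ}
    (hQ : ∀ x y, Tendsto (fun n : ℕ => (n : ℝ)⁻¹ * ∫ ω, SS Z w n x ω * SS Z w n y ω ∂P) atTop (𝓝 (Q x y)))
    {ι : Type*} (s : Finset ι) (a : ι → ℝ) (x : ι → H) :
    Tendsto (fun n : ℕ => (n : ℝ)⁻¹ * ∫ ω, SS Z w n (∑ i ∈ s, a i • x i) ω ^ 2 ∂P) atTop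
      (𝓝 (∑ i ∈ s, ∑ j ∈ s, a i * a j * Q (x i) (x j))) := by
  refine (tendsto_finset_sum s fun i _ => tendsto_finset_sum s fun j _ =>
      (hQ (x i) (x j)).const_mul (a i * a j)).congr fun m => ?_
  rw [g.quad h]

/-- finite-dimensional projections -/
def XX (Z : ℕ → Ω → 𝒵) (w : 𝒵 → H) (e : ℕ → H) (M n : ℕ) (ω : Ω) : EuclideanSpace ℝ (Fin M) :=
  WithLp.toLp 2 fun k => (√n)⁻¹ * SS Z w n (e k) ω

lemma Good.meas_SS (h : MixSeq P Z ε r C) (g : Good P Z ε w N) (n : ℕ) (x : H) :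
    Measurable (SS Z w n x) := by
  refine Finset.measurable_fun_sum _ fun i _ => ?_
  exact ((g.sm.inner stronglyMeasurable_const).measurable).comp (h.meas i)

lemma Good.meas_XX (h : MixSeq P Z ε r C) (g : Good P Z ε w N) (e : ℕ → H) (M n : ℕ) :
    Measurable (XX Z w e M n) := by
  refine (WithLp.measurable_toLp 2 _).comp (measurable_pi_iff.2 fun k => ?_)
  exact (g.meas_SS h n _).const_mul _

theorem Good.fidi (h : MixSeq P Z ε r C) (g : Good P Z ε w N) {Q : H → H → ℝ} (hP : PDK Q)
    (hQ : ∀ x y, Tendsto (fun n : ℕ => (n : ℝ)⁻¹ * ∫ ω, SS Z w n x ω * SS Z w n y ω ∂P) atTop (𝓝 (Q x y)))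
    (e : ℕ → H) {Ω' : Type*} [MeasurableSpace Ω'] {P' : Measure Ω'} [IsProbabilityMeasure P']
    {G : ℕ → Ω' → ℝ} (mG : ∀ k, Measurable (G k)) (hG : ∀ (M : ℕ) (a : ℕ → ℝ),
      P'.map (fun ω => ∑ k ∈ Finset.range M, a k * G k ω) = gaussianReal 0
        (Real.toNNReal (∑ i ∈ Finset.range M, ∑ j ∈ Finset.range M, a i * a j * Q (e i) (e j))))
    (M : ℕ) (f : BoundedContinuousFunction (EuclideanSpace ℝ (Fin M)) ℝ) :
    Tendsto (fun n => ∫ ω, f (XX Z w e M n ω) ∂P) atTop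
      (𝓝 (∫ ω, f (WithLp.toLp 2 fun k : Fin M => G k ω) ∂P')) := by
  have mX := g.meas_XX h e M
  have mGM : Measurable fun ω => (WithLp.toLp 2 fun k : Fin M => G k ω : EuclideanSpace ℝ (Fin M)) :=
    (WithLp.measurable_toLp 2 _).comp (measurable_pi_iff.2 fun k => mG _)
  let μs : ℕ → ProbabilityMeasure (EuclideanSpace ℝ (Fin M)) := fun n =>
    ⟨P.map (XX Z w e M n), Measure.isProbabilityMeasure_map (mX n).aemeasurable⟩
  let μ : ProbabilityMeasure (EuclideanSpace ℝ (Fin M)) :=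
    ⟨P'.map fun ω => (WithLp.toLp 2 fun k : Fin M => G k ω : EuclideanSpace ℝ (Fin M)),
      Measure.isProbabilityMeasure_map mGM.aemeasurable⟩
  have key : Tendsto μs atTop (𝓝 μ) := by
    rw [ProbabilityMeasure.tendsto_iff_tendsto_charFun]
    intro t
    obtain ⟨a, ha⟩ : ∃ a : ℕ → ℝ, ∀ k : Fin M, a k = t k :=
      ⟨fun k => if hk : k < M then t ⟨k, hk⟩ else 0, fun k => by simp⟩
    obtain ⟨N', g'⟩ := g.exists_inner h (∑ k ∈ Finset.range M, a k • e k)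
    have l1 := clt_scalar h g' (g.lim_sq h hQ (Finset.range M) a e)
    have c1 : ∀ n, charFun (μs n : Measure _) t = ∫ ω, ee ((√n)⁻¹ * SS Z w n (∑ k ∈ Finset.range M, a k • e k) ω) ∂P := by
      intro n
      change charFun (P.map (XX Z w e M n)) t = _
      rw [charFun_apply, integral_map (mX n).aemeasurable (by fun_prop)]
      refine integral_congr_ae (ae_of_all _ fun ω => ?_)
      simp only [ee, mul_comm _ Complex.I]
      congr 3
      rw [SS_sum, Finset.mul_sum, PiLp.inner_apply, ← Fin.sum_univ_eq_sum_range (fun k => (√n)⁻¹ * (a k * SS Z w n (e k) ω))]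
      refine Finset.sum_congr rfl fun k _ => ?_
      simp only [XX, ha, RCLike.inner_apply, conj_trivial]
      ring
    have c2 : charFun (μ : Measure _) t = Complex.exp (-((∑ i ∈ Finset.range M, ∑ j ∈ Finset.range M, a i * a j * Q (e i) (e j)) / 2 : ℝ)) := by
      have mS : Measurable fun ω => ∑ k ∈ Finset.range M, a k * G k ω :=
        Finset.measurable_fun_sum _ fun k _ => (mG k).const_mul _
      have := congrArg (fun ν => charFun ν (1 : ℝ)) (hG M a)
      simp only [charFun_gaussianReal] at this
      rw [Real.coe_toNNReal _ (hP.finset _ _ _), charFun_apply,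
        integral_map mS.aemeasurable (by fun_prop)] at this
      change charFun (P'.map _) t = _
      rw [charFun_apply, integral_map mGM.aemeasurable (by fun_prop)]
      refine Eq.trans (integral_congr_ae (ae_of_all _ fun ω => ?_)) (this.trans ?_)
      · simp only
        congr 3
        rw [PiLp.inner_apply, ← Fin.sum_univ_eq_sum_range (fun k => a k * G k ω)]
        simp [ha]
      · push_cast
        congr 1
        ring
    rw [c2]
    simp only [c1]
    exact l1
  rw [ProbabilityMeasure.tendsto_iff_forall_integral_tendsto] at key
  have := key f
  simp only [μs, μ, ProbabilityMeasure.coe_mk] at this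
  rw [integral_map mGM.aemeasurable f.continuous.aestronglyMeasurable] at this
  refine this.congr fun n => ?_
  rw [integral_map (mX n).aemeasurable f.continuous.aestronglyMeasurable]

end LongRun

section GaussMoments

set_option linter.unusedSectionVars false

variable {Ω' : Type*} [MeasurableSpace Ω'] {P' : Measure Ω'} [IsProbabilityMeasure P']
variable {G : ℕ → Ω' → ℝ} {K : ℕ → ℕ → ℝ}

lemma sq_of_gauss {U : Ω' → ℝ} (mU : Measurable U) {v : ℝ} (hv : 0 ≤ v)
    (hU : P'.map U = gaussianReal 0 (Real.toNNReal v)) :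
    MemLp U 2 P' ∧ ∫ ω, U ω ∂P' = 0 ∧ ∫ ω, U ω ^ 2 ∂P' = v := by
  have h1 : MemLp (id : ℝ → ℝ) 2 (P'.map U) := by
    rw [hU]; exact memLp_id_gaussianReal 2
  have h2 : ∫ x, x ∂(P'.map U) = 0 := by rw [hU]; exact integral_id_gaussianReal
  have h3 : Var[id; P'.map U] = v := by
    rw [hU, variance_id_gaussianReal]; exact Real.coe_toNNReal v hv
  have h4 : ∫ x, x ^ 2 ∂(P'.map U) = v := by
    rw [variance_eq_integral measurable_id.aemeasurable] at h3
    simp only [id, h2, sub_zero] at h3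
    exact h3
  refine ⟨?_, ?_, ?_⟩
  · exact (memLp_map_measure_iff aestronglyMeasurable_id mU.aemeasurable).1 h1
  · rw [integral_map mU.aemeasurable (by fun_prop)] at h2; exact h2
  · rw [integral_map mU.aemeasurable (by fun_prop)] at h4; exact h4

lemma PDK.range_nonneg (hK : PDK K) (M : ℕ) (a : ℕ → ℝ) :
    0 ≤ ∑ i ∈ Finset.range M, ∑ j ∈ Finset.range M, a i * a j * K i j := by
  have := hK.nonneg M (fun i => (i : ℕ)) (fun i => a i)
  rw [Finset.sum_range]
  simpa only [Finset.sum_range] using this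

lemma gauss_smul (hG : ∀ (M : ℕ) (a : ℕ → ℝ),
      P'.map (fun ω => ∑ k ∈ Finset.range M, a k * G k ω) = gaussianReal 0
        (Real.toNNReal (∑ i ∈ Finset.range M, ∑ j ∈ Finset.range M, a i * a j * K i j)))
    (t : ℝ) (k : ℕ) :
    P'.map (fun ω => t * G k ω) = gaussianReal 0 (Real.toNNReal (t * t * K k k)) := by
  have := hG (k + 1) (Pi.single k t)
  simpa [Pi.single_apply, Finset.sum_ite_eq, ite_mul, mul_ite] using this

lemma gauss_one (hK : PDK K) (mG : ∀ k, Measurable (G k)) (hG : ∀ (M : ℕ) (a : ℕ → ℝ),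
      P'.map (fun ω => ∑ k ∈ Finset.range M, a k * G k ω) = gaussianReal 0
        (Real.toNNReal (∑ i ∈ Finset.range M, ∑ j ∈ Finset.range M, a i * a j * K i j)))
    (k : ℕ) :
    MemLp (G k) 2 P' ∧ ∫ ω, G k ω ∂P' = 0 ∧ ∫ ω, G k ω ^ 2 ∂P' = K k k := by
  have h := gauss_smul hG 1 k
  simp only [one_mul] at h
  refine sq_of_gauss (mG k) ?_ h
  have := hK.nonneg 1 (fun _ => k) (fun _ => 1)
  simpa using this

lemma gauss_cov (hK : PDK K) (mG : ∀ k, Measurable (G k)) (hG : ∀ (M : ℕ) (a : ℕ → ℝ),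
      P'.map (fun ω => ∑ k ∈ Finset.range M, a k * G k ω) = gaussianReal 0
        (Real.toNNReal (∑ i ∈ Finset.range M, ∑ j ∈ Finset.range M, a i * a j * K i j)))
    (i j : ℕ) : ∫ ω, G i ω * G j ω ∂P' = K i j := by
  have h := hG (i + j + 1) (Pi.single i 1 + Pi.single j 1)
  have hn := hK.range_nonneg (i + j + 1) (Pi.single i 1 + Pi.single j 1)
  have hi : i < i + j + 1 := by omega
  have hj : j < i + j + 1 := by omega
  have e1 : ∀ ω, ∑ k ∈ Finset.range (i + j + 1), (Pi.single i 1 + Pi.single j 1 : ℕ → ℝ) k * G k ω =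
      G i ω + G j ω := by
    intro ω
    simp [Pi.single_apply, add_mul, Finset.sum_add_distrib]
  have e2 : ∑ k ∈ Finset.range (i + j + 1), ∑ l ∈ Finset.range (i + j + 1),
      (Pi.single i 1 + Pi.single j 1 : ℕ → ℝ) k * (Pi.single i 1 + Pi.single j 1 : ℕ → ℝ) l * K k l =
      K i i + K i j + (K j i + K j j) := by
    simp [Pi.single_apply, add_mul, mul_add, Finset.sum_add_distrib]
    ring
  simp only [e1, e2] at h hn
  have s := (sq_of_gauss ((mG i).add (mG j)) hn h).2.2
  obtain ⟨mi, _, si⟩ := gauss_one hK mG hG i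
  obtain ⟨mj, _, sj⟩ := gauss_one hK mG hG j
  have hij : Integrable (fun ω => G i ω * G j ω) P' := mi.integrable_mul mj
  have : ∫ ω, (G i ω + G j ω) ^ 2 ∂P' =
      ∫ ω, G i ω ^ 2 ∂P' + 2 * ∫ ω, G i ω * G j ω ∂P' + ∫ ω, G j ω ^ 2 ∂P' := by
    rw [← integral_const_mul, ← integral_add mi.integrable_sq (hij.const_mul 2),
      ← integral_add (f := fun ω => G i ω ^ 2 + 2 * (G i ω * G j ω))
        (mi.integrable_sq.add (hij.const_mul 2)) mj.integrable_sq]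
    congr 1; ext ω; ring
  have hs := hK.symm i j
  have s' : ∫ ω, (G i ω + G j ω) ^ 2 ∂P' = K i i + K i j + (K j i + K j j) := s
  linarith

end GaussMoments

section Bessel

variable {H : Type*} [NormedAddCommGroup H] [InnerProductSpace ℝ H] {e : ℕ → H}

lemma inner_proj (ho : ∀ i j, i ≠ j → inner ℝ (e i) (e j) = 0) (R : H) (s : Finset ℕ) :
    ‖∑ k ∈ s, inner ℝ R (e k) • e k‖ ^ 2 = ∑ k ∈ s, inner ℝ R (e k) ^ 2 * ‖e k‖ ^ 2 := by
  rw [← real_inner_self_eq_norm_sq, sum_inner]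
  refine Finset.sum_congr rfl fun i hi => ?_
  rw [inner_sum, Finset.sum_eq_single i]
  · rw [real_inner_smul_left, real_inner_smul_right, real_inner_self_eq_norm_sq]; ring
  · intro j _ hj
    rw [real_inner_smul_left, real_inner_smul_right, ho i j (Ne.symm hj)]; ring
  · intro h; exact absurd hi h

lemma norm_proj (ho : ∀ i j, i ≠ j → inner ℝ (e i) (e j) = 0) (R : H)
    (hR : ∀ k, inner ℝ R (e k) ≠ 0 → ‖e k‖ = 1) (s : Finset ℕ) :
    ‖∑ k ∈ s, inner ℝ R (e k) • e k‖ ^ 2 = ∑ k ∈ s, inner ℝ R (e k) ^ 2 := by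
  rw [inner_proj ho]
  refine Finset.sum_congr rfl fun i _ => ?_
  by_cases h : inner ℝ R (e i) = 0
  · simp [h]
  · rw [hR i h]; simp

lemma norm_sub_proj (ho : ∀ i j, i ≠ j → inner ℝ (e i) (e j) = 0) (R : H)
    (hR : ∀ k, inner ℝ R (e k) ≠ 0 → ‖e k‖ = 1) (s : Finset ℕ) :
    ‖R - ∑ k ∈ s, inner ℝ R (e k) • e k‖ ^ 2 = ‖R‖ ^ 2 - ∑ k ∈ s, inner ℝ R (e k) ^ 2 := by
  rw [norm_sub_sq_real, norm_proj ho R hR, inner_sum]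
  have : ∑ i ∈ s, inner ℝ R (inner ℝ R (e i) • e i) = ∑ k ∈ s, inner ℝ R (e k) ^ 2 :=
    Finset.sum_congr rfl fun i _ => by rw [real_inner_smul_right]; ring
  rw [this]; ring

end Bessel

section LimitLaw

set_option linter.unusedSectionVars false

variable {Ω 𝒵 : Type*} [mΩ : MeasurableSpace Ω] [m𝒵 : MeasurableSpace 𝒵]
variable {P : Measure Ω} [IsProbabilityMeasure P] {Z : ℕ → Ω → 𝒵} {ε r C N : ℝ}
variable {H : Type*} [NormedAddCommGroup H] [InnerProductSpace ℝ H] [CompleteSpace H] {w : 𝒵 → H}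
variable {e : ℕ → H}

lemma inner_sum_ne (hn : ∀ k z, inner ℝ (w z) (e k) ≠ 0 → ‖e k‖ = 1) (n : ℕ) (ω : Ω) (k : ℕ)
    (hk : inner ℝ (∑ t ∈ Finset.range n, w (Z t ω)) (e k) ≠ 0) : ‖e k‖ = 1 := by
  rw [sum_inner] at hk
  obtain ⟨t, _, ht⟩ := Finset.exists_ne_zero_of_sum_ne_zero hk
  exact hn k _ ht

lemma Good.sum_Q_le (h : MixSeq P Z ε r C) (g : Good P Z ε w N) {Q : H → H → ℝ}
    (hQ : ∀ x y, Tendsto (fun n : ℕ => (n : ℝ)⁻¹ * ∫ ω, SS Z w n x ω * SS Z w n y ω ∂P) atTop (𝓝 (Q x y)))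
    (ho : ∀ i j, i ≠ j → inner ℝ (e i) (e j) = 0)
    (hn : ∀ k z, inner ℝ (w z) (e k) ≠ 0 → ‖e k‖ = 1) (M : ℕ) :
    ∑ k ∈ Finset.range M, Q (e k) (e k) ≤ KC C * N ^ 2 := by
  refine le_of_tendsto (tendsto_finsetSum (Finset.range M) fun k _ => hQ (e k) (e k)) ?_
  filter_upwards [eventually_gt_atTop 0] with n hn0
  have hn1 : (0 : ℝ) < n := by exact_mod_cast hn0
  rw [← Finset.mul_sum, ← integral_finsetSum _ fun k _ => g.int_SS h n _ _]
  have h1 : ∫ ω, ∑ k ∈ Finset.range M, SS Z w n (e k) ω * SS Z w n (e k) ω ∂P ≤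
      ∫ ω, ‖∑ i ∈ Finset.range n, w (Z i ω)‖ ^ 2 ∂P := by
    refine integral_mono (integrable_finsetSum _ fun k _ => g.int_SS h n _ _)
      (g.memLp_sum h (Finset.range n)).norm.integrable_sq fun ω => ?_
    have := norm_sub_proj ho (∑ i ∈ Finset.range n, w (Z i ω)) (inner_sum_ne hn n ω) (Finset.range M)
    have h0 := sq_nonneg ‖∑ i ∈ Finset.range n, w (Z i ω) -
      ∑ k ∈ Finset.range M, inner ℝ (∑ i ∈ Finset.range n, w (Z i ω)) (e k) • e k‖
    simp only [SS_eq, ← sq]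
    linarith
  have h2 := h1.trans (g.l2 h (Finset.range n))
  rw [Finset.card_range] at h2
  calc (n : ℝ)⁻¹ * _ ≤ (n : ℝ)⁻¹ * (KC C * N ^ 2 * n) := by gcongr
    _ = _ := by field_simp

lemma summable_gauss {Ω' : Type*} [MeasurableSpace Ω'] {P' : Measure Ω'} [IsProbabilityMeasure P']
    {G : ℕ → Ω' → ℝ} {q : ℕ → ℝ} {B : ℝ} (mG : ∀ k, Measurable (G k)) (mL : ∀ k, MemLp (G k) 2 P')
    (hq : ∀ k, ∫ ω, G k ω ^ 2 ∂P' = q k) (hB : ∀ M, ∑ k ∈ Finset.range M, q k ≤ B) :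
    ∀ᵐ ω ∂P', Summable fun k => G k ω ^ 2 := by
  have hq0 : ∀ k, 0 ≤ q k := fun k => by rw [← hq k]; exact integral_nonneg fun ω => sq_nonneg _
  have m : ∀ k, Measurable fun ω => ENNReal.ofReal (G k ω ^ 2) := fun k =>
    ((mG k).pow_const 2).ennreal_ofReal
  have h1 : ∫⁻ ω, ∑' k, ENNReal.ofReal (G k ω ^ 2) ∂P' ≤ ENNReal.ofReal B := by
    rw [lintegral_tsum fun k => (m k).aemeasurable]
    have : ∀ k, ∫⁻ ω, ENNReal.ofReal (G k ω ^ 2) ∂P' = ENNReal.ofReal (q k) := by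
      intro k
      rw [← hq k, ofReal_integral_eq_lintegral_ofReal (mL k).integrable_sq
        (Eventually.of_forall fun ω => sq_nonneg _)]
    simp only [this]
    rw [ENNReal.tsum_eq_iSup_nat]
    refine iSup_le fun M => ?_
    rw [← ENNReal.ofReal_sum_of_nonneg fun k _ => hq0 k]
    exact ENNReal.ofReal_le_ofReal (hB M)
  have h2 := ae_lt_top (Measurable.tsum m) (h1.trans_lt ENNReal.ofReal_lt_top).ne
  filter_upwards [h2] with ω hω
  have := ENNReal.summable_toReal hω.ne
  simpa only [ENNReal.toReal_ofReal (sq_nonneg _)] using this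

lemma norm_XX (ho : ∀ i j, i ≠ j → inner ℝ (e i) (e j) = 0)
    (hn : ∀ k z, inner ℝ (w z) (e k) ≠ 0 → ‖e k‖ = 1) (M n : ℕ) (ω : Ω) :
    ‖XX Z w e M n ω‖ = ‖(√n)⁻¹ • ∑ k ∈ Finset.range M,
      inner ℝ (∑ t ∈ Finset.range n, w (Z t ω)) (e k) • e k‖ := by
  have : ‖XX Z w e M n ω‖ ^ 2 = ‖(√n)⁻¹ • ∑ k ∈ Finset.range M,
      inner ℝ (∑ t ∈ Finset.range n, w (Z t ω)) (e k) • e k‖ ^ 2 := by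
    rw [EuclideanSpace.norm_sq_eq, norm_smul, mul_pow, norm_proj ho _ (inner_sum_ne hn n ω),
      Finset.mul_sum, Finset.sum_range]
    refine Finset.sum_congr rfl fun k _ => ?_
    simp only [XX, SS_eq, norm_mul, mul_pow, Real.norm_eq_abs, sq_abs]
  exact (sq_eq_sq₀ (norm_nonneg _) (norm_nonneg _)).1 this

lemma sum_tail (M n : ℕ) (ω : Ω) :
    ∑ t ∈ Finset.range n, (w (Z t ω) - ∑ k ∈ Finset.range M, inner ℝ (w (Z t ω)) (e k) • e k) =
      ∑ t ∈ Finset.range n, w (Z t ω) - ∑ k ∈ Finset.range M,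
        inner ℝ (∑ t ∈ Finset.range n, w (Z t ω)) (e k) • e k := by
  rw [Finset.sum_sub_distrib, Finset.sum_comm]
  simp only [sum_inner, Finset.sum_smul]

lemma Good.tails (h : MixSeq P Z ε r C) (g : Good P Z ε w N)
    (ho : ∀ i j, i ≠ j → inner ℝ (e i) (e j) = 0)
    (hn : ∀ k z, inner ℝ (w z) (e k) ≠ 0 → ‖e k‖ = 1)
    (hs : ∀ z, HasSum (fun k => inner ℝ (w z) (e k) • e k) (w z)) :
    ∃ N : ℕ → ℝ, Tendsto N atTop (𝓝 0) ∧ ∀ M, Good P Z ε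
      (fun z => w z - ∑ k ∈ Finset.range M, inner ℝ (w z) (e k) • e k) (N M) := by
  have hin : ∀ k, Integrable (fun ω => inner ℝ (w (Z 0 ω)) (e k) • e k) P := fun k =>
    Integrable.smul_const ((g.integrable h 0).inner_const (e k)) (e k)
  refine Good.seq (G := fun z => ‖w z‖) (h.meas 0) h.eps (fun M => ?_) g.int (fun M z => ?_)
    (fun M => ?_) (fun z => ?_)
  · refine g.sm.sub (Finset.stronglyMeasurable_fun_sum _ fun k _ => ?_)
    exact (g.sm.inner stronglyMeasurable_const).smul_const (e k)
  · have := norm_sub_proj ho (w z) (fun k hk => hn k z hk) (Finset.range M)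
    have h0 : 0 ≤ ∑ k ∈ Finset.range M, inner ℝ (w z) (e k) ^ 2 :=
      Finset.sum_nonneg fun k _ => sq_nonneg _
    exact (sq_le_sq₀ (norm_nonneg _) (norm_nonneg _)).1 (by linarith)
  · rw [integral_sub (g.integrable h 0) (integrable_finsetSum _ fun k _ => hin k), g.mean,
      integral_finsetSum _ fun k _ => hin k, zero_sub, neg_eq_zero]
    refine Finset.sum_eq_zero fun k _ => ?_
    rw [integral_smul_const]
    have : ∫ ω, inner ℝ (w (Z 0 ω)) (e k) ∂P = 0 := by
      simp only [real_inner_comm (e k)]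
      rw [integral_inner (g.integrable h 0), g.mean, inner_zero_right]
    rw [this, zero_smul]
  · have := (hs z).tendsto_sum_nat
    simpa using this.const_sub (w z)

lemma Good.int_norm_avg (h : MixSeq P Z ε r C) (g : Good P Z ε w N) (n : ℕ) (hn : n ≠ 0) :
    ∫ ω, ‖(√n)⁻¹ • ∑ i ∈ Finset.range n, w (Z i ω)‖ ∂P ≤ √(KC C) * N := by
  have hn1 : (0 : ℝ) < n := by exact_mod_cast Nat.pos_of_ne_zero hn
  have mL := (g.memLp_sum h (Finset.range n)).const_smul (√(n : ℝ))⁻¹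
  have h1 := int_norm_sq_le mL
  have h2 := g.l2 h (Finset.range n)
  rw [Finset.card_range] at h2
  have hK := KC_nonneg h.C_nonneg
  have h3 : ∫ ω, ‖(√n)⁻¹ • ∑ i ∈ Finset.range n, w (Z i ω)‖ ^ 2 ∂P ≤ KC C * N ^ 2 := by
    have : ∀ ω, ‖(√n)⁻¹ • ∑ i ∈ Finset.range n, w (Z i ω)‖ ^ 2 =
        (n : ℝ)⁻¹ * ‖∑ i ∈ Finset.range n, w (Z i ω)‖ ^ 2 := by
      intro ω
      rw [norm_smul, mul_pow, norm_inv, inv_pow, Real.norm_eq_abs, sq_abs, Real.sq_sqrt hn1.le]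
    simp only [this]
    rw [integral_const_mul]
    calc (n : ℝ)⁻¹ * _ ≤ (n : ℝ)⁻¹ * (KC C * N ^ 2 * n) := by gcongr
      _ = _ := by field_simp
  refine abs_le_of_sq_le_sq' ?_ (mul_nonneg (Real.sqrt_nonneg _) g.pos.le) |>.2
  rw [mul_pow, Real.sq_sqrt hK]
  exact h1.trans h3

end LimitLaw

section LimitLaw2

set_option linter.unusedSectionVars false

variable {Ω 𝒵 : Type*} [mΩ : MeasurableSpace Ω] [m𝒵 : MeasurableSpace 𝒵]
variable {P : Measure Ω} [IsProbabilityMeasure P] {Z : ℕ → Ω → 𝒵} {ε r C N : ℝ}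
variable {H : Type*} [NormedAddCommGroup H] [InnerProductSpace ℝ H] [CompleteSpace H] {w : 𝒵 → H}
variable {e : ℕ → H}

theorem Good.lip_lim (h : MixSeq P Z ε r C) (g : Good P Z ε w N) {Q : H → H → ℝ} (hP : PDK Q)
    (hQ : ∀ x y, Tendsto (fun n : ℕ => (n : ℝ)⁻¹ * ∫ ω, SS Z w n x ω * SS Z w n y ω ∂P) atTop (𝓝 (Q x y)))
    (ho : ∀ i j, i ≠ j → inner ℝ (e i) (e j) = 0)
    (hn : ∀ k z, inner ℝ (w z) (e k) ≠ 0 → ‖e k‖ = 1)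
    (hs : ∀ z, HasSum (fun k => inner ℝ (w z) (e k) • e k) (w z))
    {Ω' : Type*} [MeasurableSpace Ω'] {P' : Measure Ω'} [IsProbabilityMeasure P']
    {G : ℕ → Ω' → ℝ} (mG : ∀ k, Measurable (G k)) (hG : ∀ (M : ℕ) (a : ℕ → ℝ),
      P'.map (fun ω => ∑ k ∈ Finset.range M, a k * G k ω) = gaussianReal 0
        (Real.toNNReal (∑ i ∈ Finset.range M, ∑ j ∈ Finset.range M, a i * a j * Q (e i) (e j))))
    (hsum : ∀ᵐ ω ∂P', Summable fun k => G k ω ^ 2)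
    {D : ℕ → Ω → H} {K : ℝ} (mD : ∀ n, StronglyMeasurable (D n))
    (hD : ∀ n : ℕ, n ≠ 0 → Integrable (D n) P ∧ ∫ ω, ‖D n ω‖ ∂P ≤ K * (√n)⁻¹)
    (f : ℝ → ℝ) {c : ℝ} (hc : ∀ x, ‖f x‖ ≤ c) {L : ℝ≥0} (hL : LipschitzWith L f) :
    Tendsto (fun n : ℕ => ∫ ω, f (2 * ‖(√n)⁻¹ • ∑ i ∈ Finset.range n, w (Z i ω) - D n ω‖) ∂P) atTop
      (𝓝 (∫ ω, f (2 * √(∑' k, G k ω ^ 2)) ∂P')) := by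
  obtain ⟨N', hN', gT⟩ := g.tails h ho hn hs
  have hfc : Continuous f := hL.continuous
  have mA : ∀ n : ℕ, StronglyMeasurable
      (fun ω => (√n)⁻¹ • ∑ i ∈ Finset.range n, w (Z i ω) - D n ω) := fun n =>
    ((Finset.stronglyMeasurable_fun_sum _ fun i _ => g.sm.comp_measurable (h.meas i)).const_smul
      (√(n : ℝ))⁻¹).sub (mD n)
  have iA : ∀ n : ℕ, Integrable
      (fun ω => f (2 * ‖(√n)⁻¹ • ∑ i ∈ Finset.range n, w (Z i ω) - D n ω‖)) P := fun n =>
    Integrable.of_bound (hfc.comp_stronglyMeasurable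
      ((mA n).norm.const_mul 2)).aestronglyMeasurable c (Eventually.of_forall fun ω => hc _)
  have iB : ∀ M n : ℕ, Integrable (fun ω => f (2 * ‖XX Z w e M n ω‖)) P := fun M n =>
    Integrable.of_bound (hfc.comp_stronglyMeasurable
      ((g.meas_XX h e M n).norm.const_mul 2).stronglyMeasurable).aestronglyMeasurable c
      (Eventually.of_forall fun ω => hc _)
  have hKn : Tendsto (fun n : ℕ => K * (√(n : ℝ))⁻¹) atTop (𝓝 0) := by
    have : Tendsto (fun n : ℕ => (√(n : ℝ))⁻¹) atTop (𝓝 0) :=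
      (tendsto_inv_atTop_zero.comp Real.tendsto_sqrt_atTop).comp tendsto_natCast_atTop_atTop
    simpa using this.const_mul K
  refine approx_lim (b := fun M n => ∫ ω, f (2 * ‖XX Z w e M n ω‖) ∂P)
    (bl := fun M => ∫ ω, f (2 * ‖(WithLp.toLp 2 fun k : Fin M => G k ω : EuclideanSpace ℝ (Fin M))‖) ∂P')
    (c := fun M => L * (2 * (√(KC C) * N' M + 1 / ((M : ℝ) + 1)))) ?_ (fun M => ?_) (fun M => ?_) ?_
  · have := (((hN'.const_mul (√(KC C))).add (tendsto_one_div_add_atTop_nhds_zero_nat (𝕜 := ℝ))).const_mul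
      2).const_mul (L : ℝ)
    simpa using this
  · have hpos : (0 : ℝ) < 1 / ((M : ℝ) + 1) := by positivity
    filter_upwards [eventually_ne_atTop 0, hKn.eventually_le_const hpos] with n hn0 hKn'
    obtain ⟨iD, bD⟩ := hD n hn0
    have hT := (gT M).int_norm_avg h n hn0
    have iT : Integrable (fun ω => ‖(√n)⁻¹ • ∑ i ∈ Finset.range n, (w (Z i ω) -
        ∑ k ∈ Finset.range M, inner ℝ (w (Z i ω)) (e k) • e k)‖) P :=
      ((((gT M).memLp_sum h (Finset.range n)).const_smul (√(n : ℝ))⁻¹).integrable one_le_two).norm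
    rw [← integral_sub (iA n) (iB M n)]
    have key : ∀ ω, ‖f (2 * ‖(√n)⁻¹ • ∑ i ∈ Finset.range n, w (Z i ω) - D n ω‖) -
        f (2 * ‖XX Z w e M n ω‖)‖ ≤ L * (2 * (‖(√n)⁻¹ • ∑ i ∈ Finset.range n, (w (Z i ω) -
        ∑ k ∈ Finset.range M, inner ℝ (w (Z i ω)) (e k) • e k)‖ + ‖D n ω‖)) := by
      intro ω
      rw [← dist_eq_norm]
      refine (hL.dist_le_mul _ _).trans ?_
      gcongr
      rw [dist_eq_norm, ← mul_sub, norm_mul, Real.norm_two, norm_XX ho hn, sum_tail, Real.norm_eq_abs]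
      gcongr
      refine (abs_norm_sub_norm_le _ _).trans ?_
      refine le_trans (le_of_eq ?_) (norm_sub_le _ _)
      congr 1
      rw [smul_sub]; abel
    calc ‖∫ ω, (f (2 * ‖(√n)⁻¹ • ∑ i ∈ Finset.range n, w (Z i ω) - D n ω‖) -
          f (2 * ‖XX Z w e M n ω‖)) ∂P‖
        ≤ ∫ ω, L * (2 * (‖(√n)⁻¹ • ∑ i ∈ Finset.range n, (w (Z i ω) -
          ∑ k ∈ Finset.range M, inner ℝ (w (Z i ω)) (e k) • e k)‖ + ‖D n ω‖)) ∂P :=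
          norm_integral_le_of_norm_le (((iT.add iD.norm).const_mul 2).const_mul (L : ℝ))
            (Eventually.of_forall key)
      _ = L * (2 * (∫ ω, ‖(√n)⁻¹ • ∑ i ∈ Finset.range n, (w (Z i ω) -
          ∑ k ∈ Finset.range M, inner ℝ (w (Z i ω)) (e k) • e k)‖ ∂P + ∫ ω, ‖D n ω‖ ∂P)) := by
          rw [integral_const_mul, integral_const_mul, integral_add iT iD.norm]
      _ ≤ _ := by
          gcongr
          exact bD.trans hKn'
  · have := g.fidi h hP hQ e mG hG M (BoundedContinuousFunction.ofNormedAddCommGroup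
      (fun x : EuclideanSpace ℝ (Fin M) => f (2 * ‖x‖)) (hfc.comp (by fun_prop)) c fun x => hc _)
    simpa using this
  · have mGM : ∀ M, Measurable fun ω =>
        (WithLp.toLp 2 fun k : Fin M => G k ω : EuclideanSpace ℝ (Fin M)) := fun M =>
      (WithLp.measurable_toLp 2 _).comp (measurable_pi_iff.2 fun k => mG _)
    refine tendsto_integral_of_dominated_convergence (fun _ => c) (fun M => ?_) (integrable_const c)
      (fun M => Eventually.of_forall fun ω => hc _) ?_
    · exact (hfc.comp_stronglyMeasurable
        ((mGM M).norm.const_mul 2).stronglyMeasurable).aestronglyMeasurable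
    · filter_upwards [hsum] with ω hω
      refine (hfc.tendsto _).comp (Tendsto.const_mul 2 ?_)
      have h1 := (Real.continuous_sqrt.tendsto _).comp hω.hasSum.tendsto_sum_nat
      refine h1.congr fun M => ?_
      rw [EuclideanSpace.norm_eq, Function.comp, Finset.sum_range]
      simp

theorem Good.cont_lim (h : MixSeq P Z ε r C) (g : Good P Z ε w N) {Q : H → H → ℝ} (hP : PDK Q)
    (hQ : ∀ x y, Tendsto (fun n : ℕ => (n : ℝ)⁻¹ * ∫ ω, SS Z w n x ω * SS Z w n y ω ∂P) atTop (𝓝 (Q x y)))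
    (ho : ∀ i j, i ≠ j → inner ℝ (e i) (e j) = 0)
    (hn : ∀ k z, inner ℝ (w z) (e k) ≠ 0 → ‖e k‖ = 1)
    (hs : ∀ z, HasSum (fun k => inner ℝ (w z) (e k) • e k) (w z))
    {Ω' : Type*} [MeasurableSpace Ω'] {P' : Measure Ω'} [IsProbabilityMeasure P']
    {G : ℕ → Ω' → ℝ} (mG : ∀ k, Measurable (G k)) (hG : ∀ (M : ℕ) (a : ℕ → ℝ),
      P'.map (fun ω => ∑ k ∈ Finset.range M, a k * G k ω) = gaussianReal 0
        (Real.toNNReal (∑ i ∈ Finset.range M, ∑ j ∈ Finset.range M, a i * a j * Q (e i) (e j))))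
    (hsum : ∀ᵐ ω ∂P', Summable fun k => G k ω ^ 2)
    {D : ℕ → Ω → H} {K : ℝ} (mD : ∀ n, StronglyMeasurable (D n))
    (hD : ∀ n : ℕ, n ≠ 0 → Integrable (D n) P ∧ ∫ ω, ‖D n ω‖ ∂P ≤ K * (√n)⁻¹)
    (f : BoundedContinuousFunction ℝ ℝ) :
    Tendsto (fun n : ℕ => ∫ ω, f ((2 * ‖(√n)⁻¹ • ∑ i ∈ Finset.range n, w (Z i ω) - D n ω‖) ^ 2) ∂P) atTop
      (𝓝 (∫ ω, f (∑' k, 4 * G k ω ^ 2) ∂P')) := by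
  have mA : ∀ n : ℕ, Measurable
      (fun ω => 2 * ‖(√n)⁻¹ • ∑ i ∈ Finset.range n, w (Z i ω) - D n ω‖) := fun n =>
    ((((Finset.stronglyMeasurable_fun_sum _ fun i _ => g.sm.comp_measurable (h.meas i)).const_smul
      (√(n : ℝ))⁻¹).sub (mD n)).norm.const_mul 2).measurable
  have mL : Measurable fun ω => 2 * √(∑' k, G k ω ^ 2) :=
    (Measurable.tsum fun k => (mG k).pow_const 2).sqrt.const_mul 2
  let μs : ℕ → ProbabilityMeasure ℝ := fun n =>
    ⟨P.map (fun ω => 2 * ‖(√n)⁻¹ • ∑ i ∈ Finset.range n, w (Z i ω) - D n ω‖),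
      Measure.isProbabilityMeasure_map (mA n).aemeasurable⟩
  let μ : ProbabilityMeasure ℝ :=
    ⟨P'.map (fun ω => 2 * √(∑' k, G k ω ^ 2)), Measure.isProbabilityMeasure_map mL.aemeasurable⟩
  have hw : Tendsto μs atTop (𝓝 μ) := by
    rw [tendsto_iff_forall_lipschitz_integral_tendsto]
    rintro f ⟨c, hc⟩ ⟨L, hL⟩
    have hb : ∀ x, ‖f x‖ ≤ c + ‖f 0‖ := by
      intro x
      have := hc x 0
      rw [dist_eq_norm] at this
      have h2 := norm_add_le (f x - f 0) (f 0)
      rw [sub_add_cancel] at h2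
      linarith
    have := g.lip_lim h hP hQ ho hn hs mG hG hsum mD hD f hb hL
    have hfm := hL.continuous.measurable.aestronglyMeasurable (μ := P'.map (fun ω => 2 * √(∑' k, G k ω ^ 2)))
    simp only [μs, μ, ProbabilityMeasure.coe_mk]
    rw [integral_map mL.aemeasurable hfm]
    refine this.congr fun n => ?_
    rw [integral_map (mA n).aemeasurable hL.continuous.measurable.aestronglyMeasurable]
  rw [ProbabilityMeasure.tendsto_iff_forall_integral_tendsto] at hw
  have := hw (f.compContinuous ⟨fun x => x ^ 2, by fun_prop⟩)
  simp only [μs, μ, ProbabilityMeasure.coe_mk, BoundedContinuousFunction.compContinuous_apply,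
    ContinuousMap.coe_mk] at this
  have hm : Measurable fun x : ℝ => f (x ^ 2) := (f.continuous.comp (by fun_prop)).measurable
  rw [integral_map mL.aemeasurable hm.aestronglyMeasurable] at this
  have e1 : ∀ ω, (2 * √(∑' k, G k ω ^ 2)) ^ 2 = ∑' k, 4 * G k ω ^ 2 := by
    intro ω
    rw [mul_pow, Real.sq_sqrt (tsum_nonneg fun k => sq_nonneg _), tsum_mul_left]; norm_num
  simp only [e1] at this
  refine this.congr fun n => ?_
  rw [integral_map (mA n).aemeasurable hm.aestronglyMeasurable]

end LimitLaw2

/-- Asymptotic distribution of `n · dcov_β(θₙ)`, `β ∈ (1,2)`, for independent `X, Y` in separable metric spaces isometrically embeddable into separable Hilbert spaces, with `𝒳 × 𝒴` σ-compact, finite `(1+ε)β`-moments and absolute regularity `β(n) = O(n^{-r})`, `r > 6(1+2/ε)`. -/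
theorem dcovBeta_asymptotic_distribution_one_lt_beta
    (β : ℝ) (hβ : β ∈ Set.Ioo (1 : ℝ) 2)
    {X Y : Type*}
    [MetricSpace X] [TopologicalSpace.SeparableSpace X] [MeasurableSpace X] [BorelSpace X]
    [MetricSpace Y] [TopologicalSpace.SeparableSpace Y] [MeasurableSpace Y] [BorelSpace Y]
    [SigmaCompactSpace (X × Y)]
    -- 𝒳 and 𝒴 admit isometric embeddings into separable Hilbert spaces
    {H₁ H₂ : Type*}
    [NormedAddCommGroup H₁] [InnerProductSpace ℝ H₁] [CompleteSpace H₁]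
    [TopologicalSpace.SeparableSpace H₁]
    [NormedAddCommGroup H₂] [InnerProductSpace ℝ H₂] [CompleteSpace H₂]
    [TopologicalSpace.SeparableSpace H₂]
    (φemb : X → H₁) (hφ : ∀ x x' : X, ‖φemb x - φemb x'‖ = dist x x')
    (ψemb : Y → H₂) (hψ : ∀ y y' : Y, ‖ψemb y - ψemb y'‖ = dist y y')
    {Ω : Type*} [MeasurableSpace Ω] (P : Measure Ω) [IsProbabilityMeasure P]
    (Z : ℕ → Ω → X × Y) (hZmeas : ∀ i, Measurable (Z i))
    -- strict stationarity
    (hstat : MeasurePreserving shift (P.map fun ω i => Z i ω) (P.map fun ω i => Z i ω))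
    (θ : Measure (X × Y)) (hθ : θ = P.map (Z 0))
    -- independence of X and Y
    (hindep : θ = (θ.map Prod.fst).prod (θ.map Prod.snd))
    -- finite (1+ε)β-moments
    (ε : ℝ) (hε : 0 < ε) (x₀ : X) (y₀ : Y)
    (hmomX : Integrable (fun x => dist x x₀ ^ ((1 + ε) * β)) (θ.map Prod.fst))
    (hmomY : Integrable (fun y => dist y y₀ ^ ((1 + ε) * β)) (θ.map Prod.snd))
    -- absolute regularity with β(n) = O(n^{-r}), r > 6(1 + 2/ε)
    (habsreg : Tendsto (betaProc P Z) atTop (𝓝 0))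
    (r : ℝ) (hr : 6 * (1 + 2 / ε) < r)
    (C : ℝ) (hmix : ∀ n : ℕ, 1 ≤ n → betaProc P Z n ≤ C * (n : ℝ) ^ (-r)) :
    ∃ (lam : ℕ → ℝ) (φ : ℕ → X × Y → ℝ),
      (∀ k, 0 ≤ lam k) ∧
      (∀ k, Measurable (φ k)) ∧
      -- eigenpairs of the integral operator f ↦ ∫ δ_θ^{(β)}(·,z) f(z) dθ(z)
      (∀ k, ∀ᵐ z ∂θ, ∫ z', deltaTheta (fun a b : X => dist a b ^ β)
          (fun a b : Y => dist a b ^ β) θ z z' * φ k z' ∂θ = lam k * φ k z) ∧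
      (∀ k, lam k ≠ 0 → ∫ z, φ k z ^ 2 ∂θ = 1) ∧
      ∃ (Ω' : Type) (mΩ' : MeasurableSpace Ω') (P' : Measure Ω')
        (_ : IsProbabilityMeasure P') (ζ : ℕ → Ω' → ℝ),
        (∀ k, Measurable (ζ k)) ∧
        -- the ζ_k are centered Gaussian
        (∀ k, ∃ v : ℝ≥0, P'.map (ζ k) = gaussianReal 0 v) ∧
        -- covariance structure determined by the dependence structure of (Z_k)
        (∀ i j, Tendsto
          (fun n : ℕ => (n : ℝ)⁻¹ * ∑ t ∈ Finset.range n, ∑ u ∈ Finset.range n,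
            (∫ ω, φ i (Z t ω) * φ j (Z u ω) ∂P
              - (∫ ω, φ i (Z t ω) ∂P) * (∫ ω, φ j (Z u ω) ∂P)))
          atTop
          (𝓝 (∫ ω', ζ i ω' * ζ j ω' ∂P'
              - (∫ ω', ζ i ω' ∂P') * (∫ ω', ζ j ω' ∂P')))) ∧
        -- convergence in distribution of n · dcov_β(θₙ) to ∑ λ_k ζ_k²
        (∀ f : BoundedContinuousFunction ℝ ℝ,
          Tendsto (fun n : ℕ => ∫ ω,
              f ((n : ℝ) * dcov (fun a b : X => dist a b ^ β)
                (fun a b : Y => dist a b ^ β) (emp Z n ω)) ∂P)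
            atTop (𝓝 (∫ ω', f (∑' k, lam k * ζ k ω' ^ 2) ∂P'))) := by
  have h : MixSeq P Z ε r C := ⟨hZmeas, hstat, hε, hr, hmix⟩
  obtain ⟨H, i1, i2, i3, w, N, K, D, g, hδ, hdcov, mD, hD⟩ :=
    reduction β hβ φemb hφ ψemb hψ P Z θ hθ hindep ε x₀ y₀ hmomX hmomY r C h
  have hw2 : MemLp w 2 θ := by
    rw [hθ]
    exact (memLp_map_measure_iff g.sm.aestronglyMeasurable (hZmeas 0).aemeasurable).2 (g.memLp h 0)
  have : IsProbabilityMeasure θ := by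
    rw [hθ]; exact Measure.isProbabilityMeasure_map (hZmeas 0).aemeasurable
  obtain ⟨e, c, hc0, hc1, -, ho, hInt, hn, hs⟩ := spectral θ w g.sm hw2
  obtain ⟨Q, hP, hQ⟩ := g.lrc h
  have hK : PDK (fun i j => Q (e i) (e j)) :=
    ⟨fun s t => hP.symm _ _, fun n x a => hP.nonneg n (fun i => e (x i)) a⟩
  obtain ⟨Ω', mΩ', P', iP', G, mG, hG⟩ := exists_gauss (fun i j => Q (e i) (e j)) hK
  have hsum : ∀ᵐ ω ∂P', Summable fun k => G k ω ^ 2 :=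
    summable_gauss mG (fun k => (gauss_one hK mG hG k).1) (fun k => (gauss_one hK mG hG k).2.2)
      (g.sum_Q_le h hQ ho hn)
  have mw : ∀ x, Measurable fun z => inner ℝ (w z) x := fun x =>
    (g.sm.inner stronglyMeasurable_const).measurable
  -- vanishing coordinates
  have hz : ∀ k, c k = 0 → ∀ᵐ ω ∂P', G k ω = 0 := by
    intro k hk
    have h1 : ∀ᵐ z ∂θ, inner ℝ (w z) (e k) = 0 := by
      have h2 := hInt k (e k)
      rw [hk, zero_mul] at h2
      have h3 := (integral_eq_zero_iff_of_nonneg (fun z => mul_self_nonneg _)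
        ((hw2.inner_const (e k)).integrable_mul (hw2.inner_const (e k)))).1 h2
      filter_upwards [h3] with z hz
      exact mul_self_eq_zero.1 hz
    have h2 : ∀ t, ∀ᵐ ω ∂P, inner ℝ (w (Z t ω)) (e k) = 0 := by
      intro t
      rw [hθ, ← h.map_eq t] at h1
      exact ae_of_ae_map (hZmeas t).aemeasurable h1
    have h3 : Q (e k) (e k) = 0 := by
      refine tendsto_nhds_unique (hQ (e k) (e k)) ?_
      refine tendsto_const_nhds.congr fun n => ?_
      have : ∫ ω, SS Z w n (e k) ω * SS Z w n (e k) ω ∂P = 0 := by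
        rw [← integral_zero Ω ℝ (μ := P)]
        refine integral_congr_ae ?_
        filter_upwards [ae_all_iff.2 h2] with ω hω
        simp [SS, hω]
      rw [this, mul_zero]
    have h4 := (gauss_one hK mG hG k).2.2
    have h5 := (integral_eq_zero_iff_of_nonneg (fun ω => sq_nonneg _)
      (gauss_one hK mG hG k).1.integrable_sq).1 (h4.trans h3)
    filter_upwards [h5] with ω hω
    exact pow_eq_zero_iff two_ne_zero |>.1 hω
  refine ⟨fun k => 4 * c k, fun k z => (√(c k))⁻¹ * inner ℝ (w z) (e k),
    fun k => mul_nonneg (by norm_num) (hc0 k), fun k => (mw _).const_mul _, fun k => ?_, fun k hk => ?_,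
    Ω', mΩ', P', iP', fun k ω => (√(c k))⁻¹ * G k ω, fun k => (mG k).const_mul _,
    fun k => ⟨_, gauss_smul hG (√(c k))⁻¹ k⟩, fun i j => ?_, fun f => ?_⟩
  · refine Eventually.of_forall fun z => ?_
    have e1 : ∀ z', deltaTheta (fun a b : X => dist a b ^ β) (fun a b : Y => dist a b ^ β) θ z z' *
        ((√(c k))⁻¹ * inner ℝ (w z') (e k)) =
        (4 * (√(c k))⁻¹) * (inner ℝ (w z') (e k) * inner ℝ (w z') (w z)) := by
      intro z'
      rw [hδ, real_inner_comm (w z') (w z)]; ring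
    simp only [e1]
    rw [integral_const_mul, hInt, real_inner_comm (e k) (w z)]; ring
  · have hk' : c k ≠ 0 := fun h0 => hk (by simp [h0])
    have e1 : ∀ z, ((√(c k))⁻¹ * inner ℝ (w z) (e k)) ^ 2 =
        (c k)⁻¹ * (inner ℝ (w z) (e k) * inner ℝ (w z) (e k)) := by
      intro z
      rw [mul_pow, inv_pow, Real.sq_sqrt (hc0 k), sq]
    simp only [e1]
    rw [integral_const_mul, hInt, real_inner_self_eq_norm_sq, hc1 k hk', one_pow, mul_one,
      inv_mul_cancel₀ hk']
  · have eG : ∫ ω, (√(c i))⁻¹ * G i ω * ((√(c j))⁻¹ * G j ω) ∂P' =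
        (√(c i))⁻¹ * (√(c j))⁻¹ * Q (e i) (e j) := by
      rw [← gauss_cov hK mG hG i j, ← integral_const_mul]
      congr 1; ext ω; ring
    have e0 : ∫ ω, (√(c i))⁻¹ * G i ω ∂P' = 0 := by
      rw [integral_const_mul, (gauss_one hK mG hG i).2.1, mul_zero]
    rw [eG, e0, zero_mul, sub_zero]
    refine ((hQ (e i) (e j)).const_mul ((√(c i))⁻¹ * (√(c j))⁻¹)).congr fun n => ?_
    have em : ∀ t, ∫ ω, (√(c i))⁻¹ * inner ℝ (w (Z t ω)) (e i) ∂P = 0 := by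
      intro t
      obtain ⟨N', g'⟩ := g.exists_inner h (e i)
      rw [integral_const_mul, h.integral_eq t g'.sm, g'.mean, mul_zero]
    have mt : ∀ t k, MemLp (fun ω => inner ℝ (w (Z t ω)) (e k)) 2 P := fun t k =>
      (g.memLp h t).inner_const (e k)
    have it : ∀ t u, Integrable
        (fun ω => inner ℝ (w (Z t ω)) (e i) * inner ℝ (w (Z u ω)) (e j)) P := fun t u =>
      (mt t i).integrable_mul (mt u j)
    have ee : ∀ t u, ∫ ω, (√(c i))⁻¹ * inner ℝ (w (Z t ω)) (e i) *
        ((√(c j))⁻¹ * inner ℝ (w (Z u ω)) (e j)) ∂P = (√(c i))⁻¹ * (√(c j))⁻¹ *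
        ∫ ω, inner ℝ (w (Z t ω)) (e i) * inner ℝ (w (Z u ω)) (e j) ∂P := by
      intro t u
      rw [← integral_const_mul]
      congr 1; ext ω; ring
    simp only [em, zero_mul, sub_zero, ee, ← Finset.mul_sum]
    simp only [SS, Finset.sum_mul_sum]
    rw [integral_finsetSum _ fun t _ => integrable_finsetSum _ fun u _ => it t u]
    simp only [integral_finsetSum _ fun u _ => it _ u]
    ring
  · have hlim := g.cont_lim h hP hQ ho hn hs mG hG hsum mD hD f
    have e1 : ∫ ω, f (∑' k, 4 * G k ω ^ 2) ∂P' =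
        ∫ ω, f (∑' k, 4 * c k * ((√(c k))⁻¹ * G k ω) ^ 2) ∂P' := by
      refine integral_congr_ae ?_
      filter_upwards [ae_all_iff.2 fun k => eventually_imp_distrib_left.2 (hz k)] with ω hω
      congr 1
      refine tsum_congr fun k => ?_
      by_cases hk : c k = 0
      · rw [hω k hk, hk]; simp
      · rw [mul_pow, inv_pow, Real.sq_sqrt (hc0 k)]
        field_simp
    rw [← e1]
    refine hlim.congr' ?_
    filter_upwards [eventually_ne_atTop 0] with n hn0
    refine integral_congr_ae (Eventually.of_forall fun ω => ?_)
    simp only [hdcov n hn0 ω]
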